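/- Let D be a field and let k ≥ 1, n ≥ 1. If D is infinite and either (k = 1 and n ≥ 2) or (2 ≤ k ≤ n), then the relative integral group homology H_k(SO_{n+1,n+1}(D), SO_{n,n}(D); Z) vanishes; equivalently, the map H_k(SO_{n,n}(D); Z) → H_k(SO_{n+1,n+1}(D); Z) induced by the hyperbolic embedding is surjective and the induced map in degree k − 1 is injective. If D is a finite field, the same conclusion holds provided n ≥ 2k. -/

import Mathlib

namespace Stmt4

open Finsupp in
/-- The `n`-th differential of the (inhomogeneous) bar complex computing the homology of the
group `G` with trivial coefficients in the commutative ring `R`.  The module of `n`-chains is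
the free `R`-module on `n`-tuples of elements of `G`, and on a basis element
`(g₁, …, g_{n+1})` the differential is
`(g₂,…,g_{n+1}) + ∑ᵢ (-1)ⁱ (g₁,…,gᵢgᵢ₊₁,…,g_{n+1}) + (-1)^{n+1} (g₁,…,g_n)`. -/
noncomputable def barDiff (R : Type) [CommRing R] (G : Type*) [Group G] (n : ℕ) :
    ((Fin (n + 1) → G) →₀ R) →ₗ[R] ((Fin n → G) →₀ R) :=
  Finsupp.lift ((Fin n → G) →₀ R) R (Fin (n + 1) → G) fun c =>
    Finsupp.single (fun j : Fin n => c j.succ) (1 : R)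
      + ∑ i : Fin n, Finsupp.single
          (fun j : Fin n => if (j : ℕ) < (i : ℕ) then c (Fin.castSucc j)
            else if (j : ℕ) = (i : ℕ) then c (Fin.castSucc i) * c i.succ
            else c j.succ) ((-1 : R) ^ ((i : ℕ) + 1))
      + Finsupp.single (fun j : Fin n => c (Fin.castSucc j)) ((-1 : R) ^ (n + 1))

/-- The submodule of `k`-cycles of the bar complex of `G` (with trivial coefficients `R`). -/
noncomputable def barCycles (R : Type) [CommRing R] (G : Type*) [Group G] :
    (k : ℕ) → Submodule R ((Fin k → G) →₀ R)
  | 0 => ⊤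
  | (k + 1) => LinearMap.ker (barDiff R G k)

/-- The submodule of `k`-boundaries of the bar complex of `G`. -/
noncomputable def barBoundaries (R : Type) [CommRing R] (G : Type*) [Group G] (k : ℕ) :
    Submodule R ((Fin k → G) →₀ R) :=
  LinearMap.range (barDiff R G k)

/-- Group homology `H_k(G; R)` with trivial coefficients, defined via the bar complex as the
image of the `k`-cycles in the quotient of the `k`-chains by the `k`-boundaries
(i.e. as `Z_k / B_k`). -/
noncomputable def barHomology (R : Type) [CommRing R] (G : Type*) [Group G] (k : ℕ) :=
  ↥(Submodule.map (barBoundaries R G k).mkQ (barCycles R G k))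

noncomputable instance (R : Type) [CommRing R] (G : Type*) [Group G] (k : ℕ) :
    AddCommGroup (barHomology R G k) :=
  inferInstanceAs (AddCommGroup ↥(Submodule.map (barBoundaries R G k).mkQ (barCycles R G k)))

noncomputable instance (R : Type) [CommRing R] (G : Type*) [Group G] (k : ℕ) :
    Module R (barHomology R G k) :=
  inferInstanceAs (Module R ↥(Submodule.map (barBoundaries R G k).mkQ (barCycles R G k)))

/-- The map induced on bar chains by a map `φ : G' → G` of groups; for a group homomorphism
`φ` this is the usual chain map inducing `H_k(φ) : H_k(G'; R) → H_k(G; R)`. -/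
noncomputable def barMap (R : Type) [CommRing R] {G' G : Type*} [Group G'] [Group G]
    (φ : G' → G) (k : ℕ) : ((Fin k → G') →₀ R) →ₗ[R] ((Fin k → G) →₀ R) :=
  Finsupp.lmapDomain R R fun c => φ ∘ c

/-- The statement that the map `H_k(G'; R) → H_k(G; R)` induced by `φ : G' → G` is
surjective, expressed at the chain level of the bar complexes:  every `k`-cycle of `G` differs
from the image of a `k`-cycle of `G'` by a `k`-boundary. -/
def BarInducedSurj (R : Type) [CommRing R] {G' G : Type*} [Group G'] [Group G]
    (φ : G' → G) (k : ℕ) : Prop :=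
  ∀ z ∈ barCycles R G k, ∃ w ∈ barCycles R G' k,
    z - barMap R φ k w ∈ barBoundaries R G k

/-- The statement that the map `H_k(G'; R) → H_k(G; R)` induced by `φ : G' → G` is
injective, expressed at the chain level of the bar complexes:  a `k`-cycle of `G'` whose image
is a `k`-boundary of `G` is already a `k`-boundary of `G'`. -/
def BarInducedInj (R : Type) [CommRing R] {G' G : Type*} [Group G'] [Group G]
    (φ : G' → G) (k : ℕ) : Prop :=
  ∀ w ∈ barCycles R G' k,
    barMap R φ k w ∈ barBoundaries R G k → w ∈ barBoundaries R G' k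

open Matrix

variable (D : Type) [Field D]

/-- The Gram matrix `H_n = [[0, Iₙ], [Iₙ, 0]]` of the hyperbolic symmetric bilinear form of
Witt index `n` with respect to a hyperbolic basis `e_{−n}, …, e_{−1}, e_1, …, e_n`. -/
def Hmat (n : ℕ) : Matrix (Fin n ⊕ Fin n) (Fin n ⊕ Fin n) D :=
  Matrix.fromBlocks 0 1 1 0

/-- The special orthogonal group
`SO_{n,n}(D) = {A ∈ GL_{2n}(D) : Aᵀ Hₙ A = Hₙ and det A = 1}` of the hyperbolic symmetric
bilinear form of Witt index `n`. -/
def SOGroup (n : ℕ) : Subgroup (GL (Fin n ⊕ Fin n) D) where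
  carrier := {A : GL (Fin n ⊕ Fin n) D |
    (A : Matrix (Fin n ⊕ Fin n) (Fin n ⊕ Fin n) D)ᵀ * Hmat D n *
      (A : Matrix (Fin n ⊕ Fin n) (Fin n ⊕ Fin n) D) = Hmat D n ∧
    (A : Matrix (Fin n ⊕ Fin n) (Fin n ⊕ Fin n) D).det = 1}
  one_mem' := by simp
  mul_mem' := by
    intro a b ha hb
    simp only [Set.mem_setOf_eq, Units.val_mul, Matrix.transpose_mul] at ha hb ⊢
    constructor
    · calc (b : Matrix _ _ D)ᵀ * (a : Matrix _ _ D)ᵀ * Hmat D n *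
            ((a : Matrix _ _ D) * (b : Matrix _ _ D))
          = (b : Matrix _ _ D)ᵀ * ((a : Matrix _ _ D)ᵀ * Hmat D n * (a : Matrix _ _ D)) *
            (b : Matrix _ _ D) := by simp only [Matrix.mul_assoc]
        _ = Hmat D n := by rw [ha.1, hb.1]
    · rw [Matrix.det_mul, ha.2, hb.2, one_mul]
  inv_mem' := by
    intro a ha
    simp only [Set.mem_setOf_eq] at ha ⊢
    constructor
    · calc ((a⁻¹ : GL _ D) : Matrix _ _ D)ᵀ * Hmat D n * ((a⁻¹ : GL _ D) : Matrix _ _ D)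
          = ((a⁻¹ : GL _ D) : Matrix _ _ D)ᵀ *
              ((a : Matrix _ _ D)ᵀ * Hmat D n * (a : Matrix _ _ D)) *
              ((a⁻¹ : GL _ D) : Matrix _ _ D) := by rw [ha.1]
        _ = ((a : Matrix _ _ D) * ((a⁻¹ : GL _ D) : Matrix _ _ D))ᵀ * Hmat D n *
              ((a : Matrix _ _ D) * ((a⁻¹ : GL _ D) : Matrix _ _ D)) := by
            simp only [Matrix.transpose_mul, Matrix.mul_assoc]
        _ = Hmat D n := by rw [Units.mul_inv]; simp
    · have hdet : (a : Matrix (Fin n ⊕ Fin n) (Fin n ⊕ Fin n) D).det *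
          ((a⁻¹ : GL _ D) : Matrix (Fin n ⊕ Fin n) (Fin n ⊕ Fin n) D).det = 1 := by
        rw [← Matrix.det_mul, Units.mul_inv, Matrix.det_one]
      rwa [ha.2, one_mul] at hdet

theorem mem_soGroup_iff (n : ℕ) (A : GL (Fin n ⊕ Fin n) D) :
    A ∈ SOGroup D n ↔
      ((A : Matrix (Fin n ⊕ Fin n) (Fin n ⊕ Fin n) D)ᵀ * Hmat D n *
        (A : Matrix (Fin n ⊕ Fin n) (Fin n ⊕ Fin n) D) = Hmat D n ∧
      (A : Matrix (Fin n ⊕ Fin n) (Fin n ⊕ Fin n) D).det = 1) :=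
  Iff.rfl

/-- The identification of the index sets of the hyperbolic bases, where the two new basis
vectors `e_{−(n+1)}` and `e_{n+1}` are appended at the last position of each of the two
blocks of `n` basis vectors. -/
def sumEquiv (n : ℕ) : ((Fin n ⊕ Fin n) ⊕ (Fin 1 ⊕ Fin 1)) ≃ (Fin (n + 1) ⊕ Fin (n + 1)) where
  toFun := Sum.elim (Sum.map Fin.castSucc Fin.castSucc)
    (Sum.elim (fun _ => Sum.inl (Fin.last n)) (fun _ => Sum.inr (Fin.last n)))
  invFun := Sum.elim
    (fun i => Fin.lastCases (Sum.inr (Sum.inl 0)) (fun j => Sum.inl (Sum.inl j)) i)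
    (fun i => Fin.lastCases (Sum.inr (Sum.inr 0)) (fun j => Sum.inl (Sum.inr j)) i)
  left_inv := by
    rintro ((i | i) | (x | x))
    · simp
    · simp
    · simp only [Sum.elim_inl, Sum.elim_inr, Fin.lastCases_last]
      rw [Subsingleton.elim (0 : Fin 1) x]
    · simp only [Sum.elim_inl, Sum.elim_inr, Fin.lastCases_last]
      rw [Subsingleton.elim (0 : Fin 1) x]
  right_inv := by
    rintro (i | i) <;> induction i using Fin.lastCases <;> simp

/-- The matrix `diag(A, I₂)` extending `A` by the identity on the two new basis vectors
`e_{−(n+1)}`, `e_{n+1}`. -/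
noncomputable def embMat (n : ℕ)
    (A : Matrix (Fin n ⊕ Fin n) (Fin n ⊕ Fin n) D) :
    Matrix (Fin (n + 1) ⊕ Fin (n + 1)) (Fin (n + 1) ⊕ Fin (n + 1)) D :=
  (Matrix.fromBlocks A 0 0 (1 : Matrix (Fin 1 ⊕ Fin 1) (Fin 1 ⊕ Fin 1) D)).submatrix
    (sumEquiv n).symm (sumEquiv n).symm

theorem hmat_decomp (n : ℕ) :
    (Matrix.fromBlocks (Hmat D n) 0 0 (Hmat D 1)).submatrix
      (sumEquiv n).symm (sumEquiv n).symm = Hmat D (n + 1) := by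
  have key : ∀ p q, Matrix.fromBlocks (Hmat D n) 0 0 (Hmat D 1) p q
      = Hmat D (n + 1) (sumEquiv n p) (sumEquiv n q) := by
    rintro ((p | p) | (p | p)) ((q | q) | (q | q)) <;>
      simp [sumEquiv, Hmat, Matrix.one_apply, Fin.castSucc_inj,
        (Fin.castSucc_lt_last _).ne, (Fin.castSucc_lt_last _).ne'] <;>
      exact Subsingleton.elim _ _
  ext x y
  rw [Matrix.submatrix_apply, key, Equiv.apply_symm_apply, Equiv.apply_symm_apply]

/-- The extension-by-the-identity map `GL_{2n}(D) → GL_{2n+2}(D)`. -/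
noncomputable def embGL (n : ℕ) (A : GL (Fin n ⊕ Fin n) D) :
    GL (Fin (n + 1) ⊕ Fin (n + 1)) D where
  val := embMat D n (A : Matrix _ _ D)
  inv := embMat D n ((A⁻¹ : GL _ D) : Matrix _ _ D)
  val_inv := by
    simp only [embMat, Matrix.submatrix_mul_equiv, Matrix.fromBlocks_multiply,
      Matrix.mul_zero, Matrix.zero_mul, Matrix.mul_one, Matrix.one_mul, add_zero, zero_add,
      Units.mul_inv, Matrix.fromBlocks_one, Matrix.submatrix_one_equiv]
  inv_val := by
    simp only [embMat, Matrix.submatrix_mul_equiv, Matrix.fromBlocks_multiply,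
      Matrix.mul_zero, Matrix.zero_mul, Matrix.mul_one, Matrix.one_mul, add_zero, zero_add,
      Units.inv_mul, Matrix.fromBlocks_one, Matrix.submatrix_one_equiv]

/-- The hyperbolic embedding `SO_{n,n}(D) → SO_{n+1,n+1}(D)`, acting as `A` on the old basis
vectors and fixing the two new hyperbolic basis vectors `e_{−(n+1)}` and `e_{n+1}`. -/
noncomputable def embSO (n : ℕ) (A : ↥(SOGroup D n)) : ↥(SOGroup D (n + 1)) :=
  ⟨embGL D n ↑A, by
    have hA := (mem_soGroup_iff D n ↑A).1 A.2
    rw [mem_soGroup_iff]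
    constructor
    · show (embMat D n (((A : GL (Fin n ⊕ Fin n) D) : Matrix _ _ D)))ᵀ * Hmat D (n + 1) *
          embMat D n (((A : GL (Fin n ⊕ Fin n) D) : Matrix _ _ D)) = Hmat D (n + 1)
      rw [← hmat_decomp D n]
      simp only [embMat, Matrix.transpose_submatrix, Matrix.fromBlocks_transpose,
        Matrix.submatrix_mul_equiv, Matrix.fromBlocks_multiply]
      simp [hA.1]
    · show (embMat D n (((A : GL (Fin n ⊕ Fin n) D) : Matrix _ _ D))).det = 1
      rw [embMat, Matrix.det_submatrix_equiv_self, Matrix.det_fromBlocks_zero₂₁]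
      simp [hA.2]⟩

set_option linter.all false
section P1

/-! ### Tuples, bar chains -/

/-- Tuples of length `q`, as an inductive family. -/
inductive Tup (G : Type) : ℕ → Type
  | tn : Tup G 0
  | tc {q : ℕ} (k : G) (g : Tup G q) : Tup G (q + 1)

open Tup

theorem tup_zero {G : Type} (g : Tup G 0) : g = tn := by cases g; rfl
theorem tup_succ {G : Type} {q : ℕ} (g : Tup G (q + 1)) : ∃ k g', g = tc k g' := by
  cases g with
  | tc k g => exact ⟨k, g, rfl⟩

/-- A group together with a module. -/
structure GM where
  G : Type
  [grp : Group G]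
  M : Type
  [acg : AddCommGroup M]
  ρ : G → M →+ M
  ρ_one : ∀ m, ρ 1 m = m
  ρ_mul : ∀ g h m, ρ (g * h) m = ρ g (ρ h m)

attribute [instance] GM.grp GM.acg

/-- Morphisms of pairs (group, module). -/
structure GHom (A B : GM) where
  f : A.G →* B.G
  φ : A.M →+ B.M
  h : ∀ g m, φ (A.ρ g m) = B.ρ (f g) (φ m)

namespace GHom
def id (A : GM) : GHom A A := ⟨MonoidHom.id _, AddMonoidHom.id _, fun _ _ => rfl⟩
def comp {A B C : GM} (F : GHom B C) (E : GHom A B) : GHom A C :=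
  ⟨F.f.comp E.f, F.φ.comp E.φ, fun g m => by simp [E.h, F.h]⟩
theorem ext' {A B : GM} {F E : GHom A B} (h1 : ∀ g, F.f g = E.f g) (h2 : ∀ m, F.φ m = E.φ m) :
    F = E := by
  cases F; cases E
  congr
  · exact MonoidHom.ext h1
  · exact AddMonoidHom.ext h2
end GHom

abbrev Ch (A : GM) (q : ℕ) : Type := Tup A.G q →₀ A.M

section gen
variable {G G' : Type} {M M' : Type} [AddCommGroup M] [AddCommGroup M']

/-- linear extension -/
noncomputable def lin {X N : Type} [AddCommGroup N] (F : X → M →+ N) : (X →₀ M) →+ N :=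
  Finsupp.liftAddHom F

@[simp] theorem lin_single {X N : Type} [AddCommGroup N] (F : X → M →+ N) (x : X) (m : M) :
    lin F (Finsupp.single x m) = F x m := by simp [lin]

/-- `single` as a hom -/
noncomputable def sg {X : Type} (x : X) : M →+ (X →₀ M) := Finsupp.singleAddHom x

@[simp] theorem sg_apply {X : Type} (x : X) (m : M) : sg x m = Finsupp.single x m := rfl

theorem hom_ext {X N : Type} [AddCommGroup N] {F E : (X →₀ M) →+ N}
    (h : ∀ x m, F (Finsupp.single x m) = E (Finsupp.single x m)) : F = E :=
  Finsupp.addHom_ext h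

theorem hom_ext_apply {X N : Type} [AddCommGroup N] (F E : (X →₀ M) →+ N)
    (h : ∀ x m, F (Finsupp.single x m) = E (Finsupp.single x m)) (c : X →₀ M) : F c = E c :=
  DFunLike.congr_fun (hom_ext h) c

/-- prepend `k` -/
noncomputable def consL {q : ℕ} (k : G) : (Tup G q →₀ M) →+ (Tup G (q + 1) →₀ M) :=
  lin fun g => sg (tc k g)

@[simp] theorem consL_single {q : ℕ} (k : G) (g : Tup G q) (m : M) :
    consL k (Finsupp.single g m) = Finsupp.single (tc k g) m := by
  simp [consL]

variable [Group G] [Group G']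

/-- the passive part of the bar differential -/
noncomputable def E0 : ∀ {q : ℕ}, Tup G (q + 1) → M →+ (Tup G q →₀ M)
  | 0, _ => -(sg tn)
  | (_ + 1), tc k (tc l g) => -(sg (tc (k * l) g)) - (consL k).comp (E0 (tc l g))

noncomputable def EL {q : ℕ} : (Tup G (q + 1) →₀ M) →+ (Tup G q →₀ M) := lin E0

theorem EL_zero (k : G) (c : Tup G 0 →₀ M) : EL (consL k c) = - c := by
  refine hom_ext_apply (EL.comp (consL k)) (- AddMonoidHom.id _) (fun g m => ?_) c
  simp [EL, E0, tup_zero g]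

theorem EL_cons {q : ℕ} (k l : G) (c : Tup G q →₀ M) :
    EL (q := q + 1) (consL k (consL l c)) = - consL (k * l) c - consL k (EL (consL l c)) := by
  refine hom_ext_apply ((EL.comp (consL k)).comp (consL l))
    (- consL (k * l) - ((consL k).comp EL).comp (consL l)) (fun g m => ?_) c
  rw [AddMonoidHom.comp_apply, AddMonoidHom.comp_apply, consL_single, consL_single]
  show lin E0 (Finsupp.single _ m) = _
  rw [lin_single]
  simp only [AddMonoidHom.sub_apply, AddMonoidHom.comp_apply, AddMonoidHom.neg_apply, consL_single,
    EL, lin_single]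
  rfl

/-- key identity `e(kl::g) + e(k::e(l::g)) = 0` -/
theorem EL_EL : ∀ {q : ℕ} (k l : G) (c : Tup G q →₀ M),
    EL (consL (k * l) c) + EL (consL k (EL (consL l c))) = 0
  | 0, k, l, c => by
    simp [EL_zero]
  | (q + 1), k, l, c => by
    refine hom_ext_apply (EL.comp (consL (k * l)) + (EL.comp (consL k)).comp (EL.comp (consL l))) 0
      (fun g m => ?_) c
    obtain ⟨a, g, rfl⟩ := tup_succ g
    have ih2 := congrArg (consL k) (EL_EL l a (Finsupp.single g m))
    simp only [map_add, map_zero] at ih2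
    rw [← consL_single]
    simp only [AddMonoidHom.add_apply, AddMonoidHom.comp_apply, AddMonoidHom.zero_apply, EL_cons,
      map_sub, map_neg, mul_assoc]
    rw [← sub_eq_zero.mpr ih2]
    abel

end gen

/-! ### The bar complex with coefficients -/
section bar
variable {A B C : GM}

/-- the active part of the bar differential -/
noncomputable def FL (A : GM) {q : ℕ} : Ch A (q + 1) →+ Ch A q :=
  lin fun g => match g with
    | tc k g => (sg g).comp (A.ρ k⁻¹)

/-- action on coefficients only -/
noncomputable def actL (A : GM) {q : ℕ} (g : A.G) : Ch A q →+ Ch A q :=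
  lin fun w => (sg w).comp (A.ρ g)

theorem FL_cons {q : ℕ} (k : A.G) (c : Ch A q) : FL A (consL k c) = actL A k⁻¹ c := by
  refine hom_ext_apply ((FL A).comp (consL k)) (actL A k⁻¹) (fun g m => ?_) c
  simp only [AddMonoidHom.comp_apply, consL_single, FL, actL, lin_single]

theorem actL_mul {q : ℕ} (k l : A.G) (c : Ch A q) : actL A (k * l) c = actL A k (actL A l c) := by
  refine hom_ext_apply (actL A (k * l)) ((actL A k).comp (actL A l)) (fun g m => ?_) c
  simp [actL, A.ρ_mul, A.ρ_one]

theorem actL_one {q : ℕ} (c : Ch A q) : actL A 1 c = c := by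
  refine hom_ext_apply (actL A 1) (AddMonoidHom.id _) (fun g m => ?_) c
  simp [actL, A.ρ_mul, A.ρ_one]

theorem actL_cons {q : ℕ} (k l : A.G) (c : Ch A q) :
    actL A k (consL l c) = consL l (actL A k c) := by
  refine hom_ext_apply ((actL A k).comp (consL l)) ((consL l).comp (actL A k)) (fun g m => ?_) c
  simp [actL, A.ρ_mul, A.ρ_one]

theorem chain_ext {q : ℕ} {N : Type} [AddCommGroup N] {P Q : Ch A (q + 1) →+ N}
    (h : ∀ k (c : Ch A q), P (consL k c) = Q (consL k c)) (c : Ch A (q + 1)) : P c = Q c := by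
  refine hom_ext_apply P Q (fun g m => ?_) c
  obtain ⟨a, g, rfl⟩ := tup_succ g
  rw [← consL_single, h]

theorem actL_EL {q : ℕ} (k : A.G) (c : Ch A (q + 1)) : actL A k (EL c) = EL (actL A k c) := by
  induction q with
  | zero =>
    refine chain_ext (A := A) (P := (actL A k).comp EL) (Q := EL.comp (actL A k)) (fun l c => ?_) c
    simp [EL_zero, actL_cons]
  | succ q ih =>
    refine chain_ext (A := A) (P := (actL A k).comp EL) (Q := EL.comp (actL A k)) (fun l c => ?_) c
    refine chain_ext (A := A) (P := (actL A k).comp (EL.comp (consL l)))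
      (Q := EL.comp ((actL A k).comp (consL l))) (fun l' c => ?_) c
    simp only [AddMonoidHom.comp_apply, EL_cons, actL_cons, map_sub, map_neg, ih]

/-- the bar differential -/
noncomputable def dd (A : GM) {q : ℕ} : Ch A (q + 1) →+ Ch A q := FL A + EL

theorem dd_cons {q : ℕ} (k : A.G) (c : Ch A q) :
    dd A (consL k c) = actL A k⁻¹ c + EL (consL k c) := by
  simp [dd, FL_cons]

theorem dd_dd {q : ℕ} (c : Ch A (q + 2)) : dd A (dd A c) = 0 := by
  refine chain_ext (P := (dd A).comp (dd A)) (Q := 0) (fun l c => ?_) c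
  refine chain_ext (P := (dd A).comp ((dd A).comp (consL l))) (Q := 0) (fun k c => ?_) c
  have := EL_EL l k c
  simp only [AddMonoidHom.comp_apply, AddMonoidHom.zero_apply, EL_cons,
    map_sub, map_neg, dd_cons, _root_.mul_inv_rev, actL_mul, map_add, actL_cons, actL_EL]
  rw [eq_neg_of_add_eq_zero_left this]
  abel

/-- map on tuples -/
def tmap {G G' : Type} (f : G → G') : ∀ {q : ℕ}, Tup G q → Tup G' q
  | 0, _ => tn
  | (_ + 1), tc k g => tc (f k) (tmap f g)

theorem tmap_comp {G G' G'' : Type} (f : G → G') (f' : G' → G'') {q : ℕ} (g : Tup G q) :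
    tmap f' (tmap f g) = tmap (fun x => f' (f x)) g := by
  induction g with
  | tn => rfl
  | tc k g ih => simp [tmap, ih]

theorem tmap_id {G : Type} {q : ℕ} (g : Tup G q) : tmap (fun x => x) g = g := by
  induction g with
  | tn => rfl
  | tc k g ih => simp [tmap, ih]

theorem tmap_inj {G G' : Type} {f : G → G'} (hf : Function.Injective f) {q : ℕ} :
    Function.Injective (tmap f : Tup G q → Tup G' q) := by
  intro g
  induction g with
  | tn => intro g' _; exact (tup_zero g').symm
  | tc k g ih =>
    intro g' h
    obtain ⟨k', g', rfl⟩ := tup_succ g'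
    simp only [tmap, Tup.tc.injEq, heq_eq_eq, true_and] at h
    rw [hf h.1, ih h.2]

/-- map on chains -/
noncomputable def mapC (F : GHom A B) {q : ℕ} : Ch A q →+ Ch B q :=
  lin fun g => (sg (tmap F.f g)).comp F.φ

@[simp] theorem mapC_single (F : GHom A B) {q : ℕ} (g : Tup A.G q) (m : A.M) :
    mapC F (Finsupp.single g m) = Finsupp.single (tmap F.f g) (F.φ m) := by simp [mapC]

theorem mapC_cons (F : GHom A B) {q : ℕ} (k : A.G) (c : Ch A q) :
    mapC F (consL k c) = consL (F.f k) (mapC F c) := by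
  refine hom_ext_apply ((mapC F).comp (consL k)) ((consL (F.f k)).comp (mapC F)) (fun g m => ?_) c
  simp [tmap]

theorem mapC_act (F : GHom A B) {q : ℕ} (k : A.G) (c : Ch A q) :
    mapC F (actL A k c) = actL B (F.f k) (mapC F c) := by
  refine hom_ext_apply ((mapC F).comp (actL A k)) ((actL B (F.f k)).comp (mapC F)) (fun g m => ?_) c
  simp [actL, F.h]

theorem mapC_EL (F : GHom A B) {q : ℕ} (c : Ch A (q + 1)) : mapC F (EL c) = EL (mapC F c) := by
  induction q with
  | zero =>
    refine chain_ext (A := A) (P := (mapC F).comp EL) (Q := EL.comp (mapC F)) (fun l c => ?_) c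
    simp [EL_zero, mapC_cons]
  | succ q ih =>
    refine chain_ext (A := A) (P := (mapC F).comp EL) (Q := EL.comp (mapC F)) (fun l c => ?_) c
    refine chain_ext (A := A) (P := (mapC F).comp (EL.comp (consL l)))
      (Q := EL.comp ((mapC F).comp (consL l))) (fun l' c => ?_) c
    simp only [AddMonoidHom.comp_apply, EL_cons, mapC_cons, map_sub, map_neg, ih, map_mul]

theorem mapC_dd (F : GHom A B) {q : ℕ} (c : Ch A (q + 1)) :
    mapC F (dd A c) = dd B (mapC F c) := by
  refine chain_ext (A := A) (P := (mapC F).comp (dd A)) (Q := (dd B).comp (mapC F))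
    (fun l c => ?_) c
  simp [dd_cons, mapC_cons, mapC_act, mapC_EL]

theorem mapC_comp (F : GHom B C) (E : GHom A B) {q : ℕ} (c : Ch A q) :
    mapC (F.comp E) c = mapC F (mapC E c) := by
  refine hom_ext_apply (mapC (F.comp E)) ((mapC F).comp (mapC E)) (fun g m => ?_) c
  simp [GHom.comp, tmap_comp]
  rfl

theorem mapC_id {q : ℕ} (c : Ch A q) : mapC (GHom.id A) c = c := by
  refine hom_ext_apply (mapC (GHom.id A)) (AddMonoidHom.id _) (fun g m => ?_) c
  simp only [GHom.id, mapC_single, AddMonoidHom.id_apply]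
  congr 1
  exact tmap_id g

/-! ### homology -/

/-- cycles -/
noncomputable def cyc (A : GM) : ∀ i : ℕ, AddSubgroup (Ch A i)
  | 0 => ⊤
  | (_ + 1) => (dd A).ker

theorem cyc_zero (c : Ch A 0) : c ∈ cyc A 0 := trivial
theorem cyc_succ {i : ℕ} (c : Ch A (i + 1)) : c ∈ cyc A (i + 1) ↔ dd A c = 0 := Iff.rfl

theorem dd_mem_cyc {i : ℕ} (c : Ch A (i + 1)) : dd A c ∈ cyc A i := by
  cases i with
  | zero => trivial
  | succ i => exact dd_dd c

theorem mapC_cyc (F : GHom A B) {i : ℕ} {c : Ch A i} (h : c ∈ cyc A i) : mapC F c ∈ cyc B i := by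
  cases i with
  | zero => trivial
  | succ i =>
    rw [cyc_succ] at h ⊢
    rw [← mapC_dd, h, map_zero]

/-- group homology -/
def H (A : GM) (i : ℕ) : Type := cyc A i ⧸ (dd A (q := i)).range.addSubgroupOf (cyc A i)

noncomputable instance (A : GM) (i : ℕ) : AddCommGroup (H A i) :=
  inferInstanceAs (AddCommGroup (cyc A i ⧸ (dd A (q := i)).range.addSubgroupOf (cyc A i)))

/-- class of a cycle -/
noncomputable def cls {i : ℕ} : cyc A i →+ H A i := QuotientAddGroup.mk' _

theorem cls_surj {i : ℕ} (y : H A i) : ∃ z, ∃ hz : z ∈ cyc A i, cls ⟨z, hz⟩ = y := by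
  obtain ⟨⟨z, hz⟩, h⟩ := QuotientAddGroup.mk'_surjective _ y
  exact ⟨z, hz, h⟩

theorem cls_eq_zero {i : ℕ} {z : Ch A i} {hz : z ∈ cyc A i} :
    cls ⟨z, hz⟩ = 0 ↔ ∃ b, dd A b = z := by
  unfold cls
  refine (QuotientAddGroup.eq_zero_iff _).trans ?_
  rw [AddSubgroup.mem_addSubgroupOf]
  rfl

theorem cls_eq {i : ℕ} {z z' : Ch A i} {hz : z ∈ cyc A i} {hz' : z' ∈ cyc A i} :
    cls ⟨z, hz⟩ = cls ⟨z', hz'⟩ ↔ ∃ b, dd A b = z - z' := by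
  rw [← sub_eq_zero, ← map_sub]
  exact cls_eq_zero

/-- induced map in homology -/
noncomputable def Hm (F : GHom A B) (i : ℕ) : H A i →+ H B i :=
  QuotientAddGroup.lift _ (cls.comp (((mapC F).comp (cyc A i).subtype).codRestrict (cyc B i)
    (fun c => mapC_cyc F c.2))) (by
    rintro ⟨z, hz⟩ h
    obtain ⟨b, hb⟩ := AddSubgroup.mem_addSubgroupOf.1 h
    refine cls_eq_zero.2 ⟨mapC F b, ?_⟩
    rw [← mapC_dd, hb]; rfl)

theorem Hm_cls (F : GHom A B) {i : ℕ} {z : Ch A i} (hz : z ∈ cyc A i) :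
    Hm F i (cls ⟨z, hz⟩) = cls ⟨mapC F z, mapC_cyc F hz⟩ := rfl

theorem Hm_comp (F : GHom B C) (E : GHom A B) {i : ℕ} (y : H A i) :
    Hm (F.comp E) i y = Hm F i (Hm E i y) := by
  obtain ⟨z, hz, rfl⟩ := cls_surj y
  simp only [Hm_cls, mapC_comp]

theorem Hm_id {i : ℕ} (y : H A i) : Hm (GHom.id A) i y = y := by
  obtain ⟨z, hz, rfl⟩ := cls_surj y
  simp only [Hm_cls, mapC_id]

end bar

end P1

section P2
open Tup
/-! ### gauge transformations -/

/-- a set with a left action (explicit) -/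
structure GAct (G : Type) [Group G] (X : Type) where
  act : G → X → X
  one : ∀ x, act 1 x = x
  mul : ∀ g h x, act (g * h) x = act g (act h x)

theorem GAct.inv_act {G : Type} [Group G] {X : Type} (a : GAct G X) (g : G) (x : X) :
    a.act g⁻¹ (a.act g x) = x := by rw [← a.mul, inv_mul_cancel, a.one]
theorem GAct.act_inv {G : Type} [Group G] {X : Type} (a : GAct G X) (g : G) (x : X) :
    a.act g (a.act g⁻¹ x) = x := by rw [← a.mul, mul_inv_cancel, a.one]

section gauge
variable {A : GM} {X : Type} (a : GAct A.G X)

/-- `X →₀ M` with diagonal action -/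
noncomputable abbrev labM : GM where
  G := A.G
  M := X →₀ A.M
  ρ g := lin fun x => (sg (a.act g x)).comp (A.ρ g)
  ρ_one m := by
    refine hom_ext_apply _ (AddMonoidHom.id _) (fun x m => ?_) m
    simp [a.one, A.ρ_one]
  ρ_mul g h m := by
    refine hom_ext_apply (lin fun x => (sg (a.act (g * h) x)).comp (A.ρ (g * h)))
      ((lin fun x => (sg (a.act g x)).comp (A.ρ g)).comp
        (lin fun x => (sg (a.act h x)).comp (A.ρ h))) (fun x m => ?_) m
    simp [a.mul, A.ρ_mul]

/-- sum over the labels -/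
noncomputable def sumM : GHom (labM a) A where
  f := MonoidHom.id _
  φ := lin fun _ => AddMonoidHom.id _
  h g m := by
    refine hom_ext_apply ((lin fun _ => AddMonoidHom.id _).comp ((labM a).ρ g))
      ((A.ρ g).comp (lin fun _ => AddMonoidHom.id _)) (fun x m => ?_) m
    simp

/-- label chains by `x` -/
noncomputable def emb (x : X) {q : ℕ} : Ch A q →+ Ch (labM a) q :=
  lin fun g => (sg (X := Tup A.G q) g).comp (sg (X := X) x)

theorem emb_ext {q : ℕ} {N : Type} [AddCommGroup N] {P Q : Ch (labM a) q →+ N}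
    (h : ∀ x (c : Ch A q), P (emb a x c) = Q (emb a x c)) (c : Ch (labM a) q) : P c = Q c := by
  refine hom_ext_apply P Q (fun g m => ?_) c
  refine hom_ext_apply (P.comp (sg g)) (Q.comp (sg g)) (fun x m => ?_) m
  have := h x (Finsupp.single g m)
  simpa [emb] using this

theorem emb_cons (x : X) {q : ℕ} (k : A.G) (c : Ch A q) :
    emb a x (consL k c) = consL (G := A.G) k (emb a x c) := by
  refine hom_ext_apply ((emb a x).comp (consL k))
    (AddMonoidHom.comp (consL (G := A.G) k) (emb a x)) (fun g m => ?_) c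
  simp [emb]

theorem emb_act (x : X) {q : ℕ} (k : A.G) (c : Ch A q) :
    actL (labM a) k (emb a x c) = emb a (a.act k x) (actL A k c) := by
  refine hom_ext_apply (AddMonoidHom.comp (actL (labM a) k) (emb a x))
    ((emb a (a.act k x)).comp (actL A k)) (fun g m => ?_) c
  simp [emb, actL, labM]

theorem emb_EL (x : X) {q : ℕ} (c : Ch A (q + 1)) : emb a x (EL c) = EL (G := A.G) (emb a x c) := by
  induction q with
  | zero =>
    refine chain_ext (A := A) (P := (emb a x).comp EL)
      (Q := AddMonoidHom.comp (EL (G := A.G)) (emb a x)) (fun l c => ?_) c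
    rw [AddMonoidHom.comp_apply, AddMonoidHom.comp_apply, EL_zero, map_neg]
    exact ((congrArg (EL (G := A.G)) (emb_cons a x l c)).trans
      (EL_zero (G := A.G) l (emb a x c))).symm
  | succ q ih =>
    refine chain_ext (A := A) (P := (emb a x).comp EL)
      (Q := AddMonoidHom.comp (EL (G := A.G)) (emb a x)) (fun l c => ?_) c
    refine chain_ext (A := A) (P := (emb a x).comp (EL.comp (consL l)))
      (Q := AddMonoidHom.comp (EL (G := A.G)) ((emb a x).comp (consL l))) (fun l' c => ?_) c
    simp only [AddMonoidHom.comp_apply, EL_cons, emb_cons, map_sub, map_neg, ih]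

theorem emb_dd_cons (x : X) {q : ℕ} (k : A.G) (c : Ch A q) :
    dd (labM a) (emb a x (consL k c)) =
      emb a (a.act k⁻¹ x) (actL A k⁻¹ c) + emb a x (EL (consL k c)) := by
  rw [emb_cons]
  refine (dd_cons (A := labM a) k _).trans ?_
  rw [← emb_act, emb_EL, emb_cons]

variable (c : X → A.G)

/-- gauge transformed word -/
noncomputable def gw : ∀ {q : ℕ}, X → Tup A.G q → Tup A.G q
  | 0, _, _ => tn
  | (_ + 1), x, tc k g => tc ((c x)⁻¹ * k * c (a.act k⁻¹ x)) (gw (a.act k⁻¹ x) g)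

/-- prism operator -/
noncomputable def sw {M : Type} [AddCommGroup M] :
    ∀ {q : ℕ}, X → Tup A.G q → M →+ (Tup A.G (q + 1) →₀ M)
  | 0, x, _ => sg (tc (c x) tn)
  | (_ + 1), x, tc k g => sg (tc (c x) (gw a c x (tc k g))) - (consL k).comp (sw (a.act k⁻¹ x) g)

noncomputable def gL (x : X) {q : ℕ} : Ch A q →+ Ch A q := lin fun g => sg (gw a c x g)
noncomputable def sL (x : X) {q : ℕ} : Ch A q →+ Ch A (q + 1) := lin fun g => sw a c x g

theorem gL_zero (x : X) (z : Ch A 0) : gL a c x z = z := by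
  refine hom_ext_apply (gL a c x) (AddMonoidHom.id _) (fun g m => ?_) z
  simp [gL, tup_zero g, gw]

theorem gL_cons (x : X) {q : ℕ} (k : A.G) (z : Ch A q) : gL a c x (consL k z) =
    consL ((c x)⁻¹ * k * c (a.act k⁻¹ x)) (gL a c (a.act k⁻¹ x) z) := by
  refine hom_ext_apply ((gL a c x).comp (consL k))
    ((consL ((c x)⁻¹ * k * c (a.act k⁻¹ x))).comp (gL a c (a.act k⁻¹ x))) (fun g m => ?_) z
  simp [gL, gw]

theorem sL_zero (x : X) (z : Ch A 0) : sL a c x z = consL (c x) z := by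
  refine hom_ext_apply (sL a c x) (consL (c x)) (fun g m => ?_) z
  simp [sL, tup_zero g, sw]

theorem sL_cons (x : X) {q : ℕ} (k : A.G) (z : Ch A q) : sL a c x (consL k z) =
    consL (c x) (gL a c x (consL k z)) - consL k (sL a c (a.act k⁻¹ x) z) := by
  refine hom_ext_apply ((sL a c x).comp (consL k))
    ((consL (c x)).comp ((gL a c x).comp (consL k)) - (consL k).comp (sL a c (a.act k⁻¹ x)))
    (fun g m => ?_) z
  simp [sL, gL, sw]

theorem gL_EL (x : X) {q : ℕ} (z : Ch A (q + 1)) : gL a c x (EL z) = EL (gL a c x z) := by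
  induction q generalizing x with
  | zero =>
    refine chain_ext (A := A) (P := (gL a c x).comp EL)
      (Q := EL.comp (gL a c x)) (fun l z => ?_) z
    simp only [AddMonoidHom.comp_apply, EL_zero, gL_cons, map_neg, gL_zero]
  | succ q ih =>
    refine chain_ext (A := A) (P := (gL a c x).comp EL)
      (Q := EL.comp (gL a c x)) (fun l z => ?_) z
    refine chain_ext (A := A) (P := (gL a c x).comp (EL.comp (consL l)))
      (Q := EL.comp ((gL a c x).comp (consL l))) (fun l' z => ?_) z
    simp only [AddMonoidHom.comp_apply, EL_cons, gL_cons, map_sub, map_neg, ih, _root_.mul_inv_rev, a.mul]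
    congr 3
    congr 1
    group

theorem sL_EL (x : X) {q : ℕ} (z : Ch A (q + 1)) :
    EL (sL a c x z) + sL a c x (EL z) = - z := by
  induction q generalizing x with
  | zero =>
    refine chain_ext (A := A) (P := EL.comp (sL a c x) + (sL a c x).comp EL)
      (Q := - AddMonoidHom.id _) (fun l z => ?_) z
    simp only [AddMonoidHom.comp_apply, AddMonoidHom.add_apply, AddMonoidHom.neg_apply,
      AddMonoidHom.id_apply, EL_zero, EL_cons, gL_cons, map_neg, map_sub, gL_zero, sL_zero, sL_cons]
    simp only [mul_assoc, mul_inv_cancel_left]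
    abel
  | succ q ih =>
    refine chain_ext (A := A) (P := EL.comp (sL a c x) + (sL a c x).comp EL)
      (Q := - AddMonoidHom.id _) (fun k z => ?_) z
    refine chain_ext (A := A)
      (P := (EL.comp (sL a c x) + (sL a c x).comp EL).comp (consL k))
      (Q := - (consL k)) (fun l z => ?_) z
    have ih2 := congrArg (consL k) (ih (a.act k⁻¹ x) (consL l z))
    have h3 := gL_EL a c x (consL k (consL l z))
    have h4 := congrArg (consL (c x)) h3
    simp only [AddMonoidHom.comp_apply, AddMonoidHom.add_apply, AddMonoidHom.neg_apply,
      EL_cons, map_neg, map_sub, sL_cons, map_add, gL_cons, _root_.mul_inv_rev, a.mul] at ih2 h4 ⊢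
    simp only [mul_assoc, mul_inv_cancel_left] at ih2 h4 ⊢
    rw [← sub_eq_zero] at ih2 h4 ⊢
    rw [← add_zero (0 : Ch A (q + 1 + 1))]
    nth_rewrite 1 [← ih2]
    rw [← h4]
    abel

theorem sL_act (x : X) {q : ℕ} (k : A.G) (z : Ch A q) :
    sL a c x (actL A k z) = actL A k (sL a c x z) := by
  have gact : ∀ (x : X) {q : ℕ} (z : Ch A q), gL a c x (actL A k z) = actL A k (gL a c x z) := by
    intro x q z
    refine hom_ext_apply ((gL a c x).comp (actL A k)) ((actL A k).comp (gL a c x)) (fun g m => ?_) z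
    simp [gL, actL]
  induction q generalizing x with
  | zero => simp only [sL_zero, actL_cons]
  | succ q ih =>
    refine chain_ext (A := A) (P := (sL a c x).comp (actL A k))
      (Q := (actL A k).comp (sL a c x)) (fun l z => ?_) z
    simp only [AddMonoidHom.comp_apply, actL_cons, sL_cons, gL_cons, map_sub, gact, ih]

/-- total gauge map -/
noncomputable def PhiX {q : ℕ} : Ch (labM a) q →+ Ch A q :=
  lin fun g => lin fun x => (sg (gw a c x g)).comp (A.ρ (c x)⁻¹)
noncomputable def SX {q : ℕ} : Ch (labM a) q →+ Ch A (q + 1) :=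
  lin fun g => lin fun x => sw a c x g

theorem PhiX_emb (x : X) {q : ℕ} (z : Ch A q) :
    PhiX a c (emb a x z) = actL A (c x)⁻¹ (gL a c x z) := by
  refine hom_ext_apply ((PhiX a c).comp (emb a x))
    ((actL A (c x)⁻¹).comp (gL a c x)) (fun g m => ?_) z
  simp [PhiX, emb, actL, gL]

theorem SX_emb (x : X) {q : ℕ} (z : Ch A q) :
    SX a c (emb a x z) = sL a c x z := by
  refine hom_ext_apply ((SX a c).comp (emb a x)) (sL a c x) (fun g m => ?_) z
  simp [SX, emb, sL]

theorem sumM_emb (x : X) {q : ℕ} (z : Ch A q) :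
    mapC (sumM a) (emb a x z) = z := by
  refine hom_ext_apply ((mapC (sumM a)).comp (emb a x)) (AddMonoidHom.id _) (fun g m => ?_) z
  simp only [AddMonoidHom.comp_apply, emb, lin_single, sg_apply, AddMonoidHom.id_apply]
  rw [mapC_single]
  simp only [sumM, lin_single, AddMonoidHom.id_apply]
  congr 1
  exact tmap_id g

theorem homotopy_zero (z : Ch (labM a) 0) :
    dd A (SX a c z) = PhiX a c z - mapC (sumM a) z := by
  refine emb_ext a (P := (dd A).comp (SX a c)) (Q := PhiX a c - mapC (sumM a)) (fun x z => ?_) z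
  simp only [AddMonoidHom.comp_apply, AddMonoidHom.sub_apply, SX_emb, sL_zero, PhiX_emb, sumM_emb,
    gL_zero, dd_cons, EL_zero]
  abel

theorem homotopy_succ {q : ℕ} (z : Ch (labM a) (q + 1)) :
    dd A (SX a c z) + SX a c (dd (labM a) z) = PhiX a c z - mapC (sumM a) z := by
  refine emb_ext a (P := (dd A).comp (SX a c) + (SX a c).comp (dd (labM a)))
    (Q := PhiX a c - mapC (sumM a)) (fun x z => ?_) z
  refine chain_ext (A := A)
    (P := ((dd A).comp (SX a c) + (SX a c).comp (dd (labM a))).comp (emb a x))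
    (Q := (PhiX a c - mapC (sumM a)).comp (emb a x)) (fun k z => ?_) z
  have h1 := sL_EL a c x (consL k z)
  simp only [AddMonoidHom.comp_apply, AddMonoidHom.sub_apply, AddMonoidHom.add_apply, SX_emb,
    sL_cons, PhiX_emb, sumM_emb, emb_dd_cons, map_add, map_sub, dd_cons] at h1 ⊢
  have h2 := sL_act a c (a.act k⁻¹ x) k⁻¹ z
  rw [← sub_eq_zero] at h1 h2 ⊢
  rw [← add_zero (0 : Ch A (q + 1))]
  nth_rewrite 1 [← h1]
  rw [← h2]
  abel

theorem phi_class {i : ℕ} {z : Ch (labM a) i} (hz : z ∈ cyc (labM a) i) :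
    ∃ b, dd A b = PhiX a c z - mapC (sumM a) z := by
  cases i with
  | zero => exact ⟨_, homotopy_zero a c z⟩
  | succ i =>
    refine ⟨SX a c z, ?_⟩
    have := homotopy_succ a c z
    rw [(cyc_succ z).1 hz, map_zero, add_zero] at this
    exact this

theorem phi_cyc {i : ℕ} {z : Ch (labM a) i} (hz : z ∈ cyc (labM a) i) :
    PhiX a c z ∈ cyc A i := by
  obtain ⟨b, hb⟩ := phi_class a c hz
  have : PhiX a c z = dd A b + mapC (sumM a) z := by rw [hb]; abel
  rw [this]
  exact add_mem (dd_mem_cyc b) (mapC_cyc _ hz)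

theorem phi_dd {i : ℕ} (z : Ch (labM a) (i + 1)) :
    PhiX a c (dd (labM a) z) = dd A (PhiX a c z) := by
  have h1 := homotopy_succ a c z
  have h1' := congrArg (dd A) h1
  rw [map_add, dd_dd, map_sub, zero_add, ← mapC_dd] at h1'
  cases i with
  | zero =>
    have h2 := homotopy_zero a c (dd (labM a) z)
    rw [h2] at h1'
    exact sub_left_injective h1'
  | succ i =>
    have h2 := homotopy_succ a c (dd (labM a) z)
    rw [dd_dd, map_zero, add_zero] at h2
    rw [h2] at h1'
    exact sub_left_injective h1'

open Classical in
noncomputable def filtL {X M : Type} [AddCommGroup M] (p : X → Prop) : (X →₀ M) →+ (X →₀ M) :=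
  Finsupp.filterAddHom p

theorem filtL_pos {X M : Type} [AddCommGroup M] {p : X → Prop} (m : X →₀ M) {x : X} (h : p x) :
    filtL p m x = m x := by
  simp [filtL, Finsupp.filterAddHom, h]
theorem filtL_neg {X M : Type} [AddCommGroup M] {p : X → Prop} (m : X →₀ M) {x : X} (h : ¬ p x) :
    filtL p m x = 0 := by
  simp [filtL, Finsupp.filterAddHom, h]
theorem filtL_single_pos {X M : Type} [AddCommGroup M] {p : X → Prop} (m : M) {x : X} (h : p x) :
    filtL p (Finsupp.single x m) = Finsupp.single x m := by
  classical
  exact Finsupp.filter_single_of_pos _ h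
theorem filtL_single_neg {X M : Type} [AddCommGroup M] {p : X → Prop} (m : M) {x : X} (h : ¬ p x) :
    filtL p (Finsupp.single x m) = 0 := by
  classical
  exact Finsupp.filter_single_of_neg _ h

/-- restriction to an invariant set of labels -/
noncomputable def filtM (p : X → Prop) (hp : ∀ g x, p (a.act g x) ↔ p x) :
    GHom (labM a) (labM a) where
  f := MonoidHom.id _
  φ := filtL p
  h g m := by
    refine hom_ext_apply ((filtL p).comp ((labM a).ρ g))
      (((labM a).ρ g).comp (filtL p)) (fun x m => ?_) m
    simp only [AddMonoidHom.comp_apply, lin_single, sg_apply]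
    by_cases h : p x
    · rw [filtL_single_pos _ ((hp g x).2 h), filtL_single_pos _ h]
      simp
    · rw [filtL_single_neg _ (fun h' => h ((hp g x).1 h')),
        filtL_single_neg _ h]
      simp
end gauge

theorem mapC_inj {A B : GM} (F : GHom B A) (hf : Function.Injective F.f)
    (hφ : Function.Injective F.φ) {q : ℕ} : Function.Injective (mapC F (q := q)) := by
  have : ∀ c : Ch B q, mapC F c = (c.mapRange F.φ F.φ.map_zero).mapDomain (tmap F.f) := by
    intro c
    refine hom_ext_apply (mapC F)
      ((Finsupp.mapDomain.addMonoidHom (tmap F.f)).comp (Finsupp.mapRange.addMonoidHom F.φ))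
      (fun g m => ?_) c
    simp
  intro c c' h
  rw [this, this] at h
  exact Finsupp.mapRange_injective _ F.φ.map_zero hφ (Finsupp.mapDomain_injective (tmap_inj hf) h)

theorem mapC_cyc_iff {A B : GM} (F : GHom B A) (hf : Function.Injective F.f)
    (hφ : Function.Injective F.φ) {q : ℕ} {c : Ch B q} (h : mapC F c ∈ cyc A q) : c ∈ cyc B q := by
  cases q with
  | zero => trivial
  | succ q =>
    rw [cyc_succ] at h ⊢
    rw [← mapC_dd] at h
    exact mapC_inj F hf hφ (h.trans (map_zero _).symm)

/-- a grading of a module by a set with action -/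
structure Grad (A : GM) (X : Type) where
  a : GAct A.G X
  γ : A.M →+ (X →₀ A.M)
  equi : ∀ g m, γ (A.ρ g m) = (labM a).ρ g (γ m)
  sum : ∀ m, (sumM a).φ (γ m) = m

noncomputable def Grad.hom {A : GM} {X : Type} (gr : Grad A X) : GHom A (labM gr.a) :=
  ⟨MonoidHom.id _, gr.γ, gr.equi⟩

theorem Grad.sum_hom {A : GM} {X : Type} (gr : Grad A X) {i : ℕ} (z : Ch A i) :
    mapC (sumM gr.a) (mapC gr.hom z) = z := by
  rw [← mapC_comp]
  have : (sumM gr.a).comp gr.hom = GHom.id A := GHom.ext' (fun _ => rfl) gr.sum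
  rw [this, mapC_id]

section F2
variable {A : GM} {X : Type} (gr : Grad A X)

/-- If `c x` moves the base point to `x`, gauged words lie in the stabilizer -/
theorem gw_range {B : GM} (F : GHom B A) (c : X → A.G) (pt : X) (p : X → Prop)
    (hp : ∀ g x, p (gr.a.act g x) ↔ p x)
    (hc : ∀ x, p x → gr.a.act (c x) pt = x)
    (hf : ∀ g, gr.a.act g pt = pt → ∃ b, F.f b = g) {q : ℕ} (g : Tup A.G q) :
    ∀ x, p x → ∃ b, tmap F.f b = gw gr.a c x g := by
  induction g with
  | tn => intro x _; exact ⟨tn, rfl⟩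
  | tc k g ih =>
    intro x hx
    obtain ⟨b, hb⟩ := ih (gr.a.act k⁻¹ x) ((hp _ _).2 hx)
    have h2 := hc _ ((hp k⁻¹ _).2 hx)
    have h1 := hc _ hx
    obtain ⟨b0, hb0⟩ := hf ((c x)⁻¹ * k * c (gr.a.act k⁻¹ x)) (by
      rw [gr.a.mul, gr.a.mul, h2, gr.a.act_inv]
      nth_rewrite 2 [← h1]
      rw [gr.a.inv_act])
    exact ⟨tc b0 b, by simp [tmap, gw, hb, hb0]⟩

theorem phi_range {B : GM} (F : GHom B A) (c : X → A.G) (pt : X) (p : X → Prop)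
    (hp : ∀ g x, p (gr.a.act g x) ↔ p x)
    (hc : ∀ x, p x → gr.a.act (c x) pt = x)
    (hf : ∀ g, gr.a.act g pt = pt → ∃ b, F.f b = g)
    (hφ : ∀ m, ∃ b, F.φ b = gr.γ m pt) {q : ℕ} (z : Ch A q) :
    ∃ w, mapC F w = PhiX gr.a c (mapC (filtM gr.a p hp) (mapC gr.hom z)) := by
  suffices h : PhiX gr.a c (mapC (filtM gr.a p hp) (mapC gr.hom z)) ∈ (mapC F).range from h
  induction z using Finsupp.induction_linear with
  | zero => simp
  | add f g hf hg => simp only [map_add]; exact add_mem hf hg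
  | single g m =>
    have e1 : mapC (filtM gr.a p hp) (mapC gr.hom (Finsupp.single g m))
        = Finsupp.single g (filtL p (gr.γ m)) := by
      rw [mapC_single, mapC_single, tmap_comp]
      congr 1
      exact tmap_id g
    rw [e1]
    simp only [PhiX, lin_single]
    unfold lin
    simp only [Finsupp.liftAddHom_apply]
    refine sum_mem fun x hx => ?_
    have hpx : p x := by
      by_contra hpx
      simp [filtL_neg _ hpx] at hx
    have hval : filtL p (gr.γ m) x = gr.γ m x := filtL_pos _ hpx
    obtain ⟨b, hb⟩ := gw_range gr F c pt p hp hc hf g x hpx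
    obtain ⟨n, hn⟩ := hφ (A.ρ (c x)⁻¹ m)
    refine ⟨Finsupp.single b n, ?_⟩
    rw [mapC_single, hb, hn, hval, gr.equi]
    simp only [AddMonoidHom.comp_apply, sg_apply]
    congr 1
    -- evaluate
    have key : ∀ (g : A.G) (n : X →₀ A.M) y, (labM gr.a).ρ g n (gr.a.act g y) = A.ρ g (n y) := by
      intro g n y
      refine hom_ext_apply ((Finsupp.applyAddHom (gr.a.act g y)).comp ((labM gr.a).ρ g))
        ((A.ρ g).comp (Finsupp.applyAddHom y)) (fun x m => ?_) n
      have inj : gr.a.act g x = gr.a.act g y ↔ x = y := by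
        constructor
        · intro h
          rw [← gr.a.inv_act g x, h, gr.a.inv_act]
        · rintro rfl; rfl
      classical
      simp only [AddMonoidHom.comp_apply, lin_single, sg_apply, Finsupp.applyAddHom_apply,
        Finsupp.single_apply, inj]
      split_ifs <;> simp
    have h1 := key (c x)⁻¹ (gr.γ m) x
    rw [← h1]
    congr 1
    nth_rewrite 2 [← hc x hpx]
    rw [gr.a.inv_act]

/-- **F2**: homology of a graded module is generated by the homology of stabilizers. -/
theorem F2 {R : Type} (B : R → GM) (F : ∀ r, GHom (B r) A) (pt : R → X)
    (hf : ∀ r, Function.Injective (F r).f) (hφ : ∀ r, Function.Injective (F r).φ)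
    (hst : ∀ r g, gr.a.act g (pt r) = pt r → ∃ b, (F r).f b = g)
    (hsub : ∀ r m, ∃ b, (F r).φ b = gr.γ m (pt r))
    (horb : ∀ x, ∃ r g, gr.a.act g (pt r) = x) (i : ℕ) (K : AddSubgroup (H A i))
    (hK : ∀ r y, Hm (F r) i y ∈ K) (y : H A i) : y ∈ K := by
  classical
  let orb : X → Set X := fun x => {y | ∃ g, gr.a.act g x = y}
  have horb_act : ∀ g x, orb (gr.a.act g x) = orb x := by
    intro g x
    ext y
    constructor
    · rintro ⟨h, rfl⟩; exact ⟨h * g, gr.a.mul _ _ _⟩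
    · rintro ⟨h, rfl⟩; exact ⟨h * g⁻¹, by rw [gr.a.mul, gr.a.inv_act]⟩
  have hex : ∀ x, ∃ r, pt r ∈ orb x := by
    intro x
    obtain ⟨r, g, hg⟩ := horb x
    exact ⟨r, g⁻¹, by rw [← hg, gr.a.inv_act]⟩
  by_cases hX : Nonempty X
  swap
  · have h0 : ∀ m : A.M, m = 0 := by
      intro m
      rw [← gr.sum m]
      have : gr.γ m = 0 := by ext x; exact (hX ⟨x⟩).elim
      rw [this, map_zero]
    obtain ⟨z, hz, rfl⟩ := cls_surj y
    have : z = 0 := by ext g; exact h0 _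
    subst this
    have : cls (A := A) ⟨0, hz⟩ = 0 := cls_eq_zero.2 ⟨0, map_zero _⟩
    rw [this]; exact zero_mem _
  obtain ⟨x0⟩ := hX
  obtain ⟨r0, -⟩ := hex x0
  let rs : Set X → R := fun O => if h : ∃ r, pt r ∈ O then h.choose else r0
  have hrs : ∀ x, pt (rs (orb x)) ∈ orb x := by
    intro x
    have h := hex x
    simp only [rs, dif_pos h]
    exact h.choose_spec
  have hcx : ∀ x, ∃ c, gr.a.act c (pt (rs (orb x))) = x := by
    intro x
    obtain ⟨g, hg⟩ := hrs x
    exact ⟨g⁻¹, by rw [← hg, gr.a.inv_act]⟩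
  choose c hc using hcx
  let p : R → X → Prop := fun r x => rs (orb x) = r
  have hp : ∀ r g x, p r (gr.a.act g x) ↔ p r x := by
    intro r g x; simp only [p, horb_act]
  obtain ⟨z, hz, rfl⟩ := cls_surj y
  set w := mapC gr.hom z with hw
  have hwc : w ∈ cyc _ i := mapC_cyc _ hz
  -- decomposition
  have hdec : ∀ w : Ch (labM gr.a) i, ∃ T : Finset R, ∀ T', T ⊆ T' →
      w = ∑ r ∈ T', mapC (filtM gr.a (p r) (hp r)) w := by
    intro w
    induction w using Finsupp.induction_linear with
    | zero => exact ⟨∅, fun T' _ => by simp⟩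
    | add f g hf hg =>
      obtain ⟨T1, h1⟩ := hf
      obtain ⟨T2, h2⟩ := hg
      refine ⟨T1 ∪ T2, fun T' hT => ?_⟩
      simp only [map_add, Finset.sum_add_distrib]
      rw [← h1 T' (Finset.union_subset_left hT), ← h2 T' (Finset.union_subset_right hT)]
    | single g n =>
      refine ⟨n.support.image (fun x => rs (orb x)), fun T' hT => ?_⟩
      have : ∀ r, mapC (filtM gr.a (p r) (hp r)) (Finsupp.single g n) =
          sg g (filtL (p r) n) := by
        intro r
        rw [mapC_single]
        simp only [sg_apply, filtM]
        congr 1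
        exact tmap_id g
      simp only [this]
      rw [← map_sum, sg_apply]
      congr 1
      ext x
      rw [Finsupp.finsetSum_apply]
      by_cases hx : n x = 0
      · rw [hx]
        symm
        refine Finset.sum_eq_zero fun r _ => ?_
        by_cases h : p r x
        · rw [filtL_pos _ h, hx]
        · rw [filtL_neg _ h]
      · rw [Finset.sum_eq_single (rs (orb x))]
        · exact (filtL_pos (p := p (rs (orb x))) n rfl).symm
        · intro r _ hr
          exact filtL_neg _ hr.symm
        · intro h
          exact (h (hT (Finset.mem_image_of_mem _ (by simpa using hx)))).elim
  obtain ⟨T, hT⟩ := hdec w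
  have hT := hT T subset_rfl
  have hfc : ∀ r, mapC (filtM gr.a (p r) (hp r)) w ∈ cyc _ i := fun r => mapC_cyc _ hwc
  have hz2 : (⟨z, hz⟩ : cyc A i) = ∑ r ∈ T, ⟨mapC (sumM gr.a) (mapC (filtM gr.a (p r) (hp r)) w),
      mapC_cyc _ (hfc r)⟩ := by
    apply Subtype.ext
    rw [AddSubgroup.val_finsetSum, ← map_sum, ← hT, hw, gr.sum_hom]
  rw [hz2, map_sum]
  refine sum_mem fun r _ => ?_
  obtain ⟨b, hb⟩ := phi_class gr.a c (hfc r)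
  obtain ⟨u, hu⟩ := phi_range gr (F r) c (pt r) (p r) (hp r)
    (fun x hx => by have := hc x; rw [show rs (orb x) = r from hx] at this; exact this)
    (hst r) (hsub r) z
  have hu' : mapC (F r) u ∈ cyc A i := by
    rw [hu]; exact phi_cyc gr.a c (hfc r)
  have huc := mapC_cyc_iff (F r) (hf r) (hφ r) hu'
  have := hK r (cls ⟨u, huc⟩)
  rw [Hm_cls] at this
  convert this using 1
  symm
  exact cls_eq.2 ⟨b, by rw [hb, hu]⟩

/-- Injectivity part of Shapiro's lemma. -/
theorem shapiro_inj {B : GM} (F : GHom B A) (pt : X)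
    (hf : Function.Injective F.f) (hφ : Function.Injective F.φ)
    (hfix : ∀ b, gr.a.act (F.f b) pt = pt)
    (hst : ∀ g, gr.a.act g pt = pt → ∃ b, F.f b = g)
    (hsub : ∀ m, ∃ b, F.φ b = gr.γ m pt)
    (hlab : ∀ b, gr.γ (F.φ b) = Finsupp.single pt (F.φ b))
    (horb : ∀ x, ∃ g, gr.a.act g pt = x) (i : ℕ) : Function.Injective (Hm F i) := by
  classical
  choose c0 hc0 using horb
  let c : X → A.G := fun x => if x = pt then 1 else c0 x
  have hc : ∀ x, True → gr.a.act (c x) pt = x := by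
    intro x _
    simp only [c]
    split_ifs with h
    · rw [h, gr.a.one]
    · exact hc0 x
  have hc1 : c pt = 1 := by simp [c]
  rw [injective_iff_map_eq_zero]
  intro y hy
  obtain ⟨z, hz, rfl⟩ := cls_surj y
  rw [Hm_cls] at hy
  obtain ⟨b, hb⟩ := cls_eq_zero.1 hy
  have hfilt : ∀ {q : ℕ} (z : Ch A q),
      mapC (filtM gr.a (fun _ => True) (fun _ _ => Iff.rfl)) (mapC gr.hom z) = mapC gr.hom z := by
    intro q z
    rw [← mapC_comp]
    congr 1
    congr 1
    refine GHom.ext' (fun g => rfl) (fun m => ?_)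
    show filtL _ (gr.γ m) = gr.γ m
    ext x
    exact filtL_pos (p := fun _ => True) _ trivial
  obtain ⟨w, hw⟩ := phi_range gr F c pt (fun _ => True) (fun _ _ => Iff.rfl) hc hst hsub b
  rw [hfilt] at hw
  have hg : ∀ {q : ℕ} (g : Tup B.G q), gw gr.a c pt (tmap F.f g) = tmap F.f g := by
    clear * - hfix hc1
    intro q g
    induction g with
    | tn => rfl
    | tc k g ih =>
      have : gr.a.act (F.f k)⁻¹ pt = pt := by rw [← map_inv]; exact hfix _
      simp [tmap, gw, this, ih, hc1]
  have hid : ∀ {q : ℕ} (u : Ch B q), PhiX gr.a c (mapC gr.hom (mapC F u)) = mapC F u := by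
    intro q u
    refine hom_ext_apply ((PhiX gr.a c).comp ((mapC gr.hom).comp (mapC F))) (mapC F)
      (fun g m => ?_) u
    simp only [AddMonoidHom.comp_apply, mapC_single]
    have e1 : gr.hom.φ (F.φ m) = Finsupp.single pt (F.φ m) := hlab m
    have e2 : tmap (gr.hom.f) (tmap F.f g) = tmap F.f g := tmap_id _
    rw [e1, e2]
    simp [PhiX, hg, hc1, A.ρ_one]
  apply cls_eq_zero.2
  refine ⟨w, mapC_inj F hf hφ ?_⟩
  rw [mapC_dd, hw, ← phi_dd, ← mapC_dd, hb, hid]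
end F2

/-- conjugation -/
def conjM (A : GM) (g : A.G) : GHom A A where
  f := (MulAut.conj g).toMonoidHom
  φ := A.ρ g
  h k m := by simp [← A.ρ_mul]

/-- **F3** -/
theorem Hm_conj {A : GM} (g : A.G) {i : ℕ} (y : H A i) : Hm (conjM A g) i y = y := by
  let a : GAct A.G Unit := ⟨fun _ x => x, fun _ => rfl, fun _ _ _ => rfl⟩
  let gr : Grad A Unit := ⟨a, sg (), fun g m => by simp [a], fun m => by simp [sumM]⟩
  obtain ⟨z, hz, rfl⟩ := cls_surj y
  rw [Hm_cls]
  obtain ⟨b, hb⟩ := phi_class a (fun _ => g⁻¹) (mapC_cyc gr.hom hz)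
  have h1 : mapC (sumM a) (mapC gr.hom z) = z := gr.sum_hom z
  rw [h1] at hb
  refine cls_eq.2 ⟨b, ?_⟩
  rw [hb]
  congr 1
  refine hom_ext_apply ((PhiX a (fun _ => g⁻¹)).comp (mapC gr.hom)) (mapC (conjM A g))
      (fun k m => ?_) z
  have hg : gw a (fun _ => g⁻¹) () k = tmap (conjM A g).f k := by
    clear * -
    induction k with
    | tn => rfl
    | tc k g ih =>
      simp only [tmap, gw, inv_inv]
      exact congrArg _ ih
  simp only [AddMonoidHom.comp_apply, mapC_single]
  have e2 : tmap (gr.hom.f) k = k := tmap_id _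
  have e1 : gr.hom.φ m = Finsupp.single () m := rfl
  rw [e1, e2, ← hg]
  simp [PhiX, conjM]


end P2

section P3
open Tup
/-! ### exactness and the resolution lemma -/

theorem mapC_eq {A B : GM} (F : GHom B A) {q : ℕ} (c : Ch B q) :
    mapC F c = (c.mapRange F.φ F.φ.map_zero).mapDomain (tmap F.f) := by
  refine hom_ext_apply (mapC F)
    ((Finsupp.mapDomain.addMonoidHom (tmap F.f)).comp (Finsupp.mapRange.addMonoidHom F.φ))
    (fun g m => ?_) c
  simp

theorem tmap_surj {G G' : Type} {f : G → G'} (hf : Function.Surjective f) {q : ℕ}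
    (g : Tup G' q) : ∃ g', tmap f g' = g := by
  induction g with
  | tn => exact ⟨tn, rfl⟩
  | tc k g ih =>
    obtain ⟨g', rfl⟩ := ih
    obtain ⟨k', rfl⟩ := hf k
    exact ⟨tc k' g', rfl⟩

theorem mapC_lift {A B : GM} (E : GHom A B) (hE : Function.Surjective E.f) {q : ℕ} (c : Ch B q)
    (hex : ∀ g, ∃ m', E.φ m' = c g) : ∃ c', mapC E c' = c := by
  suffices h : c ∈ (mapC E (q := q)).range from h
  rw [← Finsupp.sum_single c]
  refine sum_mem fun g _ => ?_
  obtain ⟨g', rfl⟩ := tmap_surj hE g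
  obtain ⟨m', hm⟩ := hex (tmap E.f g')
  exact ⟨Finsupp.single g' m', by rw [mapC_single, hm]⟩

theorem mapC_ker {B C : GM} (F : GHom B C) (hF : Function.Injective F.f) {q : ℕ} {c : Ch B q}
    (hc : mapC F c = 0) (g : Tup B.G q) : F.φ (c g) = 0 := by
  rw [mapC_eq] at hc
  have h0 := Finsupp.mapDomain_injective (tmap_inj hF) (hc.trans Finsupp.mapDomain_zero.symm)
  have := DFunLike.congr_fun h0 g
  simpa using this

theorem mapC_exact {A B C : GM} (E : GHom A B) (F : GHom B C) (hE : Function.Surjective E.f)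
    (hF : Function.Injective F.f) (hex : ∀ m, F.φ m = 0 → ∃ m', E.φ m' = m) {q : ℕ} {c : Ch B q}
    (hc : mapC F c = 0) : ∃ c', mapC E c' = c :=
  mapC_lift E hE c fun g => hex _ (mapC_ker F hF hc g)

theorem mapC_surj {A B : GM} (E : GHom A B) (hE : Function.Surjective E.f)
    (hφ : Function.Surjective E.φ) {q : ℕ} (c : Ch B q) : ∃ c', mapC E c' = c :=
  mapC_lift E hE c fun _ => hφ _

section RL
variable (C : ℕ → GM) (d : ∀ p, GHom (C (p + 1)) (C p))
  (hb : ∀ p, Function.Bijective (d p).f)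
  (T : ∀ p q, Ch (C p) q →+ Ch (C p) q)
  (hTd : ∀ p q (c : Ch (C p) (q + 1)), T p q (dd _ c) = dd _ (T p (q + 1) c))
  (hTm : ∀ p q (c : Ch (C (p + 1)) q), T p q (mapC (d p) c) = mapC (d p) (T (p + 1) q c))
include hb hTd hTm

theorem RL_aux (hcx : ∀ p m, (d p).φ ((d (p + 1)).φ m) = 0) (j : ℕ) : ∀ p : ℕ,
    (∀ q, q < j → ∀ m, (d (p + q)).φ m = 0 → ∃ m', (d (p + q + 1)).φ m' = m) →
    (∀ q r, q + r + 1 = j → ∀ w ∈ cyc (C (p + 2 + q)) r, ∃ b, dd _ b = T _ _ w) →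
    ∀ z : Ch (C (p + 1)) j, mapC (d p) z ∈ cyc _ j →
      ∃ b, (T _ _)^[j] z - mapC (d (p + 1)) b ∈ cyc _ j := by
  have hcxC : ∀ p q (c : Ch (C (p + 2)) q), mapC (d p) (mapC (d (p + 1)) c) = 0 := by
    intro p q c
    rw [← mapC_comp]
    refine hom_ext_apply (mapC _) 0 (fun g m => ?_) c
    simp [GHom.comp, hcx]
  have hTdN : ∀ p q N (c : Ch (C p) (q + 1)), (T p q)^[N] (dd _ c) = dd _ ((T p (q + 1))^[N] c) := by
    intro p q N
    induction N with
    | zero => intro c; rfl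
    | succ N ih => intro c; rw [Function.iterate_succ_apply, Function.iterate_succ_apply, hTd, ih]
  have hTmN : ∀ p q N (c : Ch (C (p + 1)) q),
      (T p q)^[N] (mapC (d p) c) = mapC (d p) ((T (p + 1) q)^[N] c) := by
    intro p q N
    induction N with
    | zero => intro c; rfl
    | succ N ih => intro c; rw [Function.iterate_succ_apply, Function.iterate_succ_apply, hTm, ih]
  induction j with
  | zero => intro p _ _ z _; exact ⟨0, cyc_zero _⟩
  | succ j ih =>
    intro p hex hT z hz
    have h1 : mapC (d p) (dd _ z) = 0 := by rw [mapC_dd]; exact hz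
    obtain ⟨z2, hz2⟩ := mapC_exact (d (p + 1)) (d p) (hb _).2 (hb _).1 (hex 0 (by omega)) h1
    have h2 : mapC (d (p + 1)) z2 ∈ cyc _ j := by rw [hz2]; exact dd_mem_cyc _
    obtain ⟨b3, hb3⟩ := ih (p + 1)
      (fun q hq => by have := hex (q + 1) (by omega); rw [show p + 1 + q = p + (q + 1) by ring]; exact this)
      (fun q r hqr => by
        have := hT (q + 1) r (by omega)
        rw [show p + 1 + 2 + q = p + 2 + (q + 1) by ring]; exact this) z2 h2
    obtain ⟨b, hbb⟩ := hT 0 j (by omega) _ hb3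
    refine ⟨b, ?_⟩
    rw [cyc_succ, map_sub, ← hTdN, ← mapC_dd, hbb, ← hz2, hTmN]
    have : (T (p + 1 + 1) j)^[j + 1] z2 = T (p + 1 + 1) j ((T (p + 1 + 1) j)^[j] z2) :=
      Function.iterate_succ_apply' _ _ _
    rw [this, ← hTm]
    show _ - mapC (d (p + 1)) (T (p + 1 + 1) j _) = 0
    rw [← hTm, ← map_sub, ← map_sub, sub_sub_cancel, hcxC, map_zero]

theorem RLop (hcx : ∀ p m, (d p).φ ((d (p + 1)).φ m) = 0) (i : ℕ)
    (hsurj : Function.Surjective (d 0).φ)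
    (hex : ∀ q, q < i → ∀ m, (d q).φ m = 0 → ∃ m', (d (q + 1)).φ m' = m)
    (hT : ∀ q r, q + r + 1 = i → ∀ w ∈ cyc (C (q + 2)) r, ∃ b, dd _ b = T _ _ w)
    (z : Ch (C 0) i) (hz : z ∈ cyc _ i) :
    ∃ w, w ∈ cyc (C 1) i ∧ mapC (d 0) w = (T _ _)^[i] z := by
  obtain ⟨z1, rfl⟩ := mapC_surj (d 0) (hb 0).2 hsurj z
  obtain ⟨b, h⟩ := RL_aux C d hb T hTd hTm hcx i 0
    (fun q hq => by rw [zero_add]; exact hex q hq)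
    (fun q r hq => by rw [show 0 + 2 + q = q + 2 by ring]; exact hT q r hq) z1 hz
  refine ⟨_, h, ?_⟩
  have hcxC : ∀ (c : Ch (C 2) i), mapC (d 0) (mapC (d 1) c) = 0 := by
    intro c
    rw [← mapC_comp]
    refine hom_ext_apply (mapC _) 0 (fun g m => ?_) c
    simp [GHom.comp, hcx]
  rw [map_sub]
  erw [hcxC]
  rw [sub_zero]
  have : ∀ N (c : Ch (C 1) i), (T 0 i)^[N] (mapC (d 0) c) = mapC (d 0) ((T 1 i)^[N] c) := by
    intro N
    induction N with
    | zero => intro c; rfl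
    | succ N ih => intro c; rw [Function.iterate_succ_apply, Function.iterate_succ_apply, hTm, ih]
  exact (this i z1).symm
end RL

/-- vanishing in degree `i` -/
def Van (A : GM) (i : ℕ) : Prop := ∀ y : H A i, y = 0

theorem van_iff {A : GM} {i : ℕ} : Van A i ↔ ∀ w ∈ cyc A i, ∃ b, dd A b = w := by
  constructor
  · intro h w hw; exact cls_eq_zero.1 (h (cls ⟨w, hw⟩))
  · intro h y
    obtain ⟨z, hz, rfl⟩ := cls_surj y
    exact cls_eq_zero.2 (h z hz)

/-- **RL** -/
theorem RL (C : ℕ → GM) (d : ∀ p, GHom (C (p + 1)) (C p))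
    (hb : ∀ p, Function.Bijective (d p).f)
    (hcx : ∀ p m, (d p).φ ((d (p + 1)).φ m) = 0) (i : ℕ)
    (hsurj : Function.Surjective (d 0).φ)
    (hex : ∀ q, q < i → ∀ m, (d q).φ m = 0 → ∃ m', (d (q + 1)).φ m' = m)
    (hT : ∀ q r, q + r + 1 = i → Van (C (q + 2)) r) : Function.Surjective (Hm (d 0) i) := by
  intro y
  obtain ⟨z, hz, rfl⟩ := cls_surj y
  obtain ⟨w, hw, h⟩ := RLop C d hb (fun _ _ => AddMonoidHom.id _) (fun _ _ _ => rfl)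
    (fun _ _ _ => rfl) hcx i hsurj hex (fun q r hq w hw => van_iff.1 (hT q r hq) w hw) z hz
  have hN : (AddMonoidHom.id (Ch (C 0) i))^[i] z = z := by
    have : ⇑(AddMonoidHom.id (Ch (C 0) i)) = id := rfl
    rw [this, Function.iterate_id]; rfl
  refine ⟨cls ⟨w, hw⟩, ?_⟩
  rw [Hm_cls]
  congr 1
  exact Subtype.ext (h.trans hN)

section SES
variable {K M Q : GM} (ι : GHom K M) (π : GHom M Q)
  (hι : Function.Bijective ι.f) (hπ : Function.Bijective π.f)
  (hi : Function.Injective ι.φ) (hs : Function.Surjective π.φ)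
  (h0 : ∀ m, π.φ (ι.φ m) = 0) (hex : ∀ m, π.φ m = 0 → ∃ k, ι.φ k = m)
include hι hπ hi hex

theorem ses_inj {i : ℕ} (hs : Function.Surjective π.φ) (hv : Van K i) :
    Function.Injective (Hm π i) := by
  rw [injective_iff_map_eq_zero]
  intro y hy
  obtain ⟨z, hz, rfl⟩ := cls_surj y
  rw [Hm_cls] at hy
  obtain ⟨b, hb⟩ := cls_eq_zero.1 hy
  obtain ⟨b', rfl⟩ := mapC_surj π hπ.2 hs b
  have h1 : mapC π (z - dd _ b') = 0 := by rw [map_sub, mapC_dd, hb, sub_self]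
  obtain ⟨k, hk⟩ := mapC_exact ι π hι.2 hπ.1 hex h1
  have hkc : k ∈ cyc K i := by
    apply mapC_cyc_iff ι hι.1 hi
    rw [hk]; exact sub_mem hz (dd_mem_cyc _)
  obtain ⟨e, he⟩ := van_iff.1 hv k hkc
  apply cls_eq_zero.2
  refine ⟨mapC ι e + b', ?_⟩
  rw [map_add, ← mapC_dd, he, hk]; abel

include h0
theorem ses_surj {i : ℕ} (hs : Function.Surjective π.φ) (hv : Van K i) :
    Function.Surjective (Hm π (i + 1)) := by
  intro y
  obtain ⟨z, hz, rfl⟩ := cls_surj y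
  obtain ⟨c, rfl⟩ := mapC_surj π hπ.2 hs z
  have h1 : mapC π (dd _ c) = 0 := by rw [mapC_dd]; exact hz
  obtain ⟨k, hk⟩ := mapC_exact ι π hι.2 hπ.1 hex h1
  have hkc : k ∈ cyc K i := by
    apply mapC_cyc_iff ι hι.1 hi
    rw [hk]; exact dd_mem_cyc _
  obtain ⟨e, he⟩ := van_iff.1 hv k hkc
  have h2 : mapC π (mapC ι e) = 0 := by
    rw [← mapC_comp]
    refine hom_ext_apply (mapC _) 0 (fun g m => ?_) e
    simp [GHom.comp, h0]
  have hc : c - mapC ι e ∈ cyc M (i + 1) := by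
    rw [cyc_succ, map_sub, ← mapC_dd, he, hk, sub_self]
  refine ⟨cls ⟨_, hc⟩, ?_⟩
  rw [Hm_cls]
  congr 1
  apply Subtype.ext
  show mapC π (c - mapC ι e) = _
  rw [map_sub, h2, sub_zero]

/-- two endomorphisms agreeing with the identity on `M` and `Q` square to it on `K` -/
theorem ses_square {i : ℕ} (hs : Function.Surjective π.φ) (tK : GHom K K) (tM : GHom M M)
    (tQ : GHom Q Q)
    (hiK : ∀ q (c : Ch K q), mapC ι (mapC tK c) = mapC tM (mapC ι c))
    (hpM : ∀ q (c : Ch M q), mapC π (mapC tM c) = mapC tQ (mapC π c))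
    (hM : ∀ y : H M i, Hm tM i y = y) (hQ : ∀ y : H Q (i + 1), Hm tQ (i + 1) y = y)
    (hid : ∀ y : H K i, Hm tK i (Hm tK i y) = Hm tK i y) (y : H K i) : Hm tK i y = y := by
  have h2 : ∀ (e : Ch K i), mapC π (mapC ι e) = 0 := by
    intro e
    rw [← mapC_comp]
    refine hom_ext_apply (mapC _) 0 (fun g m => ?_) e
    simp [GHom.comp, h0]
  obtain ⟨z, hz, rfl⟩ := cls_surj y
  have hzM := mapC_cyc ι hz
  have e1 := hM (cls ⟨_, hzM⟩)
  rw [Hm_cls] at e1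
  obtain ⟨b, hb⟩ := cls_eq.1 e1
  have hpb : mapC π b ∈ cyc Q (i + 1) := by
    rw [cyc_succ, ← mapC_dd, hb, map_sub, hpM, h2, map_zero, sub_zero]
  have e2 := hQ (cls ⟨_, hpb⟩)
  rw [Hm_cls] at e2
  obtain ⟨e, he⟩ := cls_eq.1 e2
  obtain ⟨e', rfl⟩ := mapC_surj π hπ.2 hs e
  have h3 : mapC π (mapC tM b - b - dd _ e') = 0 := by
    rw [map_sub, map_sub, hpM, mapC_dd, he, sub_self]
  obtain ⟨r, hr⟩ := mapC_exact ι π hι.2 hπ.1 hex h3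
  have h4 : dd K r = mapC tK (mapC tK z - z) - (mapC tK z - z) := by
    apply mapC_inj ι hι.1 hi
    rw [mapC_dd, hr]
    simp only [map_sub, dd_dd, ← mapC_dd, hb, hiK]
    simp
  have hz1 := mapC_cyc tK hz
  have h5 : Hm tK i (Hm tK i (cls ⟨z, hz⟩) - cls ⟨z, hz⟩) =
      Hm tK i (cls ⟨z, hz⟩) - cls ⟨z, hz⟩ := by
    rw [Hm_cls, ← map_sub]
    erw [Hm_cls tK (sub_mem hz1 hz)]
    exact cls_eq.2 ⟨r, h4⟩
  rw [map_sub, hid, sub_self] at h5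
  exact sub_eq_zero.1 h5.symm
end SES

end P3

section P4
open Tup
/-! ### words -/
section words
variable {Y Y' M M' : Type} [AddCommGroup M] [AddCommGroup M']

/-- the simplicial boundary of a word -/
noncomputable def w0 : ∀ {q : ℕ}, Tup Y (q + 1) → M →+ (Tup Y q →₀ M)
  | 0, tc _ g => sg g
  | (_ + 1), tc y g => sg g - (consL y).comp (w0 g)

noncomputable def wd {q : ℕ} : (Tup Y (q + 1) →₀ M) →+ (Tup Y q →₀ M) := lin w0

theorem wd_zero (y : Y) (c : Tup Y 0 →₀ M) : wd (consL y c) = c := by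
  refine hom_ext_apply (wd.comp (consL y)) (AddMonoidHom.id _) (fun g m => ?_) c
  simp [wd, w0]

theorem wd_cons {q : ℕ} (y : Y) (c : Tup Y (q + 1) →₀ M) :
    wd (consL y c) = c - consL y (wd c) := by
  refine hom_ext_apply (wd.comp (consL y)) (AddMonoidHom.id _ - (consL y).comp wd) (fun g m => ?_) c
  simp [wd, w0]

theorem word_ext {q : ℕ} {N : Type} [AddCommGroup N] {P Q : (Tup Y (q + 1) →₀ M) →+ N}
    (h : ∀ y c, P (consL y c) = Q (consL y c)) (c : Tup Y (q + 1) →₀ M) : P c = Q c := by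
  refine hom_ext_apply P Q (fun g m => ?_) c
  obtain ⟨k, g, rfl⟩ := tup_succ g
  have := h k (Finsupp.single g m)
  simpa using this

theorem wd_wd {q : ℕ} (c : Tup Y (q + 2) →₀ M) : wd (wd c) = 0 := by
  induction q with
  | zero =>
    refine word_ext (P := wd.comp wd) (Q := 0) (fun y c => ?_) c
    simp only [AddMonoidHom.comp_apply, wd_cons, map_sub, wd_zero]
    simp
  | succ q ih =>
    refine word_ext (P := wd.comp wd) (Q := 0) (fun y c => ?_) c
    simp only [AddMonoidHom.comp_apply, wd_cons, map_sub, ih, map_zero]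
    simp

/-- relabelling of words, with coefficients -/
noncomputable def wmap (f : Y → Y') (φ : M →+ M') {q : ℕ} : (Tup Y q →₀ M) →+ (Tup Y' q →₀ M') :=
  lin fun w => (sg (tmap f w)).comp φ

theorem wmap_cons (f : Y → Y') (φ : M →+ M') {q : ℕ} (y : Y) (c : Tup Y q →₀ M) :
    wmap f φ (consL y c) = consL (f y) (wmap f φ c) := by
  refine hom_ext_apply ((wmap f φ).comp (consL y)) ((consL (f y)).comp (wmap f φ)) (fun g m => ?_) c
  simp [wmap, tmap]

theorem wmap_wd (f : Y → Y') (φ : M →+ M') {q : ℕ} (c : Tup Y (q + 1) →₀ M) :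
    wmap f φ (wd c) = wd (wmap f φ c) := by
  induction q with
  | zero =>
    refine word_ext (P := (wmap f φ).comp wd) (Q := wd.comp (wmap f φ)) (fun y c => ?_) c
    simp only [AddMonoidHom.comp_apply, wmap_cons, wd_zero]
  | succ q ih =>
    refine word_ext (P := (wmap f φ).comp wd) (Q := wd.comp (wmap f φ)) (fun y c => ?_) c
    simp only [AddMonoidHom.comp_apply, wmap_cons, wd_cons, map_sub, ih]

theorem wd_exact (y : Y) {q : ℕ} (c : Tup Y (q + 1) →₀ M) (h : wd c = 0) : wd (consL y c) = c := by
  rw [wd_cons, h, map_zero, sub_zero]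
end words

/-- action on words -/
def tupAct {G : Type} [Group G] {X : Type} (a : GAct G X) (p : ℕ) : GAct G (Tup X p) where
  act g := tmap (a.act g)
  one w := by
    have : a.act 1 = fun x => x := funext a.one
    rw [this]; exact tmap_id w
  mul g h w := by
    have : a.act (g * h) = fun x => a.act g (a.act h x) := funext (a.mul g h)
    rw [this, tmap_comp]

section lab
variable {A : GM} {X : Type} (a : GAct A.G X)

/-- the tautological grading -/
noncomputable def labGrad : Grad (labM a) X where
  a := a
  γ := lin fun x => (sg (M := X →₀ A.M) x).comp (sg x)
  equi g m := by
    refine hom_ext_apply ((lin fun x => (sg (M := X →₀ A.M) x).comp (sg x)).comp ((labM a).ρ g))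
      (AddMonoidHom.comp ((labM (A := labM a) a).ρ g)
        (lin fun x => (sg (M := X →₀ A.M) x).comp (sg x))) (fun x m => ?_) m
    simp
  sum m := by
    refine hom_ext_apply ((sumM (A := labM a) a).φ.comp (lin fun x => (sg (M := X →₀ A.M) x).comp (sg x)))
      (AddMonoidHom.id _) (fun x m => ?_) m
    simp [sumM]

theorem labGrad_apply (m : X →₀ A.M) (x : X) : (labGrad a).γ m x = Finsupp.single x (m x) := by
  classical
  refine hom_ext_apply ((Finsupp.applyAddHom x).comp (labGrad a).γ)
    ((sg x).comp (Finsupp.applyAddHom x)) (fun y m => ?_) m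
  simp only [labGrad, AddMonoidHom.comp_apply, lin_single, sg_apply, Finsupp.applyAddHom_apply,
    Finsupp.single_apply]
  split_ifs with h
  · rw [h]
  · simp

/-- inclusion of the part with label `r` -/
noncomputable def labIn {B : GM} (F : GHom B A) (r : X) (hfix : ∀ b, a.act (F.f b) r = r) :
    GHom B (labM a) where
  f := F.f
  φ := (sg r).comp F.φ
  h g m := by simp [F.h, hfix]

theorem F2lab {R : Type} (B : R → GM) (F : ∀ r, GHom (B r) A) (pt : R → X)
    (hfix : ∀ r b, a.act ((F r).f b) (pt r) = pt r)
    (hf : ∀ r, Function.Injective (F r).f) (hφ : ∀ r, Function.Bijective (F r).φ)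
    (hst : ∀ r g, a.act g (pt r) = pt r → ∃ b, (F r).f b = g)
    (horb : ∀ x, ∃ r g, a.act g (pt r) = x) (i : ℕ) (K : AddSubgroup (H (labM a) i))
    (hK : ∀ r y, Hm (labIn a (F r) (pt r) (hfix r)) i y ∈ K) (y : H (labM a) i) : y ∈ K := by
  refine F2 (labGrad a) B (fun r => labIn a (F r) (pt r) (hfix r)) pt hf (fun r => ?_) hst
    (fun r m => ?_) horb i K hK y
  · intro m m' h
    exact (hφ r).1 (Finsupp.single_injective (pt r) h)
  · obtain ⟨b, hb⟩ := (hφ r).2 (m (pt r))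
    refine ⟨b, ?_⟩
    rw [labGrad_apply]
    simp [labIn, hb]

/-- the boundary in the labelled word complex -/
noncomputable def labD (p : ℕ) : GHom (labM (tupAct a (p + 1))) (labM (tupAct a p)) where
  f := MonoidHom.id _
  φ := wd
  h g m := wmap_wd (a.act g) (A.ρ g) m |>.symm

noncomputable def labT : GHom A (labM (tupAct a 0)) where
  f := MonoidHom.id _
  φ := sg tn
  h g m := by simp [tupAct, tmap]

theorem labD_surj (y : X) : Function.Surjective (labD a 0).φ := fun c => ⟨consL y c, wd_zero y c⟩
theorem labD_exact (y : X) (q : ℕ) (c : Tup X (q + 1) →₀ A.M) (h : wd c = 0) :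
    ∃ m', (labD a (q + 1)).φ m' = c := ⟨consL y c, wd_exact y c h⟩

theorem labT_sum {i : ℕ} (y : H A i) : Hm (sumM (tupAct a 0)) i (Hm (labT a) i y) = y := by
  rw [← Hm_comp]
  have : (sumM (tupAct a 0)).comp (labT a) = GHom.id A :=
    GHom.ext' (fun _ => rfl) (fun m => by simp [GHom.comp, sumM, labT, GHom.id])
  rw [this, Hm_id]

/-- **F5** -/
theorem F5 {B : GM} (F : GHom B A) [Nonempty X] (hf : Function.Injective F.f)
    (hφ : Function.Bijective F.φ) (hst : ∀ x g, a.act g x = x ↔ ∃ b, F.f b = g) (i : ℕ)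
    (hv : ∀ r, r < i → Van B r) : Function.Surjective (Hm F i) := by
  obtain ⟨x0⟩ := ‹Nonempty X›
  have hfx : ∀ {p : ℕ} (r : Tup X p) b, (tupAct a p).act (F.f b) r = r := by
    intro p r b
    induction r with
    | tn => rfl
    | tc x r ih =>
      show tc _ _ = _
      rw [(hst x (F.f b)).2 ⟨b, rfl⟩]
      exact congrArg _ ih
  have hs : ∀ {p : ℕ} (r : Tup X (p + 1)) g, (tupAct a (p + 1)).act g r = r → ∃ b, F.f b = g := by
    intro p r g h
    obtain ⟨x, r, rfl⟩ := tup_succ r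
    have h' : tc (a.act g x) (tmap (a.act g) r) = tc x r := h
    injection h' with _ h1 h2
    exact (hst x g).1 h1
  have hvan : ∀ p r, r < i → Van (labM (tupAct a (p + 1))) r := by
    intro p r hr y
    have := F2lab (tupAct a (p + 1)) (R := Tup X (p + 1)) (fun _ => B) (fun _ => F) id (fun r b => hfx r b)
      (fun _ => hf) (fun _ => hφ) (fun r g h => hs r g h) (fun x => ⟨x, 1, (tupAct a (p + 1)).one x⟩)
      r ⊥ (fun r' y => by rw [hv r hr y]; simp) y
    simpa using this
  intro y
  have hRL := RL (fun p => labM (tupAct a p)) (labD a) (fun _ => Function.bijective_id)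
    (fun p m => wd_wd m) i (labD_surj a x0) (fun q _ m h => labD_exact a x0 q m h)
    (fun q r hq => hvan (q + 1) r (by omega))
  obtain ⟨y1, hy1⟩ := hRL (Hm (labT a) i y)
  have h2 := labT_sum a y
  rw [← hy1, ← Hm_comp] at h2
  suffices h : y ∈ (Hm F i).range from h
  rw [← h2]
  refine F2lab (tupAct a 1) (R := Tup X 1) (fun _ => B) (fun _ => F) id (fun r b => hfx r b)
      (fun _ => hf) (fun _ => hφ) (fun r g h => hs r g h) (fun x => ⟨x, 1, (tupAct a 1).one x⟩)
      i ((Hm F i).range.comap (Hm ((sumM (tupAct a 0)).comp (labD a 0)) i)) (fun r y => ?_) y1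
  refine ⟨y, ?_⟩
  rw [← Hm_comp]
  congr 2
  refine GHom.ext' (fun _ => rfl) (fun m => ?_)
  obtain ⟨x, r, rfl⟩ := tup_succ r
  simp [GHom.comp, sumM, labD, labIn, wd, w0]
end lab

end P4

section P5
open Tup
/-! ### scalar operators -/

section op
variable {K : Type} [Field K] {N N' : Type} [AddCommGroup N] [AddCommGroup N']

/-- action of the multiplicative monoid of `K` on an abelian group -/
structure MAct (K : Type) [Field K] (N : Type) [AddCommGroup N] where
  t : K → N →+ N
  one : ∀ n, t 1 n = n
  mul : ∀ c c' n, t (c * c') n = t c (t c' n)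

noncomputable def MAct.hom (M : MAct K N) : K →* AddMonoid.End N where
  toFun := M.t
  map_one' := AddMonoidHom.ext M.one
  map_mul' c c' := AddMonoidHom.ext (M.mul c c')

noncomputable def op (M : MAct K N) (s : MonoidAlgebra ℤ K) : N →+ N :=
  MonoidAlgebra.lift ℤ (AddMonoid.End N) K M.hom s

theorem op_single (M : MAct K N) (c : K) (m : ℤ) (n : N) :
    op M (MonoidAlgebra.single c m) n = m • M.t c n := by
  unfold op
  rw [MonoidAlgebra.lift_single]
  rfl
theorem op_add (M : MAct K N) (s t : MonoidAlgebra ℤ K) (n : N) :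
    op M (s + t) n = op M s n + op M t n := by
  unfold op; rw [map_add]; rfl
theorem op_sub (M : MAct K N) (s t : MonoidAlgebra ℤ K) (n : N) :
    op M (s - t) n = op M s n - op M t n := by
  unfold op; rw [map_sub]; rfl
theorem op_zero (M : MAct K N) (n : N) :
    op M 0 n = 0 := by
  unfold op; rw [map_zero]; rfl
theorem op_mul (M : MAct K N) (s t : MonoidAlgebra ℤ K) (n : N) :
    op M (s * t) n = op M s (op M t n) := by
  unfold op; rw [map_mul]; rfl
theorem op_one (M : MAct K N) (n : N) :
    op M 1 n = n := by
  unfold op; rw [map_one]; rfl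
theorem op_pow (M : MAct K N) (s : MonoidAlgebra ℤ K) (j : ℕ) (n : N) :
    op M (s ^ j) n = (op M s)^[j] n := by
  induction j generalizing n with
  | zero => simp [op_one]
  | succ j ih => rw [pow_succ, op_mul, ih, Function.iterate_succ_apply]

theorem op_nat (M : MAct K N) (M' : MAct K N') (f : N →+ N')
    (h : ∀ c n, f (M.t c n) = M'.t c (f n)) (s : MonoidAlgebra ℤ K) (n : N) :
    f (op M s n) = op M' s (f n) := by
  induction s using MonoidAlgebra.induction_linear with
  | zero => simp [op_zero]
  | add s t hs ht => simp [op_add, hs, ht]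
  | single c m => simp [op_single, h]

/-- an action of the multiplicative monoid of `K` on a pair -/
structure DAct (K : Type) [Field K] (A : GM) where
  φ : K → GHom A A
  one : φ 1 = GHom.id A
  mul : ∀ c c', φ (c * c') = (φ c).comp (φ c')

noncomputable def DAct.C {A : GM} (d : DAct K A) (q : ℕ) : MAct K (Ch A q) where
  t c := mapC (d.φ c)
  one x := by rw [d.one, mapC_id]
  mul c c' x := by rw [d.mul, mapC_comp]

noncomputable def DAct.H {A : GM} (d : DAct K A) (q : ℕ) : MAct K (Stmt4.H A q) where
  t c := Hm (d.φ c) q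
  one x := by rw [d.one, Hm_id]
  mul c c' x := by rw [d.mul, Hm_comp]

theorem DAct.C_apply {A : GM} (d : DAct K A) (q : ℕ) (c : K) (x : Ch A q) :
    (d.C q).t c x = mapC (d.φ c) x := rfl
theorem DAct.H_apply {A : GM} (d : DAct K A) (q : ℕ) (c : K) (x : Stmt4.H A q) :
    (d.H q).t c x = Hm (d.φ c) q x := rfl

theorem DAct.dd {A : GM} (d : DAct K A) {q : ℕ} (s : MonoidAlgebra ℤ K) (x : Ch A (q + 1)) :
    Stmt4.dd A (op (d.C (q + 1)) s x) = op (d.C q) s (Stmt4.dd A x) :=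
  op_nat _ _ (Stmt4.dd A) (fun c n => by
    rw [DAct.C_apply, DAct.C_apply, mapC_dd]) s x

theorem DAct.mapC {A B : GM} (d : DAct K A) (d' : DAct K B) (E : GHom A B)
    (h : ∀ c, E.comp (d.φ c) = (d'.φ c).comp E) {q : ℕ} (s : MonoidAlgebra ℤ K) (x : Ch A q) :
    Stmt4.mapC E (op (d.C q) s x) = op (d'.C q) s (Stmt4.mapC E x) :=
  op_nat _ _ (Stmt4.mapC E) (fun c n => by
    rw [DAct.C_apply, DAct.C_apply, ← mapC_comp, ← mapC_comp, h]) s x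

theorem DAct.Hm {A B : GM} (d : DAct K A) (d' : DAct K B) (E : GHom A B)
    (h : ∀ c, E.comp (d.φ c) = (d'.φ c).comp E) {q : ℕ} (s : MonoidAlgebra ℤ K) (x : Stmt4.H A q) :
    Stmt4.Hm E q (op (d.H q) s x) = op (d'.H q) s (Stmt4.Hm E q x) :=
  op_nat _ _ (Stmt4.Hm E q) (fun c n => by
    rw [DAct.H_apply, DAct.H_apply, ← Hm_comp, ← Hm_comp, h]) s x

theorem DAct.cls {A : GM} (d : DAct K A) {q : ℕ} (s : MonoidAlgebra ℤ K) {z : Ch A q}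
    (hz : z ∈ cyc A q) : ∃ hz', op (d.H q) s (Stmt4.cls ⟨z, hz⟩) = Stmt4.cls ⟨op (d.C q) s z, hz'⟩ := by
  induction s using MonoidAlgebra.induction_linear with
  | zero =>
    rw [op_zero, op_zero]
    exact ⟨zero_mem _, (map_zero Stmt4.cls).symm⟩
  | add s t hs ht =>
    obtain ⟨h1, e1⟩ := hs
    obtain ⟨h2, e2⟩ := ht
    rw [op_add, op_add, e1, e2]
    exact ⟨add_mem h1 h2, (map_add Stmt4.cls ⟨_, h1⟩ ⟨_, h2⟩).symm⟩
  | single c m =>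
    rw [op_single, op_single, DAct.H_apply, DAct.C_apply, Hm_cls]
    exact ⟨zsmul_mem (mapC_cyc _ hz) m, (map_zsmul Stmt4.cls m ⟨_, mapC_cyc _ hz⟩).symm⟩
end op

/-! ### semidirect products -/
section SD
variable {K : Type} [Field K]

@[ext] structure SD {A L : Type} [AddCommGroup A] [Module K A] [Group L]
    (act : L →* Module.End K A) where
  a : A
  l : L

variable {A L : Type} [AddCommGroup A] [Module K A] [Group L] (act : L →* Module.End K A)
variable {A' L' : Type} [AddCommGroup A'] [Module K A'] [Group L'] (act' : L' →* Module.End K A')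

instance : Group (SD act) where
  mul x y := ⟨x.a + act x.l y.a, x.l * y.l⟩
  one := ⟨0, 1⟩
  inv x := ⟨-(act x.l⁻¹ x.a), x.l⁻¹⟩
  mul_assoc x y z := by
    ext
    · show x.a + act x.l y.a + act (x.l * y.l) z.a = x.a + act x.l (y.a + act y.l z.a)
      simp [add_assoc]
    · exact mul_assoc _ _ _
  one_mul x := by
    ext
    · show 0 + act 1 x.a = x.a
      simp
    · exact one_mul _
  mul_one x := by
    ext
    · show x.a + act x.l 0 = x.a
      simp
    · exact mul_one _
  inv_mul_cancel x := by
    ext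
    · show -(act x.l⁻¹ x.a) + act x.l⁻¹ x.a = 0
      simp
    · exact inv_mul_cancel _

theorem SD.mul_a (x y : SD act) : (x * y).a = x.a + act x.l y.a := rfl
theorem SD.mul_l (x y : SD act) : (x * y).l = x.l * y.l := rfl
theorem SD.one_a : (1 : SD act).a = 0 := rfl
theorem SD.one_l : (1 : SD act).l = 1 := rfl
theorem SD.inv_a (x : SD act) : (x⁻¹).a = -(act x.l⁻¹ x.a) := rfl
theorem SD.inv_l (x : SD act) : (x⁻¹).l = x.l⁻¹ := rfl

variable {act act'} in
def SDm (u : A →ₗ[K] A') (v : L →* L') (h : ∀ l a, u (act l a) = act' (v l) (u a)) :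
    SD act →* SD act' where
  toFun x := ⟨u x.a, v x.l⟩
  map_one' := by ext <;> simp [SD.one_a, SD.one_l]
  map_mul' x y := by ext <;> simp [SD.mul_a, SD.mul_l, h]

/-- trivial integer coefficients -/
abbrev trivM (G : Type) [Group G] : GM := ⟨G, ℤ, fun _ => AddMonoidHom.id _, fun _ => rfl, fun _ _ _ => rfl⟩
def trivH {G G' : Type} [Group G] [Group G'] (f : G →* G') : GHom (trivM G) (trivM G') :=
  ⟨f, AddMonoidHom.id _, fun _ _ => rfl⟩
theorem trivH_comp {G G' G'' : Type} [Group G] [Group G'] [Group G''] (f : G →* G') (f' : G' →* G'') :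
    (trivH f').comp (trivH f) = trivH (f'.comp f) := rfl

def scal (c : K) : SD act →* SD act :=
  SDm (c • LinearMap.id) (MonoidHom.id _) (fun l a => by simp)

def sdD : DAct K (trivM (SD act)) where
  φ c := trivH (scal act c)
  one := GHom.ext' (fun g => by
    show SD.mk _ _ = _
    ext
    · exact one_smul _ _
    · rfl) (fun _ => rfl)
  mul c c' := GHom.ext' (fun g => by
    show SD.mk _ _ = SD.mk _ _
    ext
    · exact mul_smul _ _ _
    · rfl) (fun _ => rfl)

/-- the doubled action -/
def act2 : L →* Module.End K (A × A) where
  toFun l := (act l).prodMap (act l)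
  map_one' := by ext <;> simp
  map_mul' x y := by ext <;> simp

def affAct : GAct (trivM (SD (act2 act))).G A where
  act g x := g.a.1 + act g.l x
  one x := by
    show (0 : A) + act 1 x = x
    simp
  mul g h x := by
    show (g.a + act2 act g.l h.a).1 + act (g.l * h.l) x = _
    simp [act2, add_assoc]

def sc2 (c : K) : SD (act2 act) →* SD (act2 act) :=
  SDm (LinearMap.prodMap LinearMap.id (c • LinearMap.id)) (MonoidHom.id _)
    (fun l a => by simp [act2])

theorem sc2_one : sc2 act (1 : K) = MonoidHom.id _ := by
  ext x <;> simp [sc2, SDm]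
theorem sc2_mul (c c' : K) : sc2 act (c * c') = (sc2 act c).comp (sc2 act c') := by
  ext x <;> simp [sc2, SDm, mul_smul]

noncomputable def labDA (p : ℕ) : DAct K (labM (tupAct (affAct act) p)) where
  φ c := ⟨sc2 act c, AddMonoidHom.id _, fun g m => rfl⟩
  one := GHom.ext' (fun g => by
    show sc2 act (1 : K) g = g
    rw [sc2_one]; rfl) (fun _ => rfl)
  mul c c' := GHom.ext' (fun g => by
    show sc2 act (c * c') g = _
    rw [sc2_mul]; rfl) (fun _ => rfl)

def triv2D : DAct K (trivM (SD (act2 act))) where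
  φ c := trivH (sc2 act c)
  one := GHom.ext' (fun g => by
    show sc2 act (1 : K) g = g
    rw [sc2_one]; rfl) (fun _ => rfl)
  mul c c' := GHom.ext' (fun g => by
    show sc2 act (c * c') g = _
    rw [sc2_mul]; rfl) (fun _ => rfl)
end SD

/-- `s` kills homology in degrees `≤ j` -/
def Kills (K : Type) [Field K] (s : MonoidAlgebra ℤ K) (j : ℕ) : Prop :=
  ∀ (A L : Type) (_ : AddCommGroup A) (_ : Module K A) (_ : Group L) (act : L →* Module.End K A) (q : ℕ),
    q < j → ∀ y : H (trivM (SD act)) q, op ((sdD act).H q) s y = 0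

section step
variable {K : Type} [Field K] {A L : Type} [AddCommGroup A] [Module K A] [Group L]
  (act : L →* Module.End K A)

/-- stabilizer of a word -/
def wst {p : ℕ} (w : Tup A p) : Subgroup L where
  carrier := {l | tmap (act l) w = w}
  one_mem' := by
    have : tmap (act (1 : L)) w = tmap (fun x => x) w := by
      rw [map_one]; rfl
    exact this.trans (tmap_id w)
  mul_mem' {x y} hx hy := by
    have : tmap (act (x * y)) w = tmap (act x) (tmap (act y) w) := by
      rw [tmap_comp, map_mul]; rfl
    show _ = _
    rw [this, hy, hx]
  inv_mem' {x} hx := by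
    have : tmap (act x⁻¹) (tmap (act x) w) = w := by
      rw [tmap_comp]
      have : (fun v => act x⁻¹ (act x v)) = fun v => v := by
        funext v; simp [← Module.End.mul_apply, ← map_mul]
      rw [this, tmap_id]
    show _ = _
    nth_rewrite 1 [← (show tmap (act x) w = w from hx)]
    exact this

abbrev wact {p : ℕ} (w : Tup A p) : wst act w →* Module.End K A := act.comp (wst act w).subtype

def wF {p : ℕ} (w : Tup A p) : GHom (trivM (SD (wact act w))) (trivM (SD (act2 act))) :=
  trivH (SDm (LinearMap.inr K A A) (wst act w).subtype (fun l a => by simp [act2, wact]))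

theorem wF_fix {p : ℕ} (w : Tup A p) (b) :
    (tupAct (affAct act) (p + 1)).act ((wF act w).f b) (tc 0 w) = tc 0 w := by
  have h0 : (affAct act).act ((wF act w).f b) = act b.l := by
    funext x
    show (0 : A) + act b.l x = act b.l x
    simp
  show tmap _ _ = _
  rw [h0]
  show tc (act b.l 0) (tmap (act b.l) w) = _
  rw [map_zero, b.l.2]

theorem wF_inj {p : ℕ} (w : Tup A p) : Function.Injective (wF act w).f := by
  intro x y h
  have h1 : (SD.mk (0, x.a) (x.l : L) : SD (act2 act)) = SD.mk (0, y.a) (y.l : L) := h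
  injection h1 with h1 h2
  injection h1 with h0 h1
  exact SD.ext h1 (Subtype.ext h2)

theorem wF_st {p : ℕ} (w : Tup A p) (g : SD (act2 act))
    (h : (tupAct (affAct act) (p + 1)).act g (tc 0 w) = tc 0 w) : ∃ b, (wF act w).f b = g := by
  have h' : tc ((affAct act).act g 0) (tmap ((affAct act).act g) w) = tc 0 w := h
  injection h' with _ h1 h2
  have h1 : g.a.1 + act g.l 0 = 0 := h1
  rw [map_zero, add_zero] at h1
  have h0 : (affAct act).act g = act g.l := by
    funext x
    show g.a.1 + act g.l x = act g.l x
    rw [h1, zero_add]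
  rw [h0] at h2
  refine ⟨⟨g.a.2, ⟨g.l, h2⟩⟩, ?_⟩
  show SD.mk (0, g.a.2) g.l = g
  ext
  · exact h1.symm
  · rfl
  · rfl

theorem wF_orb {p : ℕ} (w : Tup A (p + 1)) :
    ∃ (r : Tup A p) (g : SD (act2 act)), (tupAct (affAct act) (p + 1)).act g (tc 0 r) = w := by
  obtain ⟨x, w, rfl⟩ := tup_succ w
  refine ⟨tmap (fun y => y - x) w, ⟨(x, 0), 1⟩, ?_⟩
  have h0 : (affAct act).act ⟨(x, 0), 1⟩ = fun y => x + y := by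
    funext y
    show x + act 1 y = _
    simp
  show tmap _ _ = _
  rw [h0]
  show tc _ _ = _
  rw [tmap_comp]
  have : (fun y : A => x + (y - x)) = fun y => y := by funext y; abel
  rw [this, tmap_id]
  show tc (x + 0) w = _
  rw [add_zero]

theorem lab_kill {s : MonoidAlgebra ℤ K} {j : ℕ} (hs : Kills K s j) (p r : ℕ) (hr : r < j)
    (y : H (labM (tupAct (affAct act) (p + 1))) r) : op ((labDA act (p + 1)).H r) s y = 0 := by
  have := F2lab (tupAct (affAct act) (p + 1)) (R := Tup A p) (fun w => trivM (SD (wact act w)))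
    (fun w => wF act w) (fun w => tc 0 w) (wF_fix act) (wF_inj act) (fun _ => Function.bijective_id)
    (wF_st act) (wF_orb act) r (op ((labDA act (p + 1)).H r) s).ker (fun w y => ?_) y
  · exact this
  · show op ((labDA act (p + 1)).H r) s _ = 0
    rw [← DAct.Hm (sdD (wact act w)), hs _ _ _ _ _ _ r hr, map_zero]
    intro c
    refine GHom.ext' (fun g => ?_) (fun _ => rfl)
    show SD.mk (0, c • g.a) (g.l : L) = SD.mk (0, c • (g.a)) (g.l : L)
    rfl

def e1 : SD (act2 act) →* SD (act2 act) :=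
  SDm ((LinearMap.inr K A A).comp (LinearMap.snd K A A)) (MonoidHom.id _)
    (fun l a => by simp [act2])

theorem step_e1 {s : MonoidAlgebra ℤ K} {j : ℕ} (hs : Kills K s j)
    (y : H (trivM (SD (act2 act))) j) :
    Hm (trivH (e1 act)) j (op ((triv2D act).H j) (s ^ j) y) = op ((triv2D act).H j) (s ^ j) y := by
  obtain ⟨z, hz, rfl⟩ := cls_surj y
  have hRL := RLop (fun p => labM (tupAct (affAct act) p)) (labD (affAct act))
    (fun _ => Function.bijective_id) (fun p q => op ((labDA act p).C q) s)
    (fun p q c => ((labDA act p).dd s c).symm)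
    (fun p q c => ((labDA act (p + 1)).mapC (labDA act p) (labD (affAct act) p)
      (fun c => GHom.ext' (fun _ => rfl) (fun _ => rfl)) s c).symm)
    (fun p m => wd_wd m) j (labD_surj (affAct act) 0) (fun q _ m h => labD_exact (affAct act) 0 q m h)
    (fun q r hq w hw => by
      obtain ⟨h1, h2⟩ := (labDA act (q + 2)).cls s hw
      rw [lab_kill act hs (q + 1) r (by omega)] at h2
      exact cls_eq_zero.1 h2.symm)
    (mapC (labT (affAct act)) z) (mapC_cyc _ hz)
  obtain ⟨w, hw, h⟩ := hRL
  rw [← op_pow, ← (triv2D act).mapC (labDA act 0) (labT (affAct act))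
    (fun c => GHom.ext' (fun _ => rfl) (fun _ => rfl))] at h
  have h' := congrArg (mapC (sumM (tupAct (affAct act) 0))) h
  have hid : (sumM (tupAct (affAct act) 0)).comp (labT (affAct act)) = GHom.id _ :=
    GHom.ext' (fun _ => rfl) (fun m => by simp [GHom.comp, sumM, labT, GHom.id])
  rw [← mapC_comp, ← mapC_comp, hid, mapC_id] at h'
  obtain ⟨hz', h2⟩ := (triv2D act).cls (s ^ j) hz
  rw [h2]
  have h3 : cls ⟨_, hz'⟩ = Hm ((sumM (tupAct (affAct act) 0)).comp (labD (affAct act) 0)) j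
      (cls ⟨w, hw⟩) := by
    rw [Hm_cls]; congr 1; exact Subtype.ext h'.symm
  rw [h3]
  have := F2lab (tupAct (affAct act) 1) (R := Tup A 0) (fun w => trivM (SD (wact act w)))
    (fun w => wF act w) (fun w => tc 0 w) (wF_fix act) (wF_inj act) (fun _ => Function.bijective_id)
    (wF_st act) (wF_orb act) j (((Hm (trivH (e1 act)) j - AddMonoidHom.id _).comp
      (Hm ((sumM (tupAct (affAct act) 0)).comp (labD (affAct act) 0)) j)).ker) (fun w y => ?_)
      (cls ⟨w, hw⟩)
  · exact sub_eq_zero.1 this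
  · show Hm (trivH (e1 act)) j _ - _ = 0
    rw [sub_eq_zero]
    show _ = Hm _ _ _
    rw [← Hm_comp, ← Hm_comp, ← Hm_comp]
    refine congrArg (fun E => Hm E j y) (GHom.ext' (fun g => ?_) (fun m => rfl))
    show SD.mk ((0 : A), _) _ = SD.mk (0, _) _
    rfl

noncomputable def chi0 : K →* ℤ := by
  classical
  exact
  { toFun := fun c => if c = 0 then 0 else 1
    map_one' := by simp
    map_mul' := fun a b => by by_cases ha : a = 0 <;> by_cases hb : b = 0 <;> simp [ha, hb] }
theorem chi0_zero : chi0 (0 : K) = 0 := by simp [chi0]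
theorem chi0_ne {c : K} (h : c ≠ 0) : chi0 c = 1 := by simp [chi0, h]

/-- support character -/
noncomputable def chi : MonoidAlgebra ℤ K →ₐ[ℤ] ℤ := MonoidAlgebra.lift ℤ ℤ K chi0
noncomputable def eps : MonoidAlgebra ℤ K →ₐ[ℤ] ℤ := MonoidAlgebra.lift ℤ ℤ K 1

noncomputable def shift (α : K) (t : MonoidAlgebra ℤ K) : MonoidAlgebra ℤ K :=
  MonoidAlgebra.ofCoeff (Finsupp.mapDomain (α + ·) t.coeff)

theorem shift_single (α c : K) (m : ℤ) :
    shift α (MonoidAlgebra.single c m) = MonoidAlgebra.single (α + c) m := by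
  simp only [shift, MonoidAlgebra.coeff_single, Finsupp.mapDomain_single]
  rfl
theorem shift_add (α : K) (s t : MonoidAlgebra ℤ K) : shift α (s + t) = shift α s + shift α t := by
  simp only [shift, MonoidAlgebra.coeff_add, Finsupp.mapDomain_add]
  rfl
theorem shift_zero (α : K) : shift α (0 : MonoidAlgebra ℤ K) = 0 := by
  simp only [shift, MonoidAlgebra.coeff_zero, Finsupp.mapDomain_zero]
  rfl

theorem chi_shift (t : MonoidAlgebra ℤ K) [Infinite K] : ∃ α : K, chi (shift α t) = eps t := by
  suffices ∃ F : Finset K, ∀ α ∉ F, chi (shift α t) = eps t by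
    obtain ⟨F, h⟩ := this
    obtain ⟨α, hα⟩ := Infinite.exists_notMem_finset F
    exact ⟨α, h α hα⟩
  classical
  induction t using MonoidAlgebra.induction_linear with
  | zero => exact ⟨∅, fun α _ => by rw [shift_zero, map_zero, map_zero]⟩
  | add s t hs ht =>
    obtain ⟨F, hF⟩ := hs
    obtain ⟨F', hF'⟩ := ht
    refine ⟨F ∪ F', fun α h => ?_⟩
    rw [Finset.mem_union, not_or] at h
    rw [shift_add, map_add, map_add, hF α h.1, hF' α h.2]
  | single c m =>
    refine ⟨{-c}, fun α h => ?_⟩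
    rw [Finset.mem_singleton] at h
    rw [shift_single, chi, eps, MonoidAlgebra.lift_single, MonoidAlgebra.lift_single,
      chi0_ne (fun h' => h (eq_neg_of_add_eq_zero_left h'))]
    simp

def uA (α : K) : SD act →* SD (act2 act) :=
  SDm (LinearMap.prod (α • LinearMap.id) LinearMap.id) (MonoidHom.id _)
    (fun l a => by simp [act2])
def sA : SD (act2 act) →* SD act :=
  SDm (LinearMap.fst K A A + LinearMap.snd K A A) (MonoidHom.id _)
    (fun l a => by simp [act2])

theorem op_shift (α : K) (t : MonoidAlgebra ℤ K) {j : ℕ} (y : H (trivM (SD act)) j) :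
    Hm (trivH (sA act)) j (op ((triv2D act).H j) t (Hm (trivH (uA act α)) j y)) =
      op ((sdD act).H j) (shift α t) y := by
  induction t using MonoidAlgebra.induction_linear with
  | zero => simp only [shift_zero, op_zero, map_zero]
  | add s t hs ht => simp only [shift_add, op_add, map_add, hs, ht]
  | single c m =>
    rw [shift_single, op_single, op_single, map_zsmul, DAct.H_apply, DAct.H_apply,
      ← Hm_comp, ← Hm_comp]
    refine congrArg (fun E => m • Hm E j y) (GHom.ext' (fun g => ?_) (fun m => rfl))
    show SD.mk _ _ = SD.mk _ _
    ext
    · show α • g.a + c • g.a = (α + c) • g.a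
      rw [add_smul]
    · rfl

theorem op_shift' (α : K) (t : MonoidAlgebra ℤ K) {j : ℕ} (y : H (trivM (SD act)) j) :
    Hm (trivH (sA act)) j (Hm (trivH (e1 act)) j
      (op ((triv2D act).H j) t (Hm (trivH (uA act α)) j y))) =
      op ((sdD act).H j) t y := by
  induction t using MonoidAlgebra.induction_linear with
  | zero => simp only [op_zero, map_zero]
  | add s t hs ht => simp only [op_add, map_add, hs, ht]
  | single c m =>
    rw [op_single, op_single, map_zsmul, map_zsmul, DAct.H_apply, DAct.H_apply,
      ← Hm_comp, ← Hm_comp, ← Hm_comp]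
    refine congrArg (fun E => m • Hm E j y) (GHom.ext' (fun g => ?_) (fun m => rfl))
    show SD.mk _ _ = SD.mk _ _
    ext
    · show 0 + c • g.a = c • g.a
      rw [zero_add]
    · rfl

theorem kills_step {s : MonoidAlgebra ℤ K} {j : ℕ} (hs : Kills K s j) (α : K) :
    Kills K ((shift α (s ^ j) - s ^ j) * s) (j + 1) := by
  intro A L _ _ _ act q hq y
  rcases Nat.lt_succ_iff_lt_or_eq.1 hq with h | rfl
  · rw [op_mul, hs _ _ _ _ _ _ q h, map_zero]
  · rw [mul_comm, op_mul]
    have : op ((sdD act).H q) (shift α (s ^ q) - s ^ q) y = 0 := by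
      rw [op_sub, ← op_shift, ← op_shift' act α, step_e1 act hs, sub_self]
    rw [this, map_zero]

theorem Hm_triv_zero {G G' : Type} [Group G] [Group G'] (f f' : G →* G') (y : H (trivM G) 0) :
    Hm (trivH f) 0 y = Hm (trivH f') 0 y := by
  obtain ⟨z, hz, rfl⟩ := cls_surj y
  rw [Hm_cls, Hm_cls]
  congr 2
  refine hom_ext_apply (mapC (trivH f)) (mapC (trivH f')) (fun x m => ?_) z
  rw [mapC_single, mapC_single, tup_zero x]
  rfl

theorem kills_exists (K : Type) [Field K] [Infinite K] (j : ℕ) :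
    ∃ s : MonoidAlgebra ℤ K, Kills K s (j + 1) ∧ eps s = 0 ∧ IsUnit (chi s) := by
  induction j with
  | zero =>
    refine ⟨MonoidAlgebra.single 1 1 - MonoidAlgebra.single 0 1, ?_, ?_, ?_⟩
    · intro A L _ _ _ act q hq y
      obtain rfl : q = 0 := by omega
      rw [op_sub, op_single, op_single, DAct.H_apply, DAct.H_apply]
      exact sub_eq_zero.2 (congrArg _ (Hm_triv_zero _ _ y))
    · simp [eps, map_sub, MonoidAlgebra.lift_single]
    · simp [chi, map_sub, MonoidAlgebra.lift_single, chi0_zero]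
  | succ j ih =>
    obtain ⟨s, h1, h2, h3⟩ := ih
    obtain ⟨α, hα⟩ := chi_shift (s ^ (j + 1))
    refine ⟨_, kills_step h1 α, ?_, ?_⟩
    · rw [map_mul, h2, mul_zero]
    · rw [map_mul, map_sub, hα, map_pow, h2, map_pow, zero_pow (by omega), zero_sub]
      exact (h3.pow _).neg.mul h3

theorem torus_kill [Infinite K] {j : ℕ}
    (ht : ∀ t : K, t ≠ 0 → ∀ y, Hm (trivH (scal act t)) j y = y) (y : H (trivM (SD act)) j) :
    Hm (trivH (scal act (0 : K))) j y = y := by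
  obtain ⟨s, h1, h2, h3⟩ := kills_exists K j
  have key : ∀ t : MonoidAlgebra ℤ K, op ((sdD act).H j) t y =
      chi t • (y - Hm (trivH (scal act (0 : K))) j y) + eps t • Hm (trivH (scal act (0 : K))) j y := by
    intro t
    induction t using MonoidAlgebra.induction_linear with
    | zero => simp only [op_zero, map_zero, zero_smul, add_zero]
    | add s t hs ht => simp only [op_add, map_add, hs, ht, add_smul]; abel
    | single c m =>
      rw [op_single, DAct.H_apply, chi, eps, MonoidAlgebra.lift_single, MonoidAlgebra.lift_single]
      by_cases hc : c = 0
      · subst hc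
        rw [chi0_zero]
        show m • Hm (trivH (scal act (0 : K))) j y = _
        simp
      · rw [chi0_ne hc]
        show m • Hm (trivH (scal act c)) j y = _
        rw [ht c hc]
        simp [smul_sub]
  have h4 := key s
  rw [h1 _ _ _ _ _ _ j (by omega), h2, zero_smul, add_zero] at h4
  rcases Int.isUnit_iff.1 h3 with h | h <;> rw [h] at h4
  · rw [one_smul] at h4; exact (sub_eq_zero.1 h4.symm).symm
  · rw [neg_smul, one_smul] at h4
    exact (sub_eq_zero.1 (neg_eq_zero.1 h4.symm)).symm
end step

end P5

section P6
open Tup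
/-! ### word complexes with constraints -/
section
variable {X N N' : Type} [AddCommGroup N] [AddCommGroup N']

/-- finitely supported functions with constrained values -/
def inn (J : X → AddSubgroup N) : AddSubgroup (X →₀ N) where
  carrier := {c | ∀ x, c x ∈ J x}
  zero_mem' := fun _ => zero_mem _
  add_mem' := fun h h' x => add_mem (h x) (h' x)
  neg_mem' := fun h x => neg_mem (h x)

theorem mem_inn {J : X → AddSubgroup N} {c : X →₀ N} : c ∈ inn J ↔ ∀ x, c x ∈ J x := Iff.rfl

theorem single_inn {J : X → AddSubgroup N} {x : X} {n : N} (h : n ∈ J x) :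
    Finsupp.single x n ∈ inn J := by
  classical
  intro y
  rw [Finsupp.single_apply]
  split_ifs with e
  · exact e ▸ h
  · exact zero_mem _

theorem inn_ind {J : X → AddSubgroup N} (f : (X →₀ N) →+ N') (K : AddSubgroup N')
    (h : ∀ x, ∀ n ∈ J x, f (Finsupp.single x n) ∈ K) {c : X →₀ N} (hc : c ∈ inn J) : f c ∈ K := by
  rw [← Finsupp.sum_single c, Finsupp.sum, map_sum]
  exact sum_mem fun x _ => h x _ (hc x)

theorem inn_ext {J : X → AddSubgroup N} (f g : (X →₀ N) →+ N')
    (h : ∀ x, ∀ n ∈ J x, f (Finsupp.single x n) = g (Finsupp.single x n)) {c : X →₀ N}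
    (hc : c ∈ inn J) : f c = g c := by
  have := inn_ind (f - g) ⊥ (fun x n hn => by simp [h x n hn]) hc
  simpa [sub_eq_zero] using this

/-- zero unless `p` -/
def gate (N : Type) [AddCommGroup N] (p : Prop) : AddSubgroup N where
  carrier := {n | ¬ p → n = 0}
  zero_mem' := fun _ => rfl
  add_mem' := fun h h' hp => by rw [h hp, h' hp, add_zero]
  neg_mem' := fun h hp => by rw [h hp, neg_zero]

theorem mem_gate {p : Prop} {n : N} : n ∈ gate N p ↔ (¬ p → n = 0) := Iff.rfl
theorem gate_pos {p : Prop} {n : N} (h : p) : n ∈ gate N p := fun h' => absurd h h'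
theorem gate_mono {p p' : Prop} (h : p → p') : gate N p ≤ gate N p' := fun _ hn hp => hn (fun h' => hp (h h'))
end

section
variable {V N : Type} [AddCommGroup N]

/-- the set of letters of a word -/
def ent : ∀ {q : ℕ}, Tup V q → Set V
  | _, tn => ∅
  | _, tc y w => insert y (ent w)

theorem ent_finite {q : ℕ} (w : Tup V q) : (ent w).Finite := by
  induction w with
  | tn => exact Set.finite_empty
  | tc y w ih => exact ih.insert y

def wc (J : Set V → AddSubgroup N) (q : ℕ) : AddSubgroup (Tup V q →₀ N) :=
  inn fun w => J (ent w)

theorem consL_wc {J : Set V → AddSubgroup N} {q : ℕ} (y : V) {c : Tup V q →₀ N}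
    (hc : c ∈ wc (fun s => J (insert y s)) q) : consL y c ∈ wc J (q + 1) := by
  refine inn_ind (consL y) _ (fun w n hn => ?_) hc
  rw [consL_single]
  exact single_inn hn

theorem w0_wc {q : ℕ} (w : Tup V (q + 1)) : ∀ {J : Set V → AddSubgroup N}, Antitone J → ∀ {n : N},
    n ∈ J (ent w) → w0 w n ∈ wc J q := by
  induction q with
  | zero =>
    intro J hJ n hn
    obtain ⟨y, w, rfl⟩ := tup_succ w
    obtain rfl := tup_zero w
    exact single_inn (hJ (Set.subset_insert _ _) hn)
  | succ q ih =>
    intro J hJ n hn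
    obtain ⟨y, w, rfl⟩ := tup_succ w
    show sg w n - consL y (w0 w n) ∈ _
    refine sub_mem (single_inn (hJ (Set.subset_insert _ _) hn)) (consL_wc y ?_)
    exact ih w (fun s t h => hJ (Set.insert_subset_insert h)) hn

theorem wd_wc {J : Set V → AddSubgroup N} (hJ : Antitone J) {q : ℕ} {c : Tup V (q + 1) →₀ N}
    (hc : c ∈ wc J (q + 1)) : wd c ∈ wc J q := by
  refine inn_ind wd _ (fun w n hn => ?_) hc
  rw [wd, lin_single]
  exact w0_wc w hJ hn

theorem wc_mono {J J' : Set V → AddSubgroup N} (h : ∀ s, J s ≤ J' s) {q : ℕ} : wc J q ≤ wc J' q :=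
  fun _ hc w => h _ (hc w)

/-- cycles, augmented -/
def wz : ∀ {q : ℕ}, (Tup V q →₀ N) → Prop
  | 0, _ => True
  | _ + 1, c => wd c = 0

theorem wz_sub {q : ℕ} {c c' : Tup V q →₀ N} (h : wz c) (h' : wz c') : wz (c - c') := by
  cases q with
  | zero => trivial
  | succ q => show wd _ = 0; rw [map_sub, h, h', sub_zero]
theorem wz_wd {q : ℕ} (c : Tup V (q + 1) →₀ N) : wz (wd c) := by
  cases q with
  | zero => trivial
  | succ q => exact wd_wd c

theorem wd_cone {q : ℕ} (y : V) {c : Tup V q →₀ N} (h : wz c) : wd (consL y c) = c := by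
  cases q with
  | zero => exact wd_zero y c
  | succ q => exact wd_exact y c h

/-- exactness at index `q` -/
def Ex (J : Set V → AddSubgroup N) (q : ℕ) : Prop :=
  ∀ c ∈ wc J q, wz c → ∃ b ∈ wc J (q + 1), wd b = c

/-- clique -/
def Cl (r : V → V → Prop) (Y : Set V) (s : Set V) : Prop := s ⊆ Y ∧ ∀ x ∈ s, ∀ z ∈ s, r x z

theorem Cl.mono {r : V → V → Prop} {Y Y' s s' : Set V} (h : Cl r Y s) (hs : s' ⊆ s) (hY : Y ⊆ Y') :
    Cl r Y' s' := ⟨hs.trans (h.1.trans hY), fun x hx z hz => h.2 x (hs hx) z (hs hz)⟩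

def JA (r : V → V → Prop) (Y : Set V) : Set V → AddSubgroup ℤ := fun s => gate ℤ (Cl r Y s)

theorem JA_anti (r : V → V → Prop) (Y : Set V) : Antitone (JA r Y) :=
  fun _ _ h => gate_mono fun hc => hc.mono h subset_rfl
theorem JA_mono {r : V → V → Prop} {Y Y' : Set V} (h : Y ⊆ Y') (s : Set V) : JA r Y s ≤ JA r Y' s :=
  gate_mono fun hc => hc.mono subset_rfl h

def Lk (r : V → V → Prop) (s : Set V) : Set V := {z | ∀ x ∈ s, r z x}

variable {r : V → V → Prop}

theorem Ex_zero {Y : Set V} (hr : ∀ x, r x x) (h : Y.Nonempty) : Ex (JA r Y) 0 := by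
  intro c hc _
  obtain ⟨y, hy⟩ := h
  refine ⟨consL y c, consL_wc y ?_, wd_zero y c⟩
  intro w
  obtain rfl := tup_zero w
  refine gate_pos ⟨?_, ?_⟩ <;> simp [ent, hy, hr]

/-- coning off -/
theorem cone_wc {Y L : Set V} (hr : ∀ x, r x x) (hs : ∀ x y, r x y → r y x) {y : V} (hy : y ∈ Y)
    (hL : L ⊆ Y) (hyL : ∀ z ∈ L, r y z) {q : ℕ} {c : Tup V q →₀ ℤ} (hc : c ∈ wc (JA r L) q) :
    consL y c ∈ wc (JA r Y) (q + 1) := by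
  refine consL_wc y (wc_mono (fun s => gate_mono fun h => ?_) hc)
  refine ⟨Set.insert_subset hy (h.1.trans hL), ?_⟩
  rintro x (rfl | hx) z (rfl | hz)
  · exact hr _
  · exact hyL z (h.1 hz)
  · exact hs _ _ (hyL x (h.1 hx))
  · exact h.2 x hx z hz

/-- adding one vertex -/
theorem add_vertex (hr : ∀ x, r x x) (hs : ∀ x y, r x y → r y x) (Y : Set V) (x : V) {q : ℕ}
    (hL : Ex (JA r (Y ∩ {z | r z x})) q) {c : Tup V (q + 1) →₀ ℤ}
    (hc : c ∈ wc (JA r (insert x Y)) (q + 1)) (hz : wd c = 0) :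
    ∃ c' ∈ wc (JA r Y) (q + 1), wd c' = 0 ∧ ∃ b ∈ wc (JA r (insert x Y)) (q + 2), c - c' = wd b := by
  classical
  set L := Y ∩ {z | r z x} with hLdef
  have hLx : insert x L ⊆ insert x Y := Set.insert_subset_insert Set.inter_subset_left
  set u := filtL (fun w => x ∉ ent w) c with hu
  have huY : u ∈ wc (JA r Y) (q + 1) := by
    intro w
    by_cases h : x ∉ ent w
    · rw [hu, filtL_pos c h]
      refine gate_mono (fun hcl => ⟨?_, hcl.2⟩) (hc w)
      intro z hz'
      rcases hcl.1 hz' with rfl | h'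
      · exact absurd hz' h
      · exact h'
    · rw [hu, filtL_neg c h]; exact zero_mem _
  have hvL : c - u ∈ wc (JA r (insert x L)) (q + 1) := by
    intro w
    rw [Finsupp.sub_apply]
    by_cases h : x ∉ ent w
    · rw [hu, filtL_pos c h, sub_self]; exact zero_mem _
    · rw [hu, filtL_neg c h, sub_zero]
      refine gate_mono (fun hcl => ⟨?_, hcl.2⟩) (hc w)
      intro z hz'
      rcases hcl.1 hz' with rfl | h'
      · exact Set.mem_insert _ _
      · exact Set.mem_insert_of_mem _ ⟨h', hcl.2 z hz' x (not_not.1 h)⟩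
  have h1 : wd (c - u) ∈ wc (JA r L) q := by
    intro w
    have ha := wd_wc (JA_anti r _) hvL w
    have hb := wd_wc (JA_anti r _) huY w
    have hbb : wd (c - u) = - wd u := by rw [map_sub, hz, zero_sub]
    intro hn
    by_cases hp : Cl r (insert x L) (ent w)
    · rw [hbb, Finsupp.neg_apply, neg_eq_zero]
      refine hb fun hp' => hn ⟨?_, hp.2⟩
      intro z hz'
      rcases hp.1 hz' with rfl | h
      · exact ⟨hp'.1 hz', hr _⟩
      · exact h
    · exact ha hp
  obtain ⟨l, hl, hl'⟩ := hL _ h1 (wz_wd _)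
  have hlY : l ∈ wc (JA r Y) (q + 1) := wc_mono (JA_mono Set.inter_subset_left) hl
  have hlL : l ∈ wc (JA r (insert x L)) (q + 1) := wc_mono (JA_mono (Set.subset_insert _ _)) hl
  have hcyc : wd (c - u - l) = 0 := by rw [map_sub, hl', sub_self]
  refine ⟨u + l, add_mem huY hlY, ?_, consL x (c - u - l), ?_, ?_⟩
  · have : u + l = c - (c - u - l) := by abel
    rw [this, map_sub, hz, hcyc, sub_zero]
  · refine cone_wc hr hs (Set.mem_insert _ _) hLx ?_ (sub_mem hvL hlL)
    rintro z (rfl | hz')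
    · exact hr _
    · exact hs _ _ hz'.2
  · rw [wd_exact x _ hcyc]; abel

theorem bad_fin (hr : ∀ x, r x x) (hs : ∀ x y, r x y → r y x) (F : Finset V) : ∀ (Y : Set V) (m : ℕ),
    (∀ σ : Finset V, σ ⊆ F → σ.Nonempty → (∀ x ∈ σ, ∀ z ∈ σ, r x z) → ∀ q, q + σ.card ≤ m →
      Ex (JA r (Y ∩ Lk r σ)) q) → ∀ q, q ≤ m → ∀ c ∈ wc (JA r (Y ∪ F)) q, wz c →
      ∃ c' ∈ wc (JA r Y) q, wz c' ∧ ∃ b ∈ wc (JA r (Y ∪ F)) (q + 1), c - c' = wd b := by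
  classical
  induction F using Finset.strongInduction with | H F0 ih => ?_
  rcases F0.eq_empty_or_nonempty with rfl | ⟨x, hx0⟩
  · intro Y m _ q _ c hc hz
    have : Y ∪ ((∅ : Finset V) : Set V) = Y := by simp
    rw [this] at hc
    exact ⟨c, hc, hz, 0, zero_mem _, by simp⟩
  · obtain ⟨F, hx, rfl⟩ : ∃ F, x ∉ F ∧ F0 = insert x F :=
      ⟨F0.erase x, Finset.notMem_erase _ _, (Finset.insert_erase hx0).symm⟩
    intro Y m hσ q hq c hc hz
    have hYF : Y ∪ ((insert x F : Finset V) : Set V) = insert x (Y ∪ F) := by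
      rw [Finset.coe_insert, Set.union_insert]
    cases q with
    | zero =>
      refine ⟨c, ?_, trivial, 0, zero_mem _, by simp⟩
      intro w
      obtain rfl := tup_zero w
      exact gate_pos (by simp [Cl, ent])
    | succ q =>
      rw [hYF] at hc ⊢
      have hE : Ex (JA r ((Y ∪ F) ∩ {z | r z x})) q := by
        intro d hd hdz
        set F' := F.filter (fun z => r z x) with hF'
        have e1 : (Y ∪ F) ∩ {z | r z x} = (Y ∩ {z | r z x}) ∪ (F' : Set V) := by
          ext z; simp [hF']; tauto
        rw [e1] at hd ⊢
        have hlk : ∀ σ : Finset V, Y ∩ {z | r z x} ∩ Lk r σ = Y ∩ Lk r (insert x σ : Finset V) := by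
          intro σ; ext z; simp [Lk]; tauto
        have ih' : ∃ c' ∈ wc (JA r (Y ∩ {z | r z x})) q, wz c' ∧ ∃ b ∈ wc (JA r ((Y ∩ {z | r z x}) ∪ F'))
            (q + 1), d - c' = wd b := by
          have hbig : ∀ σ : Finset V, σ ⊆ F' → σ.Nonempty → (∀ x ∈ σ, ∀ z ∈ σ, r x z) →
              ∀ q, q + σ.card ≤ m - 1 → Ex (JA r (Y ∩ {z | r z x} ∩ Lk r σ)) q := by
            intro σ h1 h2 h3 q' hq'
            rw [hlk]
            have hxσ : x ∉ σ := fun h => hx (Finset.mem_of_mem_filter x (h1 h))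
            refine hσ _ ?_ ⟨x, Finset.mem_insert_self _ _⟩ ?_ q' ?_
            · exact Finset.insert_subset_insert x (h1.trans (Finset.filter_subset _ _))
            · intro a ha z hz'
              rw [Finset.mem_insert] at ha hz'
              rcases ha with rfl | ha <;> rcases hz' with rfl | hz'
              · exact hr _
              · exact hs _ _ (Finset.mem_filter.1 (h1 hz')).2
              · exact (Finset.mem_filter.1 (h1 ha)).2
              · exact h3 a ha z hz'
            · rw [Finset.card_insert_of_notMem hxσ]; omega
          exact ih F' ((Finset.filter_subset _ _).trans_ssubset (Finset.ssubset_insert hx)) _ (m - 1) hbig q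
            (by omega) d hd hdz
        obtain ⟨d', hd', hz', b, hb, e⟩ := ih'
        have h0 := hσ {x} (by simp) ⟨x, by simp⟩ (by simp [hr]) q (by simp; omega)
        have h00 : Y ∩ Lk r (({x} : Finset V) : Set V) = Y ∩ {z | r z x} := by ext z; simp [Lk]
        rw [h00] at h0
        obtain ⟨b', hb', e'⟩ := h0 d' hd' hz'
        refine ⟨b + b', add_mem hb (wc_mono (JA_mono Set.subset_union_left) hb'), ?_⟩
        rw [map_add, ← e, e']; abel
      obtain ⟨c1, hc1, hz1, b1, hb1, e1⟩ := add_vertex hr hs (Y ∪ F) x hE hc hz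
      obtain ⟨c2, hc2, hz2, b2, hb2, e2⟩ := ih F (Finset.ssubset_insert hx) Y m (fun σ h => hσ σ (h.trans (Finset.subset_insert _ _)))
        (q + 1) hq c1 hc1 hz1
      refine ⟨c2, hc2, hz2, b1 + b2, add_mem hb1 (wc_mono (JA_mono (Set.subset_insert _ _)) hb2), ?_⟩
      rw [map_add, ← e1, ← e2]; abel

/-- bad cliques -/
theorem bad_clique (hr : ∀ x, r x x) (hs : ∀ x y, r x y → r y x) {Y X : Set V} (hYX : Y ⊆ X) (m : ℕ)
    (h : ∀ σ : Finset V, ↑σ ⊆ X \ Y → σ.Nonempty → (∀ x ∈ σ, ∀ z ∈ σ, r x z) → ∀ q, q + σ.card ≤ m →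
      Ex (JA r (Y ∩ Lk r σ)) q) (q : ℕ) (hq : q ≤ m) (c : Tup V q →₀ ℤ) (hc : c ∈ wc (JA r X) q)
    (hz : wz c) : ∃ c' ∈ wc (JA r Y) q, wz c' ∧ ∃ b ∈ wc (JA r X) (q + 1), c - c' = wd b := by
  classical
  have hfin : (⋃ w ∈ c.support, ent w).Finite := c.support.finite_toSet.biUnion fun w _ => ent_finite w
  set F : Finset V := hfin.toFinset.filter (fun x => x ∈ X \ Y) with hF
  have hFX : Y ∪ (F : Set V) ⊆ X := Set.union_subset hYX fun x hx => by
    have := (Finset.mem_filter.1 hx).2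
    exact this.1
  obtain ⟨c', h1, h2, b, h3, h4⟩ := bad_fin hr hs F Y m (fun σ hσ => h σ fun x hx =>
    (Finset.mem_filter.1 (hσ hx)).2) q hq c (by
      intro w hn
      by_contra hne
      have hcl : Cl r X (ent w) := by
        by_contra h'
        exact hne (hc w h')
      refine hn ⟨fun x hx => ?_, hcl.2⟩
      by_cases hxY : x ∈ Y
      · exact Or.inl hxY
      · refine Or.inr (Finset.mem_coe.2 (Finset.mem_filter.2 ⟨?_, hcl.1 hx, hxY⟩))
        rw [Set.Finite.mem_toFinset]
        exact Set.mem_biUnion (Finset.mem_coe.2 (Finsupp.mem_support_iff.2 hne)) hx) hz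
  exact ⟨c', h1, h2, b, wc_mono (JA_mono hFX) h3, h4⟩
end

end P6

section P7
open Tup
section
variable {O X : Type}

noncomputable def aug : (X →₀ ℤ) →+ ℤ := lin fun _ => AddMonoidHom.id ℤ
@[simp] theorem aug_single (x : X) (n : ℤ) : aug (Finsupp.single x n) = n := by simp [aug]

/-- chains supported on `Z` -/
def Zz (Z : Set X) : AddSubgroup (X →₀ ℤ) := inn fun x => gate ℤ (x ∈ Z)
theorem Zz_mono {Z Z' : Set X} (h : Z ⊆ Z') : Zz Z ≤ Zz Z' :=
  fun _ hn x => gate_mono (fun hx => h hx) (hn x)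
theorem single_Zz {Z : Set X} {x : X} (h : x ∈ Z) (n : ℤ) : Finsupp.single x n ∈ Zz Z :=
  single_inn (gate_pos h)

/-- chains of augmentation zero supported on `Z` -/
noncomputable def Rz (Z : Set X) : AddSubgroup (X →₀ ℤ) := Zz Z ⊓ aug.ker

def Xs (X0 : Set X) (T : O → X → Prop) (s : Set O) : Set X := {x | x ∈ X0 ∧ ∀ o ∈ s, T o x}
theorem Xs_anti (X0 : Set X) (T : O → X → Prop) : Antitone (Xs X0 T) :=
  fun _ _ h _ hx => ⟨hx.1, fun o ho => hx.2 o (h ho)⟩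

variable (r : O → O → Prop) (Y : Set O) (X0 : Set X) (T : O → X → Prop)

noncomputable def JC (s : Set O) : AddSubgroup (X →₀ ℤ) := gate _ (Cl r Y s) ⊓ Zz (Xs X0 T s)
noncomputable def JR (s : Set O) : AddSubgroup (X →₀ ℤ) := gate _ (Cl r Y s) ⊓ Rz (Xs X0 T s)

theorem JC_anti : Antitone (JC r Y X0 T) := fun _ _ h _ hn =>
  ⟨gate_mono (fun hc => hc.mono h subset_rfl) hn.1, Zz_mono (Xs_anti X0 T h) hn.2⟩
theorem JR_anti : Antitone (JR r Y X0 T) := fun _ _ h _ hn =>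
  ⟨gate_mono (fun hc => hc.mono h subset_rfl) hn.1, Zz_mono (Xs_anti X0 T h) hn.2.1, hn.2.2⟩

noncomputable abbrev cf {N N' : Type} [AddCommGroup N] [AddCommGroup N'] (φ : N →+ N') {q : ℕ} :
    (Tup O q →₀ N) →+ (Tup O q →₀ N') := wmap (fun o => o) φ

theorem cf_single {N N' : Type} [AddCommGroup N] [AddCommGroup N'] (φ : N →+ N') {q : ℕ}
    (w : Tup O q) (n : N) : cf φ (Finsupp.single w n) = Finsupp.single w (φ n) := by
  simp [cf, wmap, tmap_id]
theorem cf_apply {N N' : Type} [AddCommGroup N] [AddCommGroup N'] (φ : N →+ N') {q : ℕ}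
    (c : Tup O q →₀ N) (w : Tup O q) : cf φ c w = φ (c w) := by
  classical
  refine hom_ext_apply ((Finsupp.applyAddHom w).comp (cf φ)) (φ.comp (Finsupp.applyAddHom w))
    (fun v n => ?_) c
  simp only [AddMonoidHom.comp_apply, cf_single, Finsupp.applyAddHom_apply, Finsupp.single_apply]
  split_ifs <;> simp

theorem cf_wz {N N' : Type} [AddCommGroup N] [AddCommGroup N'] (φ : N →+ N') {q : ℕ}
    {c : Tup O q →₀ N} (h : wz c) : wz (cf φ c) := by
  cases q with
  | zero => trivial
  | succ q =>
    show wd _ = 0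
    rw [← wmap_wd, show wd c = 0 from h, map_zero]

variable {r Y X0 T}

theorem C_exact {q : ℕ} (h : ∀ x ∈ X0, Ex (JA r (Y ∩ {o | T o x})) q) : Ex (JC r Y X0 T) q := by
  classical
  intro c hc hz
  have hx : ∀ x : X, ∃ b : Tup O (q + 1) →₀ ℤ, cf (Finsupp.singleAddHom x) b ∈ wc (JC r Y X0 T) (q + 1) ∧
      wd b = cf (Finsupp.applyAddHom x) c := by
    intro x
    by_cases hx : x ∈ X0
    · obtain ⟨b, hb, e⟩ := h x hx (cf (Finsupp.applyAddHom x) c) (fun w hn => by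
        rw [cf_apply]
        show c w x = 0
        by_contra hne
        have h1 : Cl r Y (ent w) := by
          by_contra h'
          exact hne (by rw [(hc w).1 h']; rfl)
        have h2 : x ∈ Xs X0 T (ent w) := by
          by_contra h'
          exact hne ((hc w).2 x h')
        exact hn ⟨fun o ho => ⟨h1.1 ho, h2.2 o ho⟩, h1.2⟩) (cf_wz _ hz)
      refine ⟨b, fun w => ?_, e⟩
      rw [cf_apply]
      by_cases hcl : Cl r (Y ∩ {o | T o x}) (ent w)
      · exact ⟨gate_pos (hcl.mono subset_rfl Set.inter_subset_left),
          single_Zz (show x ∈ Xs X0 T (ent w) from ⟨hx, fun o ho => (hcl.1 ho).2⟩) _⟩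
      · rw [hb w hcl, map_zero]; exact zero_mem _
    · refine ⟨0, by rw [map_zero]; exact zero_mem _, ?_⟩
      rw [map_zero]
      ext w
      rw [cf_apply]
      exact ((hc w).2 x (fun h' => hx h'.1)).symm
  choose b hb e using hx
  set F : Finset X := c.support.biUnion fun w => (c w).support with hF
  refine ⟨∑ x ∈ F, cf (Finsupp.singleAddHom x) (b x), sum_mem fun x _ => hb x, ?_⟩
  rw [map_sum]
  ext w x
  simp only [← wmap_wd]
  rw [Finsupp.finsetSum_apply, Finsupp.finsetSum_apply]
  have : ∀ y ∈ F, (cf (Finsupp.singleAddHom y) (wd (b y)) w) x = if y = x then c w x else 0 := by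
    intro y _
    rw [cf_apply, e, cf_apply]
    show Finsupp.single y (c w y) x = _
    rw [Finsupp.single_apply]
    split_ifs with h
    · rw [h]
    · rfl
  rw [Finset.sum_congr rfl this, Finset.sum_ite_eq']
  split_ifs with hxF
  · rfl
  · by_contra hne
    have h1 : c w x ≠ 0 := fun h' => hne h'.symm
    refine hxF (Finset.mem_biUnion.2 ⟨w, ?_, Finsupp.mem_support_iff.2 h1⟩)
    refine Finsupp.mem_support_iff.2 fun h' => h1 ?_
    rw [h']; rfl

theorem R_exact [Nonempty X] {q : ℕ} (hC : ∀ x ∈ X0, Ex (JA r (Y ∩ {o | T o x})) q) (hD : Ex (JA r Y) (q + 1))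
    (hne : ∀ w : Tup O (q + 2), Cl r Y (ent w) → (Xs X0 T (ent w)).Nonempty) : Ex (JR r Y X0 T) q := by
  classical
  intro c hc hz
  obtain ⟨b, hb, e⟩ := C_exact hC c (fun w => ⟨(hc w).1, (hc w).2.1⟩) hz
  have h1 : wd (cf aug b) = 0 := by
    rw [← wmap_wd, e]
    ext w
    rw [cf_apply]
    exact (hc w).2.2
  have h2 : cf aug b ∈ wc (JA r Y) (q + 1) := by
    intro w hn
    rw [cf_apply, (hb w).1 hn, map_zero]
  obtain ⟨d, hd, e'⟩ := hD _ h2 h1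
  choose! ξ hξ using hne
  set d' : Tup O (q + 2) →₀ (X →₀ ℤ) := lin (fun w => (sg w).comp (sg (ξ w))) d with hd'
  have h3 : d' ∈ wc (JC r Y X0 T) (q + 2) := by
    refine inn_ind (lin (fun w => (sg w).comp (sg (ξ w)))) _ (fun w n hn => ?_) hd
    rw [lin_single]
    refine single_inn ?_
    by_cases hcl : Cl r Y (ent w)
    · exact ⟨gate_pos hcl, single_Zz (hξ w hcl) n⟩
    · rw [hn hcl, map_zero]; exact zero_mem _
  have h4 : cf aug d' = d := by
    refine hom_ext_apply ((cf aug).comp (lin (fun w => (sg w).comp (sg (ξ w))))) (AddMonoidHom.id _)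
      (fun w n => ?_) d
    simp [cf_single]
  refine ⟨b - wd d', fun w => ?_, ?_⟩
  · have h5 := sub_mem hb (wd_wc (JC_anti r Y X0 T) h3) w
    refine ⟨h5.1, h5.2, ?_⟩
    show aug ((b - wd d') w) = 0
    rw [← cf_apply, map_sub, wmap_wd, h4, e', sub_self]; rfl
  · rw [map_sub, e, wd_wd, sub_zero]
end

end P7

section P8
open Tup
set_option linter.unusedVariables false
/-! ### submodules, graded pieces, the engine -/
section sub
/-- sub-representation -/
abbrev subM (A : GM) (N : AddSubgroup A.M) (h : ∀ g, ∀ n ∈ N, A.ρ g n ∈ N) : GM where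
  G := A.G
  M := N
  ρ g := ((A.ρ g).comp N.subtype).codRestrict N fun n => h g n n.2
  ρ_one m := Subtype.ext (A.ρ_one _)
  ρ_mul g g' m := Subtype.ext (A.ρ_mul _ _ _)

theorem subM_rho {A : GM} {N : AddSubgroup A.M} {h : ∀ g, ∀ n ∈ N, A.ρ g n ∈ N} (g : A.G) (m : N) :
    (((subM A N h).ρ g m : N) : A.M) = A.ρ g m := rfl

theorem labM_apply {A : GM} {X : Type} (a : GAct A.G X) (g : A.G) (c : X →₀ A.M) (x : X) :
    (labM a).ρ g c x = A.ρ g (c (a.act g⁻¹ x)) := by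
  classical
  refine hom_ext_apply ((Finsupp.applyAddHom x).comp ((labM a).ρ g))
    ((A.ρ g).comp (Finsupp.applyAddHom (a.act g⁻¹ x))) (fun y m => ?_) c
  simp only [AddMonoidHom.comp_apply, lin_single, sg_apply, Finsupp.applyAddHom_apply,
    Finsupp.single_apply]
  by_cases h : a.act g y = x
  · rw [if_pos h, if_pos (by rw [← h, a.inv_act])]
  · rw [if_neg h, if_neg (fun h' => h (by rw [h', a.act_inv])), map_zero]

variable {A : GM} {X : Type} (a : GAct A.G X) (J : X → AddSubgroup A.M)
  (hJ : ∀ g, ∀ n ∈ inn J, (labM a).ρ g n ∈ inn J)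

noncomputable def innGrad : Grad (subM (labM a) (inn J) hJ) X where
  a := a
  γ := AddMonoidHom.mk' (fun m => Finsupp.onFinset m.1.support
      (fun x => (⟨Finsupp.single x (m.1 x), single_inn (m.2 x)⟩ : inn J))
      (fun x h => by
        rw [Finsupp.mem_support_iff]
        intro h'
        exact h (Subtype.ext (by simp [h'])))) (fun m m' => by
      ext x : 1
      refine Subtype.ext ?_
      show Finsupp.single x _ = Finsupp.single x _ + Finsupp.single x _
      rw [← Finsupp.single_add]; rfl)
  equi g m := by
    ext x : 1
    refine Eq.trans ?_ (labM_apply (A := subM (labM a) (inn J) hJ) a g _ x).symm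
    refine Subtype.ext ?_
    show Finsupp.single x ((labM a).ρ g m.1 x) = (labM a).ρ g (Finsupp.single (a.act g⁻¹ x) (m.1 (a.act g⁻¹ x)))
    rw [labM_apply]
    simp [a.act_inv]
  sum m := by
    refine Subtype.ext ?_
    have h0 : ∀ c : X →₀ inn J, ((((sumM (A := subM (labM a) (inn J) hJ) a).φ c : inn J)) : X →₀ A.M) =
        c.sum fun _ n => (n : X →₀ A.M) := by
      intro c
      have : ((((sumM (A := subM (labM a) (inn J) hJ) a).φ c : inn J)) : X →₀ A.M) =
        (inn J).subtype (c.sum fun _ n => n) := by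
          congr 1
      rw [this, Finsupp.sum, map_sum]; rfl
    rw [h0]
    have hm : ∀ (f : X → inn J) (hf : ∀ x, f x ≠ 0 → x ∈ m.1.support), (Finsupp.onFinset m.1.support f hf).sum
        (fun _ n => (n : X →₀ A.M)) = ∑ x ∈ m.1.support, (f x : X →₀ A.M) := fun f hf =>
      Finsupp.sum_of_support_subset _ Finsupp.support_onFinset_subset _ (fun _ _ => rfl)
    refine (hm (fun x => (⟨Finsupp.single x (m.1 x), single_inn (m.2 x)⟩ : inn J)) (fun x h => by
        rw [Finsupp.mem_support_iff]
        intro h'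
        exact h (Subtype.ext (by simp [h'])))).trans ?_
    exact Finsupp.sum_single (m.1 : X →₀ A.M)

theorem F2inn {R : Type} (B : R → GM) (F : ∀ r, GHom (B r) (subM (labM a) (inn J) hJ)) (pt : R → X)
    (hf : ∀ r, Function.Injective (F r).f) (hφ : ∀ r, Function.Injective (F r).φ)
    (hst : ∀ r g, a.act g (pt r) = pt r → ∃ b, (F r).f b = g)
    (hsub : ∀ r, ∀ n ∈ J (pt r), ∃ b, ((F r).φ b).1 = Finsupp.single (pt r) n)
    (horb : ∀ x, J x = ⊥ ∨ ∃ r g, a.act g (pt r) = x) (i : ℕ)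
    (K : AddSubgroup (H (subM (labM a) (inn J) hJ) i))
    (hK : ∀ r y, Hm (F r) i y ∈ K) (y : H (subM (labM a) (inn J) hJ) i) : y ∈ K := by
  let B0 : GM := ⟨A.G, PUnit, fun _ => AddMonoidHom.id _, fun _ => rfl, fun _ _ _ => rfl⟩
  let F0 : GHom B0 (subM (labM a) (inn J) hJ) := ⟨MonoidHom.id _, 0, fun g m => (map_zero ((subM (labM a) (inn J) hJ).ρ g)).symm⟩
  refine F2 (innGrad a J hJ) (R := R ⊕ {x // J x = ⊥}) (Sum.elim B fun _ => B0)
    (fun r => match r with | .inl r => F r | .inr _ => F0) (Sum.elim pt fun x => x.1)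
    ?_ ?_ ?_ ?_ ?_ i K ?_ y
  · rintro (r | r)
    · exact hf r
    · exact fun _ _ h => h
  · rintro (r | r)
    · exact hφ r
    · exact fun _ _ _ => Subsingleton.elim (α := PUnit) _ _
  · rintro (r | r)
    · exact hst r
    · exact fun g _ => ⟨g, rfl⟩
  · rintro (r | r) m
    · obtain ⟨b, hb⟩ := hsub r (m.1 (pt r)) (m.2 _)
      exact ⟨b, Subtype.ext hb⟩
    · refine ⟨PUnit.unit, Subtype.ext ?_⟩
      show (0 : X →₀ A.M) = Finsupp.single r.1 (m.1 r.1)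
      have : m.1 r.1 ∈ J r.1 := m.2 _
      rw [r.2, AddSubgroup.mem_bot] at this
      rw [this, Finsupp.single_zero]
  · intro x
    rcases horb x with h | ⟨r, g, h⟩
    · exact ⟨.inr ⟨x, h⟩, 1, a.one x⟩
    · exact ⟨.inl r, g, h⟩
  · rintro (r | r) y
    · exact hK r y
    · have : ∀ y : H B0 i, Hm F0 i y = 0 := by
        intro y
        obtain ⟨z, hz, rfl⟩ := cls_surj y
        rw [Hm_cls, cls_eq_zero]
        refine ⟨0, ?_⟩
        rw [map_zero]
        refine (hom_ext_apply (mapC F0) 0 (fun x m => ?_) z).symm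
        simp [F0]
      show Hm F0 i y ∈ K
      rw [this y]; exact zero_mem _
end sub

section engine
variable {G O X : Type} [Group G] (aO : GAct (trivM G).G O) (aX : GAct (trivM G).G X)

theorem aug_rho (g : G) (n : X →₀ ℤ) : aug ((labM (A := trivM G) aX).ρ g n) = aug n := by
  refine hom_ext_apply (aug.comp ((labM (A := trivM G) aX).ρ g)) aug (fun x n => ?_) n
  simp only [AddMonoidHom.comp_apply, lin_single, sg_apply, aug_single]
  rfl

theorem Zz_rho {Z Z' : Set X} (g : G) (h : ∀ x ∈ Z, aX.act g x ∈ Z') (n : X →₀ ℤ) (hn : n ∈ Zz Z) :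
    (labM (A := trivM G) aX).ρ g n ∈ Zz Z' := by
  refine inn_ind ((labM (A := trivM G) aX).ρ g) (Zz Z') (fun x n hn => ?_) hn
  rw [lin_single]
  refine single_inn ?_
  by_cases hx : x ∈ Z
  · exact gate_pos (h x hx)
  · rw [hn hx, map_zero]; exact zero_mem _

theorem Rz_rho {Z Z' : Set X} (g : G) (h : ∀ x ∈ Z, aX.act g x ∈ Z') (n : X →₀ ℤ) (hn : n ∈ Rz Z) :
    (labM (A := trivM G) aX).ρ g n ∈ Rz Z' := ⟨Zz_rho aX g h n hn.1, by
      show aug _ = 0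
      rw [aug_rho]; exact hn.2⟩

variable (r : O → O → Prop) (Y : Set O) (X0 : Set X) (T : O → X → Prop)
/-- invariance hypotheses -/
structure Inv : Prop where
  hr : ∀ g o o', r o o' → r (aO.act g o) (aO.act g o')
  hY : ∀ g, ∀ o ∈ Y, aO.act g o ∈ Y
  hX : ∀ g, ∀ x ∈ X0, aX.act g x ∈ X0
  hT : ∀ g o x, T o x → T (aO.act g o) (aX.act g x)

variable {aO aX r Y X0 T}

theorem ent_tmap {O' : Type} (f : O → O') {q : ℕ} (w : Tup O q) : ent (tmap f w) = f '' ent w := by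
  induction w with
  | tn => simp [tmap, ent]
  | tc y w ih => simp [tmap, ent, ih, Set.image_insert_eq]

theorem JR_rho (I : Inv aO aX r Y X0 T) (q : ℕ) (g : G) (n : Tup O q →₀ (X →₀ ℤ)) (hn : n ∈ wc (JR r Y X0 T) q) :
    (labM (A := labM (A := trivM G) aX) (tupAct aO q)).ρ g n ∈ wc (JR r Y X0 T) q := by
  refine inn_ind ((labM (A := labM (A := trivM G) aX) (tupAct aO q)).ρ g) (wc (JR r Y X0 T) q)
    (fun w n hn => ?_) hn
  rw [lin_single]
  refine single_inn (J := fun w => JR r Y X0 T (ent w)) ?_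
  show _ ∈ JR r Y X0 T (ent (tmap _ w))
  rw [ent_tmap]
  by_cases hc : Cl r Y (ent w)
  · refine ⟨gate_pos (show Cl r Y _ from ⟨?_, ?_⟩), ?_⟩
    · rintro _ ⟨o, ho, rfl⟩; exact I.hY g o (hc.1 ho)
    · rintro _ ⟨o, ho, rfl⟩ _ ⟨o', ho', rfl⟩; exact I.hr g _ _ (hc.2 o ho o' ho')
    · refine Rz_rho aX g (Z' := Xs X0 T _) (fun x hx => (show _ ∧ _ from ⟨I.hX g x hx.1, ?_⟩)) n hn.2
      rintro _ ⟨o, ho, rfl⟩; exact I.hT g o x (hx.2 o ho)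
  · rw [hn.1 hc, map_zero]; exact zero_mem _

/-- the module `R` -/
noncomputable abbrev Rm (aX : GAct (trivM G).G X) (X0 : Set X) (hX : ∀ g, ∀ x ∈ X0, aX.act g x ∈ X0) : GM :=
  subM (labM (A := trivM G) aX) (Rz X0) (fun g n hn => Rz_rho aX g (hX g) n hn)

/-- the resolving complex -/
noncomputable abbrev Rc (I : Inv aO aX r Y X0 T) (q : ℕ) : GM :=
  subM (labM (A := labM (A := trivM G) aX) (tupAct aO q)) (wc (JR r Y X0 T) q) (JR_rho I q)

noncomputable def Rd (I : Inv aO aX r Y X0 T) (q : ℕ) : GHom (Rc I (q + 1)) (Rc I q) where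
  f := MonoidHom.id _
  φ := (wd.comp (wc (JR r Y X0 T) (q + 1)).subtype).codRestrict (wc (JR r Y X0 T) q)
    fun n => wd_wc (JR_anti r Y X0 T) n.2
  h g m := Subtype.ext ((labD (A := labM (A := trivM G) aX) aO q).h g m.1)

/-- stabilizer data of a word -/
structure Stb (I : Inv aO aX r Y X0 T) {q : ℕ} (w : Tup O q) (B : GM) (F : GHom B (Rm aX X0 I.hX)) : Prop where
  hf : Function.Injective F.f
  hφ : Function.Injective F.φ
  st : ∀ g, (tupAct aO q).act g w = w ↔ ∃ b, F.f b = g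
  mem : ∀ n, n ∈ Rz (Xs X0 T (ent w)) ↔ ∃ b, (F.φ b).1 = n

noncomputable def Stb.hom {I : Inv aO aX r Y X0 T} {q : ℕ} {w : Tup O q} {B : GM}
    {F : GHom B (Rm aX X0 I.hX)} (S : Stb I w B F) (hc : Cl r Y (ent w)) : GHom B (Rc I q) where
  f := F.f
  φ := (((sg w).comp (Rz X0).subtype).comp F.φ).codRestrict (wc (JR r Y X0 T) q)
    fun n => single_inn (J := fun w => JR r Y X0 T (ent w)) ⟨gate_pos hc, (S.mem _).2 ⟨n, rfl⟩⟩
  h g m := by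
    refine Subtype.ext ?_
    show Finsupp.single w (F.φ (B.ρ g m)).1 = (labM (A := labM (A := trivM G) aX) (tupAct aO q)).ρ (F.f g)
      (Finsupp.single w (F.φ m).1)
    rw [lin_single, F.h]
    simp only [AddMonoidHom.comp_apply, sg_apply]
    rw [(S.st (F.f g)).2 ⟨g, rfl⟩]
    rfl

theorem Rc_ind (I : Inv aO aX r Y X0 T) (q i : ℕ) (K : AddSubgroup (H (Rc I q) i))
    (h : ∀ w : Tup O q, ∀ hc : Cl r Y (ent w), ∃ B F, ∃ S : Stb I w B F, ∀ y, Hm (S.hom hc) i y ∈ K)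
    (y : H (Rc I q) i) : y ∈ K := by
  choose B F S hS using h
  refine F2inn (A := labM (A := trivM G) aX) (tupAct aO q) (fun w => JR r Y X0 T (ent w)) (JR_rho I q)
    (R := {w : Tup O q // Cl r Y (ent w)}) (fun w => B w.1 w.2) (fun w => (S w.1 w.2).hom w.2)
    (fun w => w.1) (fun w => (S w.1 w.2).hf) (fun w b b' h => ?_)
    (fun w g h => ((S w.1 w.2).st g).1 h) (fun w n hn => ?_) (fun w => ?_) i K (fun w y => hS w.1 w.2 y) y
  · have h' : Finsupp.single w.1 ((F w.1 w.2).φ b).1 = Finsupp.single w.1 ((F w.1 w.2).φ b').1 :=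
      congrArg Subtype.val h
    exact (S w.1 w.2).hφ (Subtype.ext (Finsupp.single_injective _ h'))
  · obtain ⟨b, hb⟩ := ((S w.1 w.2).mem n).1 hn.2
    refine ⟨b, ?_⟩
    show Finsupp.single w.1 ((F w.1 w.2).φ b).1 = _
    rw [hb]
  · by_cases hc : Cl r Y (ent w)
    · exact Or.inr ⟨⟨w, hc⟩, 1, (tupAct aO q).one w⟩
    · left
      rw [eq_bot_iff]
      intro n hn
      exact hn.1 hc

/-- **the engine** -/
theorem engine (I : Inv aO aX r Y X0 T) (i : ℕ) (hex : ∀ q, q ≤ i → Ex (JR r Y X0 T) q)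
    (hv : ∀ q j, q + j + 1 = i → ∀ w : Tup O (q + 2), Cl r Y (ent w) →
      ∃ B F, Stb I w B F ∧ Van B j)
    (K : AddSubgroup (H (Rm aX X0 I.hX) i))
    (hK : ∀ o ∈ Y, r o o → ∃ B F, Stb I (tc o tn) B F ∧ ∀ y, Hm F i y ∈ K)
    (y : H (Rm aX X0 I.hX) i) : y ∈ K := by
  have hs : Function.Surjective (Hm (Rd I 0) i) := by
    refine RL (Rc I) (Rd I) (fun _ => Function.bijective_id) (fun p m => Subtype.ext (wd_wd m.1)) i
      (fun c => ?_) (fun q hq m hm => ?_) (fun q j hq y => ?_)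
    · obtain ⟨b, hb, e⟩ := hex 0 (Nat.zero_le _) c.1 c.2 trivial
      exact ⟨⟨b, hb⟩, Subtype.ext e⟩
    · obtain ⟨b, hb, e⟩ := hex (q + 1) hq m.1 m.2 (congrArg Subtype.val hm)
      exact ⟨⟨b, hb⟩, Subtype.ext e⟩
    · have := Rc_ind I (q + 2) j ⊥ (fun w hc => by
        obtain ⟨B, F, S, hV⟩ := hv q j hq w hc
        exact ⟨B, F, S, fun y => by rw [hV y, map_zero]; exact zero_mem _⟩) y
      exact this
  -- the identification of the bottom term
  let E : GHom (Rc I 0) (Rm aX X0 I.hX) :=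
    ⟨MonoidHom.id _, ((Finsupp.applyAddHom tn).comp (wc (JR r Y X0 T) 0).subtype).codRestrict (Rz X0)
      (fun n => ⟨Zz_mono (fun x hx => hx.1) (n.2 tn).2.1, (n.2 tn).2.2⟩), fun g m => Subtype.ext (by
        show (labM (A := labM (A := trivM G) aX) (tupAct aO 0)).ρ g m.1 tn = (labM (A := trivM G) aX).ρ g (m.1 tn)
        exact labM_apply _ _ _ _)⟩
  let E' : GHom (Rm aX X0 I.hX) (Rc I 0) :=
    ⟨MonoidHom.id _, ((sg tn).comp (Rz X0).subtype).codRestrict (wc (JR r Y X0 T) 0)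
      (fun n => single_inn (J := fun w => JR r Y X0 T (ent w)) ⟨gate_pos (by simp [Cl, ent]),
        Zz_mono (fun x hx => show _ ∧ _ from ⟨hx, by simp [ent]⟩) n.2.1, n.2.2⟩), fun g m => Subtype.ext (by
        show Finsupp.single tn _ = (labM (A := labM (A := trivM G) aX) (tupAct aO 0)).ρ g (Finsupp.single tn m.1)
        rw [lin_single]; rfl)⟩
  have hEE : E.comp E' = GHom.id _ := GHom.ext' (fun _ => rfl) (fun m => Subtype.ext (by
    show Finsupp.single tn m.1 tn = m.1
    simp))
  obtain ⟨y1, hy1⟩ := hs (Hm E' i y)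
  have h2 : y = Hm (E.comp (Rd I 0)) i y1 := by
    rw [Hm_comp, hy1, ← Hm_comp, hEE, Hm_id]
  rw [h2]
  refine Rc_ind I 1 i (K.comap (Hm (E.comp (Rd I 0)) i)) (fun w hc => ?_) y1
  obtain ⟨o, w, rfl⟩ := tup_succ w
  obtain rfl := tup_zero w
  have ho : o ∈ ent (tc o (tn : Tup O 0)) := by simp [ent]
  obtain ⟨B, F, S, h⟩ := hK o (hc.1 ho) (hc.2 o ho o ho)
  refine ⟨B, F, S, fun y => ?_⟩
  show Hm _ _ _ ∈ K
  rw [← Hm_comp]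
  convert h y using 3
  refine GHom.ext' (fun _ => rfl) (fun m => Subtype.ext ?_)
  show wd (Finsupp.single (tc o tn) (F.φ m).1) tn = (F.φ m).1
  simp [wd, w0]
end engine

end P8

section P9
open Tup
/-! ### geometry -/
/-- an even symmetric bilinear form -/
structure Geo (K E : Type) [Field K] [AddCommGroup E] [Module K E] where
  b : E →ₗ[K] E →ₗ[K] K
  symm : ∀ x y, b x y = b y x
  even : ∀ x, ∃ c, b x x = 2 * c

section
variable {K E : Type} [Field K] [AddCommGroup E] [Module K E] (Q : Geo K E)

def Geo.perp (S : Set E) : Submodule K E where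
  carrier := {m | ∀ s ∈ S, Q.b s m = 0}
  zero_mem' := fun s _ => map_zero _
  add_mem' := fun h h' s hs => by rw [map_add, h s hs, h' s hs, add_zero]
  smul_mem' := fun c m h s hs => by rw [map_smul, h s hs, smul_zero]

theorem Geo.mem_perp {S : Set E} {m : E} : m ∈ Q.perp S ↔ ∀ s ∈ S, Q.b s m = 0 := Iff.rfl
theorem Geo.mem_perp' {S : Set E} {m : E} : m ∈ Q.perp S ↔ ∀ s ∈ S, Q.b m s = 0 :=
  forall₂_congr fun s _ => by rw [Q.symm]
theorem Geo.perp_insert {S : Set E} {u m : E} : m ∈ Q.perp (insert u S) ↔ Q.b u m = 0 ∧ m ∈ Q.perp S := by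
  simp [Geo.mem_perp]
theorem Geo.perp_union {S S' : Set E} {m : E} : m ∈ Q.perp (S ∪ S') ↔ m ∈ Q.perp S ∧ m ∈ Q.perp S' := by
  simp only [Geo.mem_perp, Set.mem_union]
  exact ⟨fun h => ⟨fun s hs => h s (Or.inl hs), fun s hs => h s (Or.inr hs)⟩,
    fun h s hs => hs.elim (h.1 s) (h.2 s)⟩
theorem Geo.perp_anti {S S' : Set E} (h : S ⊆ S') : Q.perp S' ≤ Q.perp S := fun _ hm s hs => hm s (h hs)

def Geo.W0 (S : Set E) : Set (E × E) :=
  {x | x.1 ∈ Q.perp S ∧ x.2 ∈ Q.perp S ∧ Q.b x.1 x.1 = 0 ∧ Q.b x.2 x.2 = 0 ∧ Q.b x.1 x.2 = 1}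

theorem Geo.W0_anti {S S' : Set E} (h : S ⊆ S') : Q.W0 S' ⊆ Q.W0 S :=
  fun _ hx => ⟨Q.perp_anti h hx.1, Q.perp_anti h hx.2.1, hx.2.2⟩

theorem Geo.complete {S : Set E} {e m : E} (he : e ∈ Q.perp S) (h0 : Q.b e e = 0) (hm : m ∈ Q.perp S)
    (h : Q.b e m ≠ 0) : ∃ a c : K, (e, a • m - c • e) ∈ Q.W0 S := by
  obtain ⟨c, hc⟩ := Q.even ((Q.b e m)⁻¹ • m)
  refine ⟨(Q.b e m)⁻¹, c, he, sub_mem (Submodule.smul_mem _ _ hm) (Submodule.smul_mem _ _ he), h0, ?_, ?_⟩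
  · simp only [map_sub, LinearMap.sub_apply, hc, map_smul, LinearMap.smul_apply, smul_eq_mul, h0, Q.symm m e] at *
    field_simp at *
    linear_combination hc
  · simp only [map_sub, map_smul, smul_eq_mul, h0]
    field_simp; simp

/-- Witt index at least `g` -/
def Geo.Wi (S : Set E) (g : ℕ) : Prop := ∃ F : Submodule K E, F ≤ Q.perp S ∧
  (∀ x ∈ F, ∀ y ∈ F, Q.b x y = 0) ∧ g ≤ Module.finrank K F ∧ ∀ e ∈ F, (∀ m ∈ Q.perp S, Q.b e m = 0) → e = 0

theorem Geo.Wi_congr {S S' : Set E} {g : ℕ} (h : ∀ m, m ∈ Q.perp S ↔ m ∈ Q.perp S') (hw : Q.Wi S g) : Q.Wi S' g := by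
  have : Q.perp S = Q.perp S' := Submodule.ext h
  unfold Geo.Wi at *
  rwa [← this]

theorem Geo.Wi_mono {S : Set E} {g g' : ℕ} (h : g' ≤ g) (hw : Q.Wi S g) : Q.Wi S g' := by
  obtain ⟨F, h1, h2, h3, h4⟩ := hw
  exact ⟨F, h1, h2, h.trans h3, h4⟩

theorem Geo.w1 {S : Set E} (hw : Q.Wi S 1) : (Q.W0 S).Nonempty := by
  obtain ⟨F, h1, h2, h3, h4⟩ := hw
  have : F ≠ ⊥ := by
    rintro rfl
    simp at h3
  obtain ⟨e, he, h0⟩ := Submodule.exists_mem_ne_zero_of_ne_bot this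
  have : ∃ m ∈ Q.perp S, Q.b e m ≠ 0 := by
    by_contra! h
    exact h0 (h4 e he h)
  obtain ⟨m, hm, h⟩ := this
  obtain ⟨a, c, hx⟩ := Q.complete (h1 he) (h2 e he e he) hm h
  exact ⟨_, hx⟩

theorem prop_of_ker {M : Submodule K E} {α β : E →ₗ[K] K} (h : ∀ m ∈ M, β m = 0 → α m = 0) :
    ∃ l : K, ∀ m ∈ M, α m = l * β m := by
  by_cases h0 : ∀ m ∈ M, β m = 0
  · exact ⟨0, fun m hm => by rw [h m hm (h0 m hm), zero_mul]⟩
  · push Not at h0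
    obtain ⟨m0, hm0, h1⟩ := h0
    refine ⟨α m0 / β m0, fun m hm => ?_⟩
    have := h (m - (β m / β m0) • m0) (sub_mem hm (Submodule.smul_mem _ _ hm0)) (by
      simp only [map_sub, map_smul, smul_eq_mul]; field_simp; simp)
    simp only [map_sub, map_smul, smul_eq_mul] at this
    field_simp at this ⊢
    linear_combination this

theorem drop_ker [FiniteDimensional K E] {F : Submodule K E} (φ : E →ₗ[K] K) {g : ℕ} (h : g + 1 ≤ Module.finrank K F) :
    g ≤ Module.finrank K (F ⊓ LinearMap.ker φ : Submodule K E) := by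
  have h1 := LinearMap.finrank_range_add_finrank_ker (φ.domRestrict F)
  have h2 : Module.finrank K (LinearMap.range (φ.domRestrict F)) ≤ 1 :=
    (Submodule.finrank_le _).trans (by simp)
  have h3 : Module.finrank K (LinearMap.ker (φ.domRestrict F)) = Module.finrank K (F ⊓ LinearMap.ker φ : Submodule K E) := by
    have h4 : (LinearMap.ker (φ.domRestrict F)).map F.subtype = F ⊓ LinearMap.ker φ := by
      ext x
      simp only [Submodule.mem_map, LinearMap.mem_ker, Submodule.mem_inf]
      constructor
      · rintro ⟨y, hy, rfl⟩; exact ⟨y.2, hy⟩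
      · rintro ⟨hx, hy⟩; exact ⟨⟨x, hx⟩, hy, rfl⟩
    rw [← h4]
    exact (Submodule.finrank_map_subtype_eq F _).symm
  omega

variable [FiniteDimensional K E]

theorem Geo.w2 {S : Set E} {g : ℕ} (u : E) (hw : Q.Wi S (g + 1)) : Q.Wi (insert u S) g := by
  obtain ⟨F, h1, h2, h3, h4⟩ := hw
  by_cases hA : ∃ e0 ∈ F, e0 ≠ 0 ∧ ∀ m ∈ Q.perp (insert u S), Q.b e0 m = 0
  · obtain ⟨e0, he0, hne, h5⟩ := hA
    obtain ⟨l, hl⟩ := prop_of_ker (M := Q.perp S) (α := Q.b e0) (β := Q.b u)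
      (fun m hm hu => h5 m (Q.perp_insert.2 ⟨hu, hm⟩))
    have hl0 : l ≠ 0 := fun h0 => hne (h4 e0 he0 fun m hm => by rw [hl m hm, h0, zero_mul])
    have hiff : ∀ m ∈ Q.perp S, Q.b e0 m = 0 → Q.b u m = 0 := fun m hm h => by
      rw [hl m hm] at h
      exact (mul_eq_zero.1 h).resolve_left hl0
    obtain ⟨φ, hφ⟩ : ∃ φ : Module.Dual K E, φ e0 ≠ 0 := by
      by_contra! h
      exact hne ((Module.forall_dual_apply_eq_zero_iff K e0).1 h)
    refine ⟨F ⊓ LinearMap.ker φ, fun x hx => Q.perp_insert.2 ⟨hiff x (h1 hx.1) (h2 e0 he0 x hx.1), h1 hx.1⟩,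
      fun x hx y hy => h2 x hx.1 y hy.1, drop_ker φ h3, fun e he h => ?_⟩
    obtain ⟨μ, hμ⟩ := prop_of_ker (M := Q.perp S) (α := Q.b e) (β := Q.b e0)
      (fun m hm h0 => h m (Q.perp_insert.2 ⟨hiff m hm h0, hm⟩))
    have h6 := h4 (e - μ • e0) (sub_mem he.1 (Submodule.smul_mem _ _ he0)) (fun m hm => by
      simp [hμ m hm])
    have h7 : e = μ • e0 := sub_eq_zero.1 h6
    have h8 : φ e = 0 := he.2
    rw [h7, map_smul, smul_eq_mul] at h8
    rw [h7, (mul_eq_zero.1 h8).resolve_right hφ, zero_smul]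
  · refine ⟨F ⊓ LinearMap.ker (Q.b u), fun x hx => Q.perp_insert.2 ⟨hx.2, h1 hx.1⟩,
      fun x hx y hy => h2 x hx.1 y hy.1, drop_ker _ h3, fun e he h => ?_⟩
    by_contra h0
    exact hA ⟨e, he.1, h0, h⟩

theorem Geo.w6 {S : Set E} {g : ℕ} {v f : E} (hv : v ∈ Q.perp S) (hr : ∀ m ∈ Q.perp S, Q.b v m = 0)
    (hf : Q.b v f = 1) (hw : Q.Wi S g) : Q.Wi (insert f S) g := by
  obtain ⟨F, h1, h2, h3, h4⟩ := hw
  let π : E →ₗ[K] E := LinearMap.id - (Q.b f).smulRight v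
  have hπ : ∀ x, π x = x - Q.b f x • v := fun x => rfl
  have hb : ∀ x ∈ Q.perp S, ∀ y ∈ Q.perp S, Q.b (π x) (π y) = Q.b x y := fun x hx y hy => by
    simp [hπ, hr x hx, hr y hy, hr v hv, Q.symm x v]
  have hp : ∀ x ∈ Q.perp S, π x ∈ Q.perp (insert f S) := fun x hx => Q.perp_insert.2 ⟨by
    simp [hπ, Q.symm f v, hf], sub_mem hx (Submodule.smul_mem _ _ hv)⟩
  have hinj : ∀ e ∈ F, (∀ m ∈ Q.perp S, Q.b (π e) (π m) = 0) → e = 0 := fun e he h =>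
    h4 e he fun m hm => by rw [← hb e (h1 he) m hm, h m hm]
  refine ⟨F.map π, ?_, ?_, ?_, ?_⟩
  · rintro _ ⟨x, hx, rfl⟩; exact hp x (h1 hx)
  · rintro _ ⟨x, hx, rfl⟩ _ ⟨y, hy, rfl⟩
    rw [hb x (h1 hx) y (h1 hy), h2 x hx y hy]
  · have : Module.finrank K (F.map π) = Module.finrank K F := by
      rw [← LinearMap.range_domRestrict]
      refine LinearMap.finrank_range_of_inj ?_
      rw [← LinearMap.ker_eq_bot, LinearMap.ker_eq_bot']
      intro m hm
      refine Subtype.ext (hinj m.1 m.2 fun m' _ => ?_)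
      have : π m.1 = 0 := hm
      rw [this]; simp
    omega
  · rintro _ ⟨e, he, rfl⟩ h
    rw [hinj e he fun m hm => h _ (hp m hm), map_zero]

theorem Geo.pair_drop {S : Set E} {g : ℕ} {e f : E} (he : e ∈ Q.perp S) (h0 : Q.b e e = 0) (hef : Q.b e f ≠ 0)
    (hw : Q.Wi S (g + 1)) : Q.Wi (insert f (insert e S)) g := by
  have h := Q.w6 (v := e) (f := (Q.b e f)⁻¹ • f) (Q.perp_insert.2 ⟨h0, he⟩) (fun m hm => (Q.perp_insert.1 hm).1)
    (by simp [hef]) (Q.w2 e hw)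
  refine Q.Wi_congr (fun m => ?_) h
  simp [Q.perp_insert, hef]

/-- support of a pair -/
def ps (x : E × E) : Set E := {x.1, x.2}
/-- support of a set of labels -/
def US {O : Type} (pt : O → Set E) (σ : Set O) : Set E := {v | ∃ x ∈ σ, v ∈ pt x}

theorem US_insert {O : Type} (pt : O → Set E) (x : O) (σ : Set O) : US pt (insert x σ) = pt x ∪ US pt σ := by
  ext v
  simp [US]
theorem US_empty {O : Type} (pt : O → Set E) : US pt ∅ = ∅ := by
  ext v; simp [US]

/-- orthogonality of a label to a pair -/
def Geo.Tr {O : Type} (pt : O → Set E) (o : O) (x : E × E) : Prop := ∀ s ∈ pt o, Q.b s x.1 = 0 ∧ Q.b s x.2 = 0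

theorem Geo.Xs_eq {O : Type} (pt : O → Set E) (S : Set E) (σ : Set O) :
    Xs (Q.W0 S) (Q.Tr pt) σ = Q.W0 (S ∪ US pt σ) := by
  ext x
  simp only [Xs, Geo.W0, Set.mem_setOf_eq, Q.perp_union, Geo.Tr, Geo.mem_perp, US]
  constructor
  · rintro ⟨⟨h1, h2, h3⟩, h4⟩
    exact ⟨⟨h1, fun s ⟨o, ho, hs⟩ => (h4 o ho s hs).1⟩, ⟨h2, fun s ⟨o, ho, hs⟩ => (h4 o ho s hs).2⟩, h3⟩
  · rintro ⟨⟨h1, h1'⟩, ⟨h2, h2'⟩, h3⟩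
    exact ⟨⟨h1, h2, h3⟩, fun o ho s hs => ⟨h1' s ⟨o, ho, hs⟩, h2' s ⟨o, ho, hs⟩⟩⟩

theorem Geo.Tr_symm {x y : E × E} (h : Q.Tr ps x y) : Q.Tr ps y x := by
  simp only [Geo.Tr, ps, Set.mem_insert_iff, Set.mem_singleton_iff, forall_eq_or_imp, forall_eq] at *
  obtain ⟨⟨h1, h2⟩, h3, h4⟩ := h
  exact ⟨⟨by rw [Q.symm, h1], by rw [Q.symm, h3]⟩, by rw [Q.symm, h2], by rw [Q.symm, h4]⟩

/-- relation on pairs -/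
def Geo.rP (x y : E × E) : Prop := x = y ∨ Q.Tr ps x y
theorem Geo.rP_refl (x : E × E) : Q.rP x x := Or.inl rfl
theorem Geo.rP_symm (x y : E × E) (h : Q.rP x y) : Q.rP y x := h.elim (fun h => Or.inl h.symm) (fun h => Or.inr (Q.Tr_symm h))

theorem Geo.pairs_drop {S : Set E} (σ : Finset (E × E)) : ∀ {g : ℕ}, ↑σ ⊆ Q.W0 S → (∀ x ∈ σ, ∀ z ∈ σ, Q.rP x z) →
    Q.Wi S (g + σ.card) → Q.Wi (S ∪ US ps (↑σ : Set (E × E))) g := by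
  classical
  induction σ using Finset.induction_on with
  | empty => intro g _ _ h; simpa [US_empty] using h
  | insert x σ hx ih =>
    intro g hσ hc h
    rw [Finset.card_insert_of_notMem hx] at h
    have h1 := ih (g := g + 1) (fun y hy => hσ (by simp at hy ⊢; exact Or.inr hy))
      (fun y hy z hz => hc y (by simp [hy]) z (by simp [hz])) (by convert h using 1; omega)
    obtain ⟨x1, x2, x3, x4, x5⟩ := hσ (show x ∈ _ by simp)
    refine Q.Wi_congr (fun m => ?_) (Q.pair_drop (e := x.1) (f := x.2) ?_ x3 (by rw [x5]; exact one_ne_zero) h1)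
    · rw [Finset.coe_insert, US_insert, Q.perp_insert, Q.perp_insert, Q.perp_union, Q.perp_union, Q.perp_union]
      simp only [ps, Q.perp_insert, Q.mem_perp, Set.mem_insert_iff, Set.mem_singleton_iff, forall_eq_or_imp, forall_eq]
      tauto
    · refine Q.perp_union.2 ⟨x1, ?_⟩
      rintro s ⟨y, hy, hs⟩
      rcases hc y (by simp at hy; simp [hy]) x (by simp) with rfl | h'
      · exact absurd hy hx
      · exact (h' s hs).1

theorem ent_finset {O : Type} {q : ℕ} (w : Tup O q) : ∃ σ : Finset O, (σ : Set O) = ent w ∧ σ.card ≤ q := by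
  classical
  induction w with
  | tn => exact ⟨∅, by simp [ent], le_refl _⟩
  | tc y w ih =>
    obtain ⟨σ, h1, h2⟩ := ih
    exact ⟨insert y σ, by simp [ent, h1], (Finset.card_insert_le _ _).trans (by omega)⟩

theorem Geo.pair_word {S : Set E} {q g : ℕ} (w : Tup (E × E) q) (hc : Cl Q.rP (Q.W0 S) (ent w)) (h : Q.Wi S (g + q)) :
    Q.Wi (S ∪ US ps (ent w)) g := by
  obtain ⟨σ, h1, h2⟩ := ent_finset w
  rw [← h1] at hc ⊢
  exact Q.pairs_drop σ hc.1 hc.2 (Q.Wi_mono (by omega) h)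

theorem Geo.W_link {S S' : Set E} (hSS : S ⊆ S') (σ : Set (E × E)) (hσ : σ ⊆ Q.W0 S \ Q.W0 S') :
    Q.W0 S' ∩ Lk Q.rP σ = Q.W0 (S' ∪ US ps σ) := by
  rw [← Q.Xs_eq]
  ext x
  constructor
  · rintro ⟨h1, h2⟩
    refine ⟨h1, fun o ho => ?_⟩
    rcases h2 o ho with rfl | h
    · exact absurd h1 (hσ ho).2
    · exact Q.Tr_symm h
  · rintro ⟨h1, h2⟩
    exact ⟨h1, fun o ho => Or.inr (Q.Tr_symm (h2 o ho))⟩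

theorem Geo.W_acyclic (q : ℕ) : ∀ S : Set E, Q.Wi S (2 * q + 1) → Ex (JA Q.rP (Q.W0 S)) q := by
  induction q using Nat.strong_induction_on with | _ q ih => ?_
  intro S hw c hc hz
  obtain ⟨⟨e, f⟩, hef⟩ := Q.w1 (Q.Wi_mono (by omega) hw)
  have hef' := hef
  obtain ⟨x1, x2, x3, x4, x5⟩ := hef'
  simp only at x1 x2 x3 x4 x5
  obtain ⟨c1, hc1, hz1, b1, hb1, e1⟩ := bad_clique (r := Q.rP) Q.rP_refl Q.rP_symm
    (Q.W0_anti (Set.subset_insert e S)) q (fun σ hσ hne hcl q' hq' => by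
      rw [Q.W_link (Set.subset_insert e S) σ hσ]
      have hs := hne.card_pos
      refine ih q' (by omega) _ ?_
      have h1 := Q.pairs_drop (g := 2 * q' + 2) σ (fun x hx => (hσ hx).1) hcl (Q.Wi_mono (by omega) hw)
      rw [Set.insert_union]
      exact Q.w2 e h1) q le_rfl c hc hz
  obtain ⟨c2, hc2, hz2, b2, hb2, e2⟩ := bad_clique (r := Q.rP) Q.rP_refl Q.rP_symm
    (Q.W0_anti (Set.subset_insert f (insert e S))) q (fun σ hσ hne hcl q' hq' => by
      rw [Q.W_link (Set.subset_insert _ _) σ hσ]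
      have hs := hne.card_pos
      refine ih q' (by omega) _ ?_
      have h1 := Q.pairs_drop (g := 2 * q' + 2) (S := S) σ
        (fun x hx => Q.W0_anti (Set.subset_insert e S) (hσ hx).1) hcl (Q.Wi_mono (by omega) hw)
      rw [Set.insert_union, Set.insert_union]
      refine Q.pair_drop (Q.perp_union.2 ⟨x1, ?_⟩) x3 (by rw [x5]; exact one_ne_zero) h1
      rintro s ⟨y, hy, rfl | rfl⟩
      · have := (Q.perp_insert.1 (hσ hy).1.1).1
        rwa [Q.symm]
      · have := (Q.perp_insert.1 (hσ hy).1.2.1).1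
        rwa [Q.symm]) q le_rfl c1 hc1 hz1
  have h3 := cone_wc (r := Q.rP) (Y := Q.W0 S) Q.rP_refl Q.rP_symm hef
    (Q.W0_anti ((Set.subset_insert e S).trans (Set.subset_insert f (insert e S)))) (fun z hz => Or.inr (by
      intro s hs
      rcases hs with rfl | rfl
      · exact ⟨(Q.perp_insert.1 (Q.perp_insert.1 hz.1).2).1, (Q.perp_insert.1 (Q.perp_insert.1 hz.2.1).2).1⟩
      · exact ⟨(Q.perp_insert.1 hz.1).1, (Q.perp_insert.1 hz.2.1).1⟩)) hc2
  refine ⟨b1 + (b2 + consL (e, f) c2), add_mem hb1 (add_mem (wc_mono (JA_mono (Q.W0_anti (Set.subset_insert e S))) hb2) h3), ?_⟩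
  rw [map_add, map_add, ← e1, ← e2, wd_cone _ hz2]
  abel
end

end P9

section P10
open Tup
/-! ### the complex of isotropic vectors -/
section
variable {K E : Type} [Field K] [AddCommGroup E] [Module K E] (Q : Geo K E)

def Geo.Yv (S : Set E) : Set E := {v | v ∈ Q.perp S ∧ Q.b v v = 0 ∧ ∃ m ∈ Q.perp S, Q.b v m ≠ 0}
def Geo.rV (u v : E) : Prop := u = v ∨ Q.b u v ≠ 0
theorem Geo.rV_refl (x : E) : Q.rV x x := Or.inl rfl
theorem Geo.rV_symm (x y : E) (h : Q.rV x y) : Q.rV y x :=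
  h.elim (fun h => Or.inl h.symm) (fun h => Or.inr (by rwa [Q.symm]))

theorem Geo.Yv_W0 {S : Set E} {x : E × E} (hx : x ∈ Q.W0 S) : x.1 ∈ Q.Yv S :=
  ⟨hx.1, hx.2.2.1, x.2, hx.2.1, by rw [hx.2.2.2.2]; exact one_ne_zero⟩

theorem Geo.Yv_link {S : Set E} {x : E × E} (hx : x ∈ Q.W0 S) :
    Q.Yv S ∩ {o | Q.Tr (fun v => {v}) o x} = Q.Yv (S ∪ ps x) := by
  obtain ⟨x1, x2, x3, x4, x5⟩ := hx
  have x6 : Q.b x.2 x.1 = 1 := by rw [Q.symm, x5]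
  ext v
  constructor
  · rintro ⟨⟨h1, h2, m, h3, h4⟩, h5⟩
    obtain ⟨h5, h6⟩ := h5 v rfl
    refine ⟨Q.perp_union.2 ⟨h1, ?_⟩, h2, m - Q.b x.2 m • x.1 - Q.b x.1 m • x.2, Q.perp_union.2 ⟨?_, ?_⟩, ?_⟩
    · rintro s (rfl | rfl)
      · rw [Q.symm, h5]
      · rw [Q.symm, h6]
    · exact sub_mem (sub_mem h3 (Submodule.smul_mem _ _ x1)) (Submodule.smul_mem _ _ x2)
    · rintro s (rfl | rfl) <;> simp [x3, x4, x5, x6]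
    · simpa [h5, h6] using h4
  · rintro ⟨h1, h2, m, h3, h4⟩
    obtain ⟨h1, h1'⟩ := Q.perp_union.1 h1
    refine ⟨⟨h1, h2, m, (Q.perp_union.1 h3).1, h4⟩, ?_⟩
    rintro s rfl
    exact ⟨by rw [Q.symm]; exact h1' _ (Or.inl rfl), by rw [Q.symm]; exact h1' _ (Or.inr rfl)⟩

theorem generic_t [Infinite K] {α β : E →ₗ[K] K} (V : Finset E) (h : ∀ v ∈ V, α v ≠ 0) :
    ∃ t : K, t ≠ 0 ∧ ∀ v ∈ V, α v + t * β v ≠ 0 := by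
  classical
  obtain ⟨t, ht⟩ := Infinite.exists_notMem_finset (insert 0 (V.image fun v => - α v / β v))
  simp only [Finset.mem_insert, Finset.mem_image, not_or, not_exists, not_and] at ht
  refine ⟨t, ht.1, fun v hv h0 => ?_⟩
  by_cases hb : β v = 0
  · rw [hb, mul_zero, add_zero] at h0; exact h v hv h0
  · refine ht.2 v hv ?_
    field_simp
    linear_combination -h0

theorem Geo.gen_step [Infinite K] {S : Set E} {u v : E} {V : Finset E} (hu : u ∈ Q.perp S) (hu0 : Q.b u u = 0)
    (hV : ∀ v ∈ V, Q.b u v ≠ 0) (hv : v ∈ Q.Yv S) (huv : Q.b u v = 0)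
    (hm : ∃ m ∈ Q.perp S, Q.b u m = 0 ∧ Q.b v m ≠ 0) :
    ∃ u' ∈ Q.Yv S, Q.b u' v ≠ 0 ∧ ∀ v ∈ V, Q.b u' v ≠ 0 := by
  obtain ⟨m, hm, h1, h2⟩ := hm
  obtain ⟨a, c, hx⟩ := Q.complete hv.1 hv.2.1 hm h2
  set p := a • m - c • v with hp
  obtain ⟨x1, x2, x3, x4, x5⟩ := hx
  simp only at x1 x2 x3 x4 x5
  have h3 : Q.b u p = 0 := by simp [hp, h1, huv]
  obtain ⟨t, ht, hV'⟩ := generic_t (α := Q.b u) (β := Q.b p) V hV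
  have h4 : Q.b (u + t • p) v ≠ 0 := by
    simp [huv, Q.symm p v, x5, ht]
  refine ⟨u + t • p, ⟨add_mem hu (Submodule.smul_mem _ _ x2), ?_, v, hv.1, h4⟩, h4, fun v hv => ?_⟩
  · simp [hu0, h3, x4, Q.symm p u]
  · simpa using hV' v hv

variable [FiniteDimensional K E]

theorem Geo.generic [Infinite K] {S : Set E} (hw : Q.Wi S 2) (V : Finset E) : (∀ v ∈ V, v ∈ Q.Yv S) →
    ∃ u ∈ Q.Yv S, ∀ v ∈ V, Q.b u v ≠ 0 := by
  classical
  induction V using Finset.induction_on with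
  | empty =>
    intro _
    obtain ⟨x, hx⟩ := Q.w1 (Q.Wi_mono (by omega) hw)
    exact ⟨x.1, Q.Yv_W0 hx, by simp⟩
  | insert v V hvV ih =>
    intro hV
    obtain ⟨u, hu, h1⟩ := ih (fun v hv => hV v (by simp [hv]))
    have hv : v ∈ Q.Yv S := hV v (by simp)
    suffices h : ∃ u' ∈ Q.Yv S, Q.b u' v ≠ 0 ∧ ∀ v ∈ V, Q.b u' v ≠ 0 by
      obtain ⟨u', h2, h3, h4⟩ := h
      exact ⟨u', h2, by simpa using ⟨h3, h4⟩⟩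
    by_cases huv : Q.b u v = 0
    swap
    · exact ⟨u, hu, huv, h1⟩
    by_cases hm : ∃ m ∈ Q.perp S, Q.b u m = 0 ∧ Q.b v m ≠ 0
    · exact Q.gen_step hu.1 hu.2.1 h1 hv huv hm
    push Not at hm
    obtain ⟨l, hl⟩ := prop_of_ker (M := Q.perp S) (α := Q.b v) (β := Q.b u) hm
    obtain ⟨⟨p, p'⟩, hp⟩ := Q.w1 (Q.w2 (g := 1) u hw)
    obtain ⟨x1, x2, x3, x4, x5⟩ := hp
    simp only [Q.perp_insert] at x1 x2 x3 x4 x5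
    obtain ⟨t, ht, hV'⟩ := generic_t (α := Q.b u) (β := Q.b p) V h1
    obtain ⟨m0, hm0, h0⟩ := hv.2.2
    refine Q.gen_step (u := u + t • p) (add_mem hu.1 (Submodule.smul_mem _ _ x1.2)) ?_ ?_ hv ?_
      ⟨m0 - (Q.b (u + t • p) m0 / t) • p', sub_mem hm0 (Submodule.smul_mem _ _ x2.2), ?_, ?_⟩
    · simp [hu.2.1, x1.1, x3, Q.symm p u]
    · intro v hv; simpa using hV' v hv
    · simp [huv, Q.symm p v, hl p x1.2, x1.1]
    · simp only [map_sub, map_smul, smul_eq_mul, map_add, LinearMap.add_apply, LinearMap.smul_apply, x2.1, x5]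
      field_simp
      ring
    · simpa [hl p' x2.2, x2.1] using h0

theorem Geo.V_acyclic [Infinite K] {S : Set E} (hw : Q.Wi S 2) (q : ℕ) : Ex (JA Q.rV (Q.Yv S)) q := by
  classical
  intro c hc hz
  have hfin : (⋃ w ∈ c.support, ent w).Finite := c.support.finite_toSet.biUnion fun w _ => ent_finite w
  obtain ⟨u, hu, h⟩ := Q.generic hw (hfin.toFinset.filter (· ∈ Q.Yv S)) (fun v hv => (Finset.mem_filter.1 hv).2)
  refine ⟨consL u c, ?_, wd_cone u hz⟩
  refine cone_wc (L := {v | v ∈ Q.Yv S ∧ v ∈ hfin.toFinset}) Q.rV_refl Q.rV_symm hu (fun v hv => hv.1)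
    (fun v hv => Or.inr (h v (by simp only [Finset.mem_filter]; exact ⟨hv.2, hv.1⟩))) (fun w => ?_)
  by_cases hw : c w = 0
  · rw [hw]; exact zero_mem _
  · refine gate_pos ?_
    have hcl : Cl Q.rV (Q.Yv S) (ent w) := by
      by_contra h'
      exact hw (hc w h')
    refine ⟨fun v hv => ⟨hcl.1 hv, ?_⟩, hcl.2⟩
    rw [Set.Finite.mem_toFinset]
    exact Set.mem_biUnion (Finsupp.mem_support_iff.2 hw) hv

theorem Geo.vec_word {S : Set E} {q g : ℕ} (w : Tup E q) (h : Q.Wi S (g + q)) : Q.Wi (S ∪ US (fun v => {v}) (ent w)) g := by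
  induction w generalizing g with
  | tn => simpa [ent, US_empty] using h
  | tc y w ih =>
    rw [ent, US_insert, Set.union_left_comm]
    exact Q.w2 y (ih (g := g + 1) (by convert h using 1; omega))

theorem Geo.vec_word2 {S : Set E} {q g : ℕ} (w : Tup E (q + 2)) (hc : Cl Q.rV (Q.Yv S) (ent w)) (h : Q.Wi S (g + q + 1)) :
    Q.Wi (S ∪ US (fun v => {v}) (ent w)) g := by
  obtain ⟨v1, w, rfl⟩ := tup_succ w
  obtain ⟨v2, w, rfl⟩ := tup_succ w
  by_cases h12 : v1 = v2
  · subst h12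
    have : ent (tc v1 (tc v1 w)) = ent (tc v1 w) := by simp [ent]
    rw [this]
    exact Q.vec_word _ h
  · have hne : Q.b v1 v2 ≠ 0 := (hc.2 v1 (by simp [ent]) v2 (by simp [ent])).resolve_left h12
    have hv1 := hc.1 (show v1 ∈ _ by simp [ent])
    have h1 := Q.vec_word w (Q.pair_drop hv1.1 hv1.2.1 hne h)
    convert h1 using 1
    simp only [ent, US_insert]
    ext x
    simp
    tauto
end

end P10

section P11
open Tup
/-! ### permutation modules and their augmentation sequences -/
section perm
variable {G X : Type} [Group G] (aX : GAct (trivM G).G X) (X0 : Set X)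
  (hX : ∀ g, ∀ x ∈ X0, aX.act g x ∈ X0)

noncomputable abbrev Zm : GM := subM (labM (A := trivM G) aX) (Zz X0) (fun g n hn => Zz_rho aX g (hX g) n hn)

noncomputable def RZ : GHom (Rm aX X0 hX) (Zm aX X0 hX) where
  f := MonoidHom.id _
  φ := (Rz X0).subtype.codRestrict (Zz X0) fun n => n.2.1
  h g m := rfl

noncomputable def Zt : GHom (Zm aX X0 hX) (trivM G) where
  f := MonoidHom.id _
  φ := aug.comp (Zz X0).subtype
  h g m := aug_rho aX g m.1

theorem RZ_inj : Function.Injective (RZ aX X0 hX).φ := fun m m' h =>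
  Subtype.ext (show m.1 = m'.1 from congrArg (fun t : (Zm aX X0 hX).M => t.1) h)
theorem Zt_surj (hne : X0.Nonempty) : Function.Surjective (Zt aX X0 hX).φ := fun n => by
  obtain ⟨x, hx⟩ := hne
  exact ⟨⟨Finsupp.single x n, single_Zz hx n⟩, aug_single x n⟩
theorem RZ_exact (m) (h : (Zt aX X0 hX).φ m = 0) : ∃ k, (RZ aX X0 hX).φ k = m :=
  ⟨⟨m.1, m.2, h⟩, rfl⟩
theorem RZ_zero (k) : (Zt aX X0 hX).φ ((RZ aX X0 hX).φ k) = 0 := k.2.2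

/-- the hom given by a stabilizer -/
noncomputable def Zp {G' : Type} [Group G'] (j : G' →* G) (x : X) (hx : x ∈ X0) (hj : ∀ g, aX.act (j g) x = x) :
    GHom (trivM G') (Zm aX X0 hX) where
  f := j
  φ := (sg x).codRestrict (Zz X0) fun n => single_Zz hx n
  h g n := Subtype.ext (by
    show Finsupp.single x n = (labM (A := trivM G) aX).ρ (j g) (Finsupp.single x n)
    rw [lin_single]
    show _ = Finsupp.single (aX.act (j g) x) n
    rw [hj])

theorem Zm_ind {R : Type} (G' : R → Type) [∀ r, Group (G' r)] (j : ∀ r, G' r →* G) (pt : R → X)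
    (hpt : ∀ r, pt r ∈ X0) (hinj : ∀ r, Function.Injective (j r)) (hj : ∀ r g, aX.act (j r g) (pt r) = pt r)
    (hst : ∀ r g, aX.act g (pt r) = pt r → ∃ b, j r b = g) (horb : ∀ x ∈ X0, ∃ r g, aX.act g (pt r) = x)
    (i : ℕ) (L : AddSubgroup (H (Zm aX X0 hX) i)) (hL : ∀ r y, Hm (Zp aX X0 hX (j r) (pt r) (hpt r) (hj r)) i y ∈ L)
    (y : H (Zm aX X0 hX) i) : y ∈ L := by
  refine F2inn (A := trivM G) aX (fun x => gate ℤ (x ∈ X0)) (fun g n hn => Zz_rho aX g (hX g) n hn)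
    (fun r => trivM (G' r)) (fun r => Zp aX X0 hX (j r) (pt r) (hpt r) (hj r)) pt hinj (fun r n n' h => ?_) hst
    (fun r n hn => ⟨n, rfl⟩) (fun x => ?_) i L hL y
  · have h' : Finsupp.single (pt r) n = Finsupp.single (pt r) n' := congrArg Subtype.val h
    exact Finsupp.single_injective _ h'
  · by_cases hx : x ∈ X0
    · exact Or.inr (horb x hx)
    · exact Or.inl ((AddSubgroup.eq_bot_iff_forall _).2 fun n hn => hn hx)

/-- homology with trivial coefficients is generated by stabilizers -/
theorem triv_ind {R : Type} (G' : R → Type) [∀ r, Group (G' r)] (j : ∀ r, G' r →* G) (pt : R → X)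
    (hpt : ∀ r, pt r ∈ X0) (hinj : ∀ r, Function.Injective (j r)) (hj : ∀ r g, aX.act (j r g) (pt r) = pt r)
    (hst : ∀ r g, aX.act g (pt r) = pt r → ∃ b, j r b = g) (horb : ∀ x ∈ X0, ∃ r g, aX.act g (pt r) = x)
    (i : ℕ) (hne : X0.Nonempty) (hv : ∀ q, q + 1 = i → Van (Rm aX X0 hX) q)
    (L : AddSubgroup (H (trivM G) i)) (hL : ∀ r y, Hm (trivH (j r)) i y ∈ L)
    (y : H (trivM G) i) : y ∈ L := by
  have hs : Function.Surjective (Hm (Zt aX X0 hX) i) := by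
    cases i with
    | succ q =>
      exact ses_surj (RZ aX X0 hX) (Zt aX X0 hX) Function.bijective_id Function.bijective_id
        (RZ_inj aX X0 hX) (RZ_zero aX X0 hX) (RZ_exact aX X0 hX) (Zt_surj aX X0 hX hne) (hv q rfl)
    | zero =>
      intro y
      obtain ⟨z, hz, rfl⟩ := cls_surj y
      obtain ⟨c, rfl⟩ := mapC_surj (Zt aX X0 hX) Function.bijective_id.2 (Zt_surj aX X0 hX hne) z
      exact ⟨cls ⟨c, trivial⟩, rfl⟩
  obtain ⟨y, rfl⟩ := hs y
  refine Zm_ind aX X0 hX G' j pt hpt hinj hj hst horb i (L.comap (Hm (Zt aX X0 hX) i)) (fun r y => ?_) y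
  show Hm _ _ _ ∈ L
  rw [← Hm_comp]
  convert hL r y using 3
  exact GHom.ext' (fun _ => rfl) (fun n => aug_single (pt r) n)
end perm

section hadd
theorem Hm_add {A B : GM} (F F' F'' : GHom A B) (h1 : F.f = F''.f) (h2 : F'.f = F''.f)
    (h : ∀ m, F.φ m + F'.φ m = F''.φ m) {i : ℕ} (y : H A i) : Hm F i y + Hm F' i y = Hm F'' i y := by
  obtain ⟨z, hz, rfl⟩ := cls_surj y
  rw [Hm_cls, Hm_cls, Hm_cls]
  have : mapC F'' z = mapC F z + mapC F' z := by
    refine hom_ext_apply (mapC F'') (mapC F + mapC F') (fun g m => ?_) z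
    rw [AddMonoidHom.add_apply, mapC_single, mapC_single, mapC_single, h1, h2, ← Finsupp.single_add, h]
  refine Eq.trans ?_ (congrArg cls (Subtype.ext this.symm : (⟨_, add_mem (mapC_cyc F hz) (mapC_cyc F' hz)⟩ : cyc B i) = ⟨_, mapC_cyc F'' hz⟩))
  rfl
end hadd

/-! ### the groups -/
section grp
variable {K E : Type} [Field K] [AddCommGroup E] [Module K E] (Q : Geo K E)

def Geo.GS (S : Set E) : Subgroup (E ≃ₗ[K] E) where
  carrier := {g | (∀ x y, Q.b (g x) (g y) = Q.b x y) ∧ LinearEquiv.det g = 1 ∧ ∀ s ∈ S, g s = s}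
  one_mem' := ⟨fun _ _ => rfl, map_one _, fun _ _ => rfl⟩
  mul_mem' := fun {g h} hg hh => ⟨fun x y => by rw [LinearEquiv.mul_apply, LinearEquiv.mul_apply, hg.1, hh.1],
    by rw [map_mul, hg.2.1, hh.2.1, one_mul], fun s hs => by rw [LinearEquiv.mul_apply, hh.2.2 s hs, hg.2.2 s hs]⟩
  inv_mem' := fun {g} hg => by
    have hi : ∀ x, g (g⁻¹ x) = x := fun x => g.apply_symm_apply x
    refine ⟨fun x y => ?_, by rw [map_inv, hg.2.1, inv_one], fun s hs => ?_⟩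
    · rw [← hg.1, hi, hi]
    · apply g.injective
      rw [hi, hg.2.2 s hs]

theorem Geo.GS_anti {S S' : Set E} (h : S ⊆ S') : Q.GS S' ≤ Q.GS S := fun g hg => ⟨hg.1, hg.2.1, fun s hs => hg.2.2 s (h hs)⟩

theorem Geo.GS_perp {S : Set E} {g : E ≃ₗ[K] E} (hg : g ∈ Q.GS S) {m : E} (hm : m ∈ Q.perp S) : g m ∈ Q.perp S := fun s hs => by
  rw [← hg.2.2 s hs, hg.1, hm s hs]

/-- action on pairs -/
def pr (g : E ≃ₗ[K] E) (x : E × E) : E × E := (g x.1, g x.2)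
theorem pr_mul (g h : E ≃ₗ[K] E) (x : E × E) : pr (g * h) x = pr g (pr h x) := rfl

def aPk {Γ : Type} [Group Γ] (κ : Γ →* (E ≃ₗ[K] E)) : GAct Γ (E × E) where
  act γ := pr (κ γ)
  one x := by rw [map_one]; rfl
  mul γ γ' x := by rw [map_mul]; rfl
def aVk {Γ : Type} [Group Γ] (κ : Γ →* (E ≃ₗ[K] E)) : GAct Γ E where
  act γ x := κ γ x
  one x := by rw [map_one]; rfl
  mul γ γ' x := by rw [map_mul]; rfl

theorem Geo.GS_W0 {S : Set E} {g : E ≃ₗ[K] E} (hg : g ∈ Q.GS S) {x : E × E} (hx : x ∈ Q.W0 S) : pr g x ∈ Q.W0 S := by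
  obtain ⟨x1, x2, x3, x4, x5⟩ := hx
  refine ⟨Q.GS_perp hg x1, Q.GS_perp hg x2, ?_, ?_, ?_⟩ <;> simp only [pr, hg.1, *]

theorem Geo.hXg (S : Set E) : ∀ g : Q.GS S, ∀ x ∈ Q.W0 S, (aPk (Q.GS S).subtype).act g x ∈ Q.W0 S :=
  fun g x hx => Q.GS_W0 g.2 hx

/-- the main modules -/
noncomputable abbrev Geo.Rg (S : Set E) : GM := Rm (G := Q.GS S) (aPk (Q.GS S).subtype) (Q.W0 S) (Q.hXg S)
noncomputable abbrev Geo.Zg (S : Set E) : GM := Zm (G := Q.GS S) (aPk (Q.GS S).subtype) (Q.W0 S) (Q.hXg S)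

theorem Rz_mono {X : Type} {Z Z' : Set X} (h : Z ⊆ Z') : Rz Z ≤ Rz Z' := fun _ hn => ⟨Zz_mono h hn.1, hn.2⟩

noncomputable def Geo.Rinc {S S' : Set E} (h : S ⊆ S') : GHom (Q.Rg S') (Q.Rg S) where
  f := Subgroup.inclusion (Q.GS_anti h)
  φ := (Rz (Q.W0 S')).subtype.codRestrict (Rz (Q.W0 S)) fun n => Rz_mono (Q.W0_anti h) n.2
  h g m := rfl

theorem tmap_fix {O : Type} (f : O → O) {q : ℕ} (w : Tup O q) : tmap f w = w ↔ ∀ o ∈ ent w, f o = o := by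
  induction w with
  | tn => simp [tmap, ent]
  | tc y w ih => simp [tmap, ent, ih]

theorem Geo.stb [FiniteDimensional K E] {O : Type} (S : Set E) (pt : O → Set E) (aO : GAct (trivM (Q.GS S)).G O) (r : O → O → Prop) (Y : Set O)
    (I : Inv (G := Q.GS S) aO (aPk (Q.GS S).subtype) r Y (Q.W0 S) (Q.Tr pt))
    (hfix : ∀ (g : Q.GS S) o, aO.act g o = o ↔ ∀ s ∈ pt o, g.1 s = s) {q : ℕ} (w : Tup O q) :
    Stb I w (Q.Rg (S ∪ US pt (ent w))) (Q.Rinc Set.subset_union_left) where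
  hf := Subgroup.inclusion_injective (Q.GS_anti Set.subset_union_left)
  hφ := fun n n' h => Subtype.ext (show n.1 = n'.1 from congrArg (fun t : (Q.Rg S).M => t.1) h)
  st g := by
    show tmap (aO.act g) w = w ↔ _
    rw [tmap_fix]
    constructor
    · intro h
      refine ⟨⟨g.1, g.2.1, g.2.2.1, ?_⟩, rfl⟩
      rintro s (hs | ⟨o, ho, hs⟩)
      · exact g.2.2.2 s hs
      · exact (hfix g o).1 (h o ho) s hs
    · rintro ⟨g', rfl⟩ o ho
      exact (hfix _ o).2 fun s hs => g'.2.2.2 s (Or.inr ⟨o, ho, hs⟩)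
  mem n := by
    rw [Q.Xs_eq]
    exact ⟨fun h => ⟨⟨n, h⟩, rfl⟩, by rintro ⟨m, rfl⟩; exact m.2⟩

/-! ### theta classes -/
def Geo.Fx (S S' : Set E) : Set (E × E) := {x | x ∈ Q.W0 S ∧ ∀ g ∈ Q.GS S', pr g x = x}

theorem th_mem {X : Type} {Z : Set X} {x x' : X} (hx : x ∈ Z) (hx' : x' ∈ Z) (n : ℤ) : (sg x - sg x' : ℤ →+ (X →₀ ℤ)) n ∈ Rz Z :=
  ⟨(Zz Z).sub_mem (single_Zz hx n) (single_Zz hx' n), by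
      show aug (Finsupp.single x n - Finsupp.single x' n) = 0
      rw [map_sub, aug_single, aug_single, sub_self]⟩

theorem psi_mem {X : Type} {Z Z' : Set X} (h : Z ⊆ Z') {x : X} (hx : x ∈ Z') (n : Zz Z) :
    ((Zz Z).subtype - ((sg x).comp (aug.comp (Zz Z).subtype)) : Zz Z →+ (X →₀ ℤ)) n ∈ Rz Z' :=
  ⟨(Zz Z').sub_mem (Zz_mono h n.2) (single_Zz hx _), by
      show aug (n.1 - Finsupp.single x (aug n.1)) = 0
      rw [map_sub, aug_single, sub_self]⟩

noncomputable def Geo.th {S S' : Set E} (h : S ⊆ S') (x x' : Q.Fx S S') : GHom (trivM (Q.GS S')) (Q.Rg S) where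
  f := Subgroup.inclusion (Q.GS_anti h)
  φ := (sg x.1 - sg x'.1 : ℤ →+ (E × E →₀ ℤ)).codRestrict (Rz (Q.W0 S)) (th_mem x.2.1 x'.2.1)
  h g n := Subtype.ext (by
    show Finsupp.single x.1 n - Finsupp.single x'.1 n = (labM (A := trivM (Q.GS S)) (aPk (Q.GS S).subtype)).ρ
      (Subgroup.inclusion (Q.GS_anti h) g) (Finsupp.single x.1 n - Finsupp.single x'.1 n)
    rw [map_sub, lin_single, lin_single]
    show _ = Finsupp.single (pr g.1 x.1) n - Finsupp.single (pr g.1 x'.1) n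
    rw [x.2.2 g.1 g.2, x'.2.2 g.1 g.2])

theorem Geo.th_add {S S' : Set E} (h : S ⊆ S') (x x' x'' : Q.Fx S S') {i : ℕ} (y : H (trivM (Q.GS S')) i) :
    Hm (Q.th h x x') i y + Hm (Q.th h x' x'') i y = Hm (Q.th h x x'') i y :=
  Hm_add (Q.th h x x') (Q.th h x' x'') (Q.th h x x'') rfl rfl (fun n => Subtype.ext (by
    show (Finsupp.single x.1 n - Finsupp.single x'.1 n) + (Finsupp.single x'.1 n - Finsupp.single x''.1 n) =
      Finsupp.single x.1 n - Finsupp.single x''.1 n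
    abel)) y

theorem Geo.th_conj {S S' : Set E} (h : S ⊆ S') (x x' : Q.Fx S S') {g : E ≃ₗ[K] E} (hg : g ∈ Q.GS S)
    (hc : ∀ k ∈ Q.GS S', g * k = k * g) (z z' : Q.Fx S S') (hz : z.1 = pr g x.1) (hz' : z'.1 = pr g x'.1) {i : ℕ}
    (y : H (trivM (Q.GS S')) i) : Hm (Q.th h z z') i y = Hm (Q.th h x x') i y := by
  rw [← Hm_conj (A := Q.Rg S) ⟨g, hg⟩ (Hm (Q.th h x x') i y), ← Hm_comp]
  congr 2
  refine GHom.ext' (fun k => ?_) (fun n => Subtype.ext ?_)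
  · refine Subtype.ext ?_
    show k.1 = g * k.1 * g⁻¹
    rw [hc k.1 k.2, mul_inv_cancel_right]
  · show Finsupp.single z.1 n - Finsupp.single z'.1 n = (labM (A := trivM (Q.GS S)) (aPk (Q.GS S).subtype)).ρ
      ⟨g, hg⟩ (Finsupp.single x.1 n - Finsupp.single x'.1 n)
    rw [map_sub, lin_single, lin_single, hz, hz']
    rfl

theorem Geo.Fx_anti {S S' S'' : Set E} (h : S' ⊆ S'') : Q.Fx S S' ⊆ Q.Fx S S'' :=
  fun x hx => ⟨hx.1, fun g hg => hx.2 g (Q.GS_anti h hg)⟩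

theorem Geo.th_nat {S S' S'' : Set E} (h : S ⊆ S') (h' : S' ⊆ S'') (x x' : Q.Fx S S') {i : ℕ} (y : H (trivM (Q.GS S'')) i) :
    Hm (Q.th h x x') i (Hm (trivH (Subgroup.inclusion (Q.GS_anti h'))) i y) =
    Hm (Q.th (h.trans h') ⟨x.1, Q.Fx_anti h' x.2⟩ ⟨x'.1, Q.Fx_anti h' x'.2⟩) i y := by
  rw [← Hm_comp]
  rfl

theorem Geo.Fx_ps {S S' : Set E} {x : E × E} (hx : x ∈ Q.W0 S) (h : ps x ⊆ S') : x ∈ Q.Fx S S' :=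
  ⟨hx, fun g hg => Prod.ext (hg.2.2 _ (h (Or.inl rfl))) (hg.2.2 _ (h (Or.inr rfl)))⟩

/-- reduction of the KILL lemma to theta classes -/
theorem Geo.kill_red {S : Set E} {x1 : E × E} (hx1 : x1 ∈ Q.W0 S) (i : ℕ)
    (hth : ∀ (x0 : E × E) (hx0 : x0 ∈ Q.W0 (S ∪ ps x1)) (y : H (trivM (Q.GS (S ∪ ps x1 ∪ ps x0))) i),
      Hm (Q.th (S := S) (S' := S ∪ ps x1 ∪ ps x0) (Set.subset_union_left.trans Set.subset_union_left)
        ⟨x0, Q.Fx_ps (Q.W0_anti Set.subset_union_left hx0) Set.subset_union_right⟩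
        ⟨x1, Q.Fx_ps hx1 (Set.subset_union_right.trans Set.subset_union_left)⟩) i y = 0)
    (y : H (Q.Rg (S ∪ ps x1)) i) : Hm (Q.Rinc Set.subset_union_left) i y = 0 := by
  have hsub : S ⊆ S ∪ ps x1 := Set.subset_union_left
  let ψ : GHom (Q.Zg (S ∪ ps x1)) (Q.Rg S) :=
    { f := Subgroup.inclusion (Q.GS_anti hsub)
      φ := ((Zz (Q.W0 (S ∪ ps x1))).subtype - ((sg x1).comp (aug.comp (Zz (Q.W0 (S ∪ ps x1))).subtype))).codRestrict
        (Rz (Q.W0 S)) (psi_mem (Q.W0_anti hsub) hx1)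
      h := fun g n => Subtype.ext (by
        show (labM (A := trivM (Q.GS (S ∪ ps x1))) (aPk (Q.GS (S ∪ ps x1)).subtype)).ρ g n.1 - Finsupp.single x1 (aug
          ((labM (A := trivM (Q.GS (S ∪ ps x1))) (aPk (Q.GS (S ∪ ps x1)).subtype)).ρ g n.1)) =
          (labM (A := trivM (Q.GS S)) (aPk (Q.GS S).subtype)).ρ (Subgroup.inclusion (Q.GS_anti hsub) g)
            (n.1 - Finsupp.single x1 (aug n.1))
        rw [map_sub, lin_single]
        congr 1
        show _ = Finsupp.single (pr g.1 x1) (aug n.1)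
        rw [(Q.Fx_ps hx1 (S' := S ∪ ps x1) Set.subset_union_right).2 g.1 g.2]
        congr 1
        exact aug_rho (G := Q.GS (S ∪ ps x1)) (aPk (Q.GS (S ∪ ps x1)).subtype) g n.1) }
  have h1 : Q.Rinc hsub = ψ.comp (RZ _ _ (Q.hXg _)) := GHom.ext' (fun _ => rfl) (fun n => Subtype.ext (by
    show n.1 = n.1 - Finsupp.single x1 (aug n.1)
    have : aug n.1 = 0 := n.2.2
    rw [this, Finsupp.single_zero, sub_zero]))
  rw [h1, Hm_comp]
  have h2 : ∀ y : H (Q.Zg (S ∪ ps x1)) i, y ∈ (Hm ψ i).ker := by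
    refine Zm_ind (G := Q.GS (S ∪ ps x1)) (aPk (Q.GS (S ∪ ps x1)).subtype) (Q.W0 (S ∪ ps x1)) (Q.hXg _)
      (R := {x // x ∈ Q.W0 (S ∪ ps x1)})
      (fun x => Q.GS (S ∪ ps x1 ∪ ps x.1)) (fun x => Subgroup.inclusion (Q.GS_anti Set.subset_union_left))
      (fun x => x.1) (fun x => x.2) (fun x => Subgroup.inclusion_injective _)
      (fun x g => (Q.Fx_ps x.2 (S' := S ∪ ps x1 ∪ ps x.1) Set.subset_union_right).2 g.1 g.2)
      (fun x g hg => ⟨⟨g.1, g.2.1, g.2.2.1, ?_⟩, rfl⟩) (fun x hx => ⟨⟨x, hx⟩, 1, rfl⟩) i _ (fun x y => ?_)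
    · rintro s (hs | rfl | rfl)
      · exact g.2.2.2 s hs
      · exact congrArg Prod.fst hg
      · exact congrArg Prod.snd hg
    · show Hm ψ i _ = 0
      rw [← hth x.1 x.2 y, ← Hm_comp]
      congr 2
      refine GHom.ext' (fun _ => rfl) (fun n => Subtype.ext ?_)
      show Finsupp.single x.1 n - Finsupp.single x1 (aug (Finsupp.single x.1 n)) = Finsupp.single x.1 n - Finsupp.single x1 n
      rw [aug_single]
  exact h2 _
end grp

end P11

section P12
open Tup
/-! ### special elements -/
section elts
variable {K E : Type} [Field K] [AddCommGroup E] [Module K E] (Q : Geo K E)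

def Geo.rl (u w : E) (β γ : K) : E →ₗ[K] E :=
  LinearMap.id + β • (Q.b w).smulRight u + γ • (Q.b u).smulRight w

theorem Geo.rl_apply (u w : E) (β γ : K) (z : E) : Q.rl u w β γ z = z + (β * Q.b w z) • u + (γ * Q.b u z) • w := by
  simp [Geo.rl, mul_smul]

theorem Geo.rl_comp {u w : E} {β γ : K} (hu : Q.b u u = 0) (hw : Q.b w w = 0) (hd : β + γ + β * γ * Q.b u w = 0) :
    (Q.rl u w β γ).comp (Q.rl u w γ β) = LinearMap.id := by
  ext z
  simp only [LinearMap.comp_apply, Geo.rl_apply, map_add, map_smul, hu, hw, Q.symm w u, smul_eq_mul, LinearMap.id_apply]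
  have h1 : β * Q.b w z + γ * Q.b w z * (1 + β * Q.b u w) = 0 := by linear_combination Q.b w z * hd
  have h2 : γ * Q.b u z + β * Q.b u z * (1 + γ * Q.b u w) = 0 := by linear_combination Q.b u z * hd
  have h3 : z = z + (β * Q.b w z + γ * Q.b w z * (1 + β * Q.b u w)) • u + (γ * Q.b u z + β * Q.b u z * (1 + γ * Q.b u w)) • w := by
    rw [h1, h2]; simp
  conv_rhs => rw [h3]
  module

def Geo.rk {u w : E} {β γ : K} (hu : Q.b u u = 0) (hw : Q.b w w = 0) (hd : β + γ + β * γ * Q.b u w = 0) : E ≃ₗ[K] E :=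
  LinearEquiv.ofLinear (Q.rl u w β γ) (Q.rl u w γ β) (Q.rl_comp hu hw hd)
    (Q.rl_comp hu hw (by linear_combination hd))

theorem Geo.rk_apply {u w : E} {β γ : K} (hu : Q.b u u = 0) (hw : Q.b w w = 0) (hd : β + γ + β * γ * Q.b u w = 0) (z : E) :
    Q.rk hu hw hd z = z + (β * Q.b w z) • u + (γ * Q.b u z) • w := Q.rl_apply u w β γ z

theorem Geo.rk_mem [FiniteDimensional K E] {S : Set E} {u w : E} {β γ : K} (hu : Q.b u u = 0) (hw : Q.b w w = 0) (hd : β + γ + β * γ * Q.b u w = 0)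
    (hu' : u ∈ Q.perp S) (hw' : w ∈ Q.perp S) : Q.rk hu hw hd ∈ Q.GS S := by
  refine ⟨fun x y => ?_, ?_, fun s hs => ?_⟩
  · simp only [Geo.rk_apply, map_add, map_smul, LinearMap.add_apply, LinearMap.smul_apply, smul_eq_mul, hu, hw, Q.symm w u,
      Q.symm x u, Q.symm x w]
    linear_combination (Q.b w x * Q.b u y + Q.b u x * Q.b w y) * hd
  · have h1 : (Q.rk hu hw hd : E →ₗ[K] E) = (LinearMap.transvection (β • Q.b w) u).comp (LinearMap.transvection (γ • Q.b u) w) := by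
      ext z
      show Q.rk hu hw hd z = _
      rw [Geo.rk_apply]
      simp only [LinearMap.comp_apply, LinearMap.transvection.apply, map_add, map_smul, LinearMap.smul_apply, smul_eq_mul, hw]
      simp only [mul_zero, add_zero, zero_smul]
      try abel
    apply Units.ext
    rw [LinearEquiv.coe_det, h1, LinearMap.det_comp, LinearMap.transvection.det, LinearMap.transvection.det]
    simp only [LinearMap.smul_apply, smul_eq_mul, Q.symm w u, Units.val_one]
    linear_combination Q.b u w * hd
  · rw [Geo.rk_apply, Q.mem_perp'.1 hu' s hs, Q.mem_perp'.1 hw' s hs]; simp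

/-- the elements of `GS S` centralizing `GS S'` -/
def Geo.Cc (S S' : Set E) : Subgroup (E ≃ₗ[K] E) := Q.GS S ⊓ Subgroup.centralizer (Q.GS S' : Set (E ≃ₗ[K] E))

theorem Geo.Cc_comm {S S' : Set E} {g : E ≃ₗ[K] E} (hg : g ∈ Q.Cc S S') : ∀ k ∈ Q.GS S', g * k = k * g :=
  fun k hk => (Subgroup.mem_centralizer_iff.1 hg.2 k hk).symm

theorem Geo.rk_Cc [FiniteDimensional K E] {S S' : Set E} {u w : E} {β γ : K} (hu : Q.b u u = 0) (hw : Q.b w w = 0)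
    (hd : β + γ + β * γ * Q.b u w = 0) (hu' : u ∈ Q.perp S) (hw' : w ∈ Q.perp S) (fu : ∀ k ∈ Q.GS S', k u = u)
    (fw : ∀ k ∈ Q.GS S', k w = w) : Q.rk hu hw hd ∈ Q.Cc S S' := by
  refine ⟨Q.rk_mem hu hw hd hu' hw', Subgroup.mem_centralizer_iff.2 fun k hk => ?_⟩
  ext z
  have h1 : Q.b u (k z) = Q.b u z := by conv_lhs => rw [← fu k hk, hk.1]
  have h2 : Q.b w (k z) = Q.b w z := by conv_lhs => rw [← fw k hk, hk.1]
  rw [LinearEquiv.mul_apply, LinearEquiv.mul_apply, Geo.rk_apply, Geo.rk_apply, h1, h2]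
  simp only [map_add, map_smul, fu k hk, fw k hk]

theorem Geo.Cc_Fx {S S' : Set E} {g : E ≃ₗ[K] E} (hg : g ∈ Q.Cc S S') {x : E × E} (hx : x ∈ Q.Fx S S') : pr g x ∈ Q.Fx S S' :=
  ⟨Q.GS_W0 hg.1 hx.1, fun k hk => by rw [← pr_mul, ← Q.Cc_comm hg k hk, pr_mul, hx.2 k hk]⟩

/-- swapping orthogonal hyperbolic pairs -/
theorem Geo.swap [FiniteDimensional K E] {S : Set E} {x x' : E × E} (hx : x ∈ Q.W0 S) (hx' : x' ∈ Q.W0 (S ∪ ps x)) :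
    ∃ g ∈ Q.GS S, pr g x = x' ∧ pr g x' = x ∧ (∀ z, (∀ s ∈ ps x ∪ ps x', Q.b s z = 0) → g z = z) ∧
      ∀ S', ps x ⊆ S' → ps x' ⊆ S' → g ∈ Q.Cc S S' := by
  obtain ⟨a1, a2, a3, a4, a5⟩ := hx
  obtain ⟨c1, c2, c3, c4, c5⟩ := hx'
  rw [Q.perp_union] at c1 c2
  have d1 : Q.b x.1 x'.1 = 0 := c1.2 _ (Or.inl rfl)
  have d2 : Q.b x.2 x'.1 = 0 := c1.2 _ (Or.inr rfl)
  have d3 : Q.b x.1 x'.2 = 0 := c2.2 _ (Or.inl rfl)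
  have d4 : Q.b x.2 x'.2 = 0 := c2.2 _ (Or.inr rfl)
  have e1 : Q.b x'.1 x.1 = 0 := by rw [Q.symm, d1]
  have e2 : Q.b x'.1 x.2 = 0 := by rw [Q.symm, d2]
  have e3 : Q.b x'.2 x.1 = 0 := by rw [Q.symm, d3]
  have e4 : Q.b x'.2 x.2 = 0 := by rw [Q.symm, d4]
  have a6 : Q.b x.2 x.1 = 1 := by rw [Q.symm, a5]
  have c6 : Q.b x'.2 x'.1 = 1 := by rw [Q.symm, c5]
  have hu : Q.b (x.1 - x'.1) (x.1 - x'.1) = 0 := by simp [*]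
  have hw : Q.b (x.2 - x'.2) (x.2 - x'.2) = 0 := by simp [*]
  have hd : (-1 : K) + -1 + -1 * -1 * Q.b (x.1 - x'.1) (x.2 - x'.2) = 0 := by
    simp [*]
  have hu' : x.1 - x'.1 ∈ Q.perp S := sub_mem a1 c1.1
  have hw' : x.2 - x'.2 ∈ Q.perp S := sub_mem a2 c2.1
  refine ⟨Q.rk hu hw hd, Q.rk_mem hu hw hd hu' hw', ?_, ?_, fun z hz => ?_, fun S' h h' => Q.rk_Cc hu hw hd hu' hw' ?_ ?_⟩
  · refine Prod.ext ?_ ?_ <;> simp only [pr, Geo.rk_apply] <;> simp [*]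
  · refine Prod.ext ?_ ?_ <;> simp only [pr, Geo.rk_apply] <;> simp [*]
  · have z1 := hz _ (Or.inl (Or.inl rfl))
    have z2 := hz _ (Or.inl (Or.inr rfl))
    have z3 := hz _ (Or.inr (Or.inl rfl))
    have z4 := hz _ (Or.inr (Or.inr rfl))
    simp [Geo.rk_apply, *]
  · intro k hk
    rw [map_sub, hk.2.2 _ (h (Or.inl rfl)), hk.2.2 _ (h' (Or.inl rfl))]
  · intro k hk
    rw [map_sub, hk.2.2 _ (h (Or.inr rfl)), hk.2.2 _ (h' (Or.inr rfl))]

theorem pr_fix {g : E ≃ₗ[K] E} {x : E × E} (h1 : g x.1 = x.1) (h2 : g x.2 = x.2) : pr g x = x := Prod.ext h1 h2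

variable [FiniteDimensional K E]

theorem Geo.W0_symm {S : Set E} {x x' : E × E} (hx : x ∈ Q.W0 S) (hx' : x' ∈ Q.W0 (S ∪ ps x)) : x ∈ Q.W0 (S ∪ ps x') := by
  obtain ⟨a1, a2, a3⟩ := hx
  obtain ⟨c1, c2, c3⟩ := hx'
  rw [Q.perp_union] at c1 c2
  refine ⟨Q.perp_union.2 ⟨a1, ?_⟩, Q.perp_union.2 ⟨a2, ?_⟩, a3⟩
  · rintro s (rfl | rfl)
    · rw [Q.symm]; exact c1.2 _ (Or.inl rfl)
    · rw [Q.symm]; exact c2.2 _ (Or.inl rfl)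
  · rintro s (rfl | rfl)
    · rw [Q.symm]; exact c1.2 _ (Or.inr rfl)
    · rw [Q.symm]; exact c2.2 _ (Or.inr rfl)

theorem Geo.th_conj' {S S' : Set E} (h : S ⊆ S') (x x' : Q.Fx S S') {g : E ≃ₗ[K] E} (hg : g ∈ Q.Cc S S')
    (z z' : Q.Fx S S') (hz : z.1 = pr g x.1) (hz' : z'.1 = pr g x'.1) {i : ℕ}
    (y : H (trivM (Q.GS S')) i) : Hm (Q.th h z z') i y = Hm (Q.th h x x') i y :=
  Q.th_conj h x x' hg.1 (Q.Cc_comm hg) z z' hz hz' y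

/-- theta classes vanish if there is a third pair -/
theorem Geo.th_three {S S' : Set E} (h : S ⊆ S') {x0 x1 x2 : E × E} (h1 : x1 ∈ Q.W0 S) (h0 : x0 ∈ Q.W0 (S ∪ ps x1))
    (h2 : x2 ∈ Q.W0 (S ∪ ps x1 ∪ ps x0)) (f0 : ps x0 ⊆ S') (f1 : ps x1 ⊆ S') (f2 : ps x2 ⊆ S') {i : ℕ}
    (k0 : x0 ∈ Q.Fx S S') (k1 : x1 ∈ Q.Fx S S') (y : H (trivM (Q.GS S')) i) : Hm (Q.th h ⟨x0, k0⟩ ⟨x1, k1⟩) i y = 0 := by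
  have h2' : x2 ∈ Q.W0 (S ∪ ps x1) := Q.W0_anti Set.subset_union_left h2
  have k2 : x2 ∈ Q.Fx S S' := Q.Fx_ps (Q.W0_anti Set.subset_union_left h2') f2
  have e1 := Q.th_add h ⟨x0, k0⟩ ⟨x1, k1⟩ ⟨x2, k2⟩ y
  obtain ⟨g, hg, g1, g2, g3, g4⟩ := Q.swap h1 h2'
  obtain ⟨p, hp, p1, p2, p3, p4⟩ := Q.swap h1 h0
  have e2 : Hm (Q.th h ⟨x0, k0⟩ ⟨x2, k2⟩) i y = Hm (Q.th h ⟨x0, k0⟩ ⟨x1, k1⟩) i y := by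
    refine Q.th_conj' h _ _ (g4 S' f1 f2) _ _ ?_ g1.symm y
    refine (pr_fix (g3 _ fun s hs => ?_) (g3 _ fun s hs => ?_)).symm
    · rcases hs with hs | hs
      · exact h0.1 s (Or.inr hs)
      · rw [Q.symm]
        rcases hs with rfl | rfl
        · exact h2.1 _ (Or.inr (Or.inl rfl))
        · exact h2.2.1 _ (Or.inr (Or.inl rfl))
    · rcases hs with hs | hs
      · exact h0.2.1 s (Or.inr hs)
      · rw [Q.symm]
        rcases hs with rfl | rfl
        · exact h2.1 _ (Or.inr (Or.inr rfl))
        · exact h2.2.1 _ (Or.inr (Or.inr rfl))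
  have e3 : Hm (Q.th h ⟨x1, k1⟩ ⟨x2, k2⟩) i y = Hm (Q.th h ⟨x0, k0⟩ ⟨x2, k2⟩) i y := by
    refine Q.th_conj' h _ _ (p4 S' f1 f0) _ _ p2.symm ?_ y
    refine (pr_fix (p3 _ fun s hs => ?_) (p3 _ fun s hs => ?_)).symm
    · rcases hs with hs | hs
      · exact h2.1 s (Or.inl (Or.inr hs))
      · exact h2.1 s (Or.inr hs)
    · rcases hs with hs | hs
      · exact h2.2.1 s (Or.inl (Or.inr hs))
      · exact h2.2.1 s (Or.inr hs)
  rw [e3] at e1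
  exact add_eq_right.1 e1

/-- KILL over arbitrary fields -/
theorem Geo.kill_fin {S : Set E} {x1 : E × E} (hx1 : x1 ∈ Q.W0 S) (i : ℕ) (hw : Q.Wi S 3)
    (hv : ∀ x0 ∈ Q.W0 (S ∪ ps x1), ∀ q, q + 1 = i → Van (Q.Rg (S ∪ ps x1 ∪ ps x0)) q)
    (y : H (Q.Rg (S ∪ ps x1)) i) : Hm (Q.Rinc Set.subset_union_left) i y = 0 := by
  refine Q.kill_red hx1 i (fun x0 hx0 => ?_) y
  have hne : (Q.W0 (S ∪ ps x1 ∪ ps x0)).Nonempty := by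
    apply Q.w1
    have h1 := Q.pair_drop hx1.1 hx1.2.2.1 (by rw [hx1.2.2.2.2]; exact one_ne_zero) hw
    have h2 : Q.Wi (S ∪ ps x1) 2 := Q.Wi_congr (fun m => by simp [Geo.perp_insert, Geo.perp_union, ps, Geo.mem_perp]; tauto) h1
    have h3 := Q.pair_drop hx0.1 hx0.2.2.1 (by rw [hx0.2.2.2.2]; exact one_ne_zero) h2
    exact Q.Wi_congr (fun m => by simp [Geo.perp_insert, Geo.perp_union, ps, Geo.mem_perp]; tauto) h3
  set T := S ∪ ps x1 ∪ ps x0 with hT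
  have h2 : ∀ y : H (trivM (Q.GS T)) i, y ∈ (Hm (Q.th (S := S) (S' := T) (Set.subset_union_left.trans Set.subset_union_left)
        ⟨x0, Q.Fx_ps (Q.W0_anti Set.subset_union_left hx0) Set.subset_union_right⟩
        ⟨x1, Q.Fx_ps hx1 (Set.subset_union_right.trans Set.subset_union_left)⟩) i).ker := by
    refine triv_ind (G := Q.GS T) (aPk (Q.GS T).subtype) (Q.W0 T) (Q.hXg _)
      (R := {x // x ∈ Q.W0 T})
      (fun x => Q.GS (T ∪ ps x.1)) (fun x => Subgroup.inclusion (Q.GS_anti Set.subset_union_left))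
      (fun x => x.1) (fun x => x.2) (fun x => Subgroup.inclusion_injective _)
      (fun x g => (Q.Fx_ps x.2 (S' := T ∪ ps x.1) Set.subset_union_right).2 g.1 g.2)
      (fun x g hg => ⟨⟨g.1, g.2.1, g.2.2.1, ?_⟩, rfl⟩) (fun x hx => ⟨⟨x, hx⟩, 1, rfl⟩) i hne (hv x0 hx0) _ (fun x y => ?_)
    · rintro s (hs | rfl | rfl)
      · exact g.2.2.2 s hs
      · exact congrArg Prod.fst hg
      · exact congrArg Prod.snd hg
    · rw [AddMonoidHom.mem_ker, Q.th_nat _ Set.subset_union_left]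
      exact Q.th_three _ hx1 hx0 x.2 (Set.subset_union_right.trans Set.subset_union_left)
        (Set.subset_union_right.trans (Set.subset_union_left.trans Set.subset_union_left)) Set.subset_union_right _ _ y
  exact h2

/-- theta homomorphism -/
noncomputable def Geo.phi {S S' : Set E} (h : S ⊆ S') (x : Q.Fx S S') {i : ℕ} (y : H (trivM (Q.GS S')) i) :
    Q.Cc S S' →* Multiplicative (H (Q.Rg S) i) :=
  MonoidHom.mk' (fun g => Multiplicative.ofAdd (Hm (Q.th h x ⟨pr g.1 x.1, Q.Cc_Fx g.2 x.2⟩) i y)) (fun g g' => by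
    rw [← ofAdd_add]
    congr 1
    rw [← Q.th_add h x ⟨pr g.1 x.1, Q.Cc_Fx g.2 x.2⟩]
    congr 1
    exact Q.th_conj' h x ⟨pr g'.1 x.1, Q.Cc_Fx g'.2 x.2⟩ g.2 _ _ rfl rfl y)

theorem Geo.el_kill {S S' : Set E} {B : Type} [AddCommGroup B] (φ : Q.Cc S S' →* Multiplicative B) {u w : E} (hu : Q.b u u = 0)
    (hw : Q.b w w = 0) (huw : Q.b u w = 0) (hu' : u ∈ Q.perp S) (hw' : w ∈ Q.perp S) (fu : ∀ k ∈ Q.GS S', k u = u)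
    (fw : ∀ k ∈ Q.GS S', k w = w) (z : Q.Cc S S') (t : K) (ht : t ≠ 1) (zu : z.1 u = t • u) (zw : z.1 w = w) (s : K)
    (hd : s + -s + s * -s * Q.b u w = 0) : φ ⟨Q.rk hu hw hd, Q.rk_Cc hu hw hd hu' hw' fu fw⟩ = 1 := by
  have hd' : ∀ s, s + -s + s * -s * Q.b u w = 0 := fun s => by rw [huw]; ring
  let e : K → Q.Cc S S' := fun s => ⟨Q.rk hu hw (hd' s), Q.rk_Cc hu hw (hd' s) hu' hw' fu fw⟩
  have he : ∀ s z, (e s).1 z = z + (s * Q.b w z) • u + (-s * Q.b u z) • w := fun s z => Q.rk_apply hu hw (hd' s) z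
  have h1 : ∀ s s', e (s + s') = e s * e s' := fun s s' => by
    apply Subtype.ext
    ext x
    show (e (s + s')).1 x = (e s).1 ((e s').1 x)
    simp only [he, map_add, map_smul, hu, hw, huw, Q.symm w u, smul_eq_mul]
    module
  have h2 : ∀ s, z * e s = e (t * s) * z := fun s => by
    apply Subtype.ext
    ext x
    show z.1 ((e s).1 x) = (e (t * s)).1 (z.1 x)
    have b1 : t * Q.b u (z.1 x) = Q.b u x := by
      rw [← z.2.1.1 u x, zu, map_smul]; rfl
    have b2 : Q.b w (z.1 x) = Q.b w x := by
      conv_lhs => rw [← zw, z.2.1.1]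
    simp only [he, map_add, map_smul, zu, zw, b2]
    rw [← b1]
    module
  have h3 : ∀ s, φ (e (t * s)) = φ (e s) := fun s => by
    have := congrArg φ (h2 s)
    rw [map_mul, map_mul, mul_comm] at this
    exact (mul_right_cancel this).symm
  have h4 : ∀ s, φ (e ((t - 1) * s)) = 1 := fun s => by
    have := h1 ((t - 1) * s) s
    rw [show (t - 1) * s + s = t * s by ring] at this
    have := congrArg φ this
    rw [map_mul, h3] at this
    exact mul_eq_right.1 this.symm
  have := h4 (s / (t - 1))
  rwa [mul_div_cancel₀ _ (sub_ne_zero.2 ht)] at this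

theorem Geo.kill_inf [Infinite K] {S : Set E} {x1 : E × E} (hx1 : x1 ∈ Q.W0 S) (i : ℕ)
    (y : H (Q.Rg (S ∪ ps x1)) i) : Hm (Q.Rinc Set.subset_union_left) i y = 0 := by
  refine Q.kill_red hx1 i (fun x0 hx0 => ?_) y
  set T := S ∪ ps x1 ∪ ps x0 with hT
  intro y
  have hST : S ⊆ T := Set.subset_union_left.trans Set.subset_union_left
  have hf : ∀ s ∈ ps x1 ∪ ps x0, ∀ k ∈ Q.GS T, k s = s := fun s hs k hk => hk.2.2 s (by
    rcases hs with hs | hs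
    · exact Or.inl (Or.inr hs)
    · exact Or.inr hs)
  have f1 := hf _ (Or.inl (Or.inl rfl))
  have f2 := hf _ (Or.inl (Or.inr rfl))
  have f3 := hf _ (Or.inr (Or.inl rfl))
  have f4 := hf _ (Or.inr (Or.inr rfl))
  have k0 : x0 ∈ Q.Fx S T := Q.Fx_ps (Q.W0_anti Set.subset_union_left hx0) Set.subset_union_right
  have k1 : x1 ∈ Q.Fx S T := Q.Fx_ps hx1 (Set.subset_union_right.trans Set.subset_union_left)
  obtain ⟨a1, a2, a3, a4, a5⟩ := hx1
  obtain ⟨c1, c2, c3, c4, c5⟩ := hx0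
  rw [Q.perp_union] at c1 c2
  have d1 : Q.b x1.1 x0.1 = 0 := c1.2 _ (Or.inl rfl)
  have d2 : Q.b x1.2 x0.1 = 0 := c1.2 _ (Or.inr rfl)
  have d3 : Q.b x1.1 x0.2 = 0 := c2.2 _ (Or.inl rfl)
  have d4 : Q.b x1.2 x0.2 = 0 := c2.2 _ (Or.inr rfl)
  have e1 : Q.b x0.1 x1.1 = 0 := by rw [Q.symm, d1]
  have e2 : Q.b x0.1 x1.2 = 0 := by rw [Q.symm, d2]
  have e3 : Q.b x0.2 x1.1 = 0 := by rw [Q.symm, d3]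
  have e4 : Q.b x0.2 x1.2 = 0 := by rw [Q.symm, d4]
  have a6 : Q.b x1.2 x1.1 = 1 := by rw [Q.symm, a5]
  have c6 : Q.b x0.2 x0.1 = 1 := by rw [Q.symm, c5]
  classical
  obtain ⟨t, ht⟩ := Infinite.exists_notMem_finset ({0, 1} : Finset K)
  simp only [Finset.mem_insert, Finset.mem_singleton, not_or] at ht
  have hz : (t - 1) + (t⁻¹ - 1) + (t - 1) * (t⁻¹ - 1) * Q.b x0.1 x0.2 = 0 := by
    rw [c5]; field_simp [ht.1]; ring
  let z : Q.Cc S T := ⟨Q.rk c3 c4 hz, Q.rk_Cc c3 c4 hz c1.1 c2.1 f3 f4⟩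
  have hza : ∀ m, z.1 m = m + ((t - 1) * Q.b x0.2 m) • x0.1 + ((t⁻¹ - 1) * Q.b x0.1 m) • x0.2 := fun m => Q.rk_apply c3 c4 hz m
  have zu1 : z.1 x0.1 = t • x0.1 := by rw [hza, c6, c3]; module
  have zu2 : z.1 x0.2 = t⁻¹ • x0.2 := by rw [hza, c5, c4]; module
  have zw1 : z.1 x1.2 = x1.2 := by rw [hza, e2, e4]; simp
  have zw2 : z.1 x1.1 = x1.1 := by rw [hza, e1, e3]; simp
  have hd1 : (-1 : K) + - -1 + -1 * - -1 * Q.b x0.1 x1.2 = 0 := by rw [e2]; ring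
  have hd2 : (-1 : K) + - -1 + -1 * - -1 * Q.b x0.2 x1.1 = 0 := by rw [e3]; ring
  let φ := Q.phi hST ⟨x0, k0⟩ y
  have p1 := Q.el_kill φ c3 a4 e2 c1.1 a2 f3 f2 z t ht.2 zu1 zw1 (-1) hd1
  have p2 := Q.el_kill φ c4 a3 e3 c2.1 a1 f4 f1 z t⁻¹ (by simpa using ht.2) zu2 zw2 (-1) hd2
  set g1 : Q.Cc S T := ⟨Q.rk c3 a4 hd1, Q.rk_Cc c3 a4 hd1 c1.1 a2 f3 f2⟩
  set g2 : Q.Cc S T := ⟨Q.rk c4 a3 hd2, Q.rk_Cc c4 a3 hd2 c2.1 a1 f4 f1⟩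
  have hg1 : ∀ m, g1.1 m = m + (-1 * Q.b x1.2 m) • x0.1 + (- -1 * Q.b x0.1 m) • x1.2 := fun m => Q.rk_apply c3 a4 hd1 m
  have hg2 : ∀ m, g2.1 m = m + (-1 * Q.b x1.1 m) • x0.2 + (- -1 * Q.b x0.2 m) • x1.1 := fun m => Q.rk_apply c4 a3 hd2 m
  have q : φ (g1 * g2 * g1) = 1 := by rw [map_mul, map_mul, p1, p2]; simp
  have hmap : pr (g1 * g2 * g1).1 x0 = x1 := by
    refine Prod.ext ?_ ?_
    · show g1.1 (g2.1 (g1.1 x0.1)) = x1.1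
      simp [hg1, hg2, *]
    · show g1.1 (g2.1 (g1.1 x0.2)) = x1.2
      simp [hg1, hg2, *]
  have q' : Hm (Q.th hST ⟨x0, k0⟩ ⟨pr (g1 * g2 * g1).1 x0, Q.Cc_Fx (g1 * g2 * g1).2 k0⟩) i y = 0 := q
  convert q' using 4
  exact Subtype.ext hmap.symm
end elts

end P12

section P13
open Tup
/-! ### the main induction -/
section main
variable {K E : Type} [Field K] [AddCommGroup E] [Module K E] (Q : Geo K E)

theorem Geo.GS_Tr {S : Set E} {g : E ≃ₗ[K] E} (hg : g ∈ Q.GS S) {O : Type} (pt : O → Set E) (f : O → O) (hf : ∀ o, pt (f o) = g '' pt o)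
    (o : O) (x : E × E) (h : Q.Tr pt o x) : Q.Tr pt (f o) (pr g x) := by
  intro s hs
  rw [hf] at hs
  obtain ⟨s, hs, rfl⟩ := hs
  obtain ⟨h1, h2⟩ := h s hs
  exact ⟨(hg.1 _ _).trans h1, (hg.1 _ _).trans h2⟩

theorem ps_pr (g : E ≃ₗ[K] E) (x : E × E) : ps (pr g x) = g '' ps x := by
  simp [ps, pr, Set.image_insert_eq]

theorem Geo.GS_rP {S : Set E} {g : E ≃ₗ[K] E} (hg : g ∈ Q.GS S) (x y : E × E) (h : Q.rP x y) : Q.rP (pr g x) (pr g y) := by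
  rcases h with rfl | h
  · exact Or.inl rfl
  · exact Or.inr (Q.GS_Tr hg ps (pr g) (ps_pr g) x y h)

theorem Geo.InvP (S : Set E) : Inv (G := Q.GS S) (aPk (Q.GS S).subtype) (aPk (Q.GS S).subtype) Q.rP (Q.W0 S) (Q.W0 S) (Q.Tr ps) where
  hr g o o' h := Q.GS_rP g.2 o o' h
  hY := Q.hXg S
  hX := Q.hXg S
  hT g o x h := Q.GS_Tr g.2 ps (pr g.1) (ps_pr g.1) o x h

theorem Geo.InvV (S : Set E) : Inv (G := Q.GS S) (aVk (Q.GS S).subtype) (aPk (Q.GS S).subtype) Q.rV (Q.Yv S) (Q.W0 S)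
    (Q.Tr fun v => {v}) where
  hr g o o' h := by
    rcases h with rfl | h
    · exact Or.inl rfl
    · refine Or.inr ?_
      show Q.b (g.1 o) (g.1 o') ≠ 0
      rwa [g.2.1]
  hY g o h := by
    obtain ⟨h1, h2, m, h3, h4⟩ := h
    refine ⟨Q.GS_perp g.2 h1, ?_, g.1 m, Q.GS_perp g.2 h3, ?_⟩
    · show Q.b (g.1 o) (g.1 o) = 0
      rwa [g.2.1]
    · show Q.b (g.1 o) (g.1 m) ≠ 0
      rwa [g.2.1]
  hX := Q.hXg S
  hT g o x h := Q.GS_Tr g.2 (fun v => {v}) (fun v => g.1 v) (fun o => by simp) o x h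

theorem US_one {O : Type} (pt : O → Set E) (o : O) : US pt (ent (tc o (tn : Tup O 0))) = pt o := by
  rw [ent, US_insert, ent, US_empty, Set.union_empty]

theorem Geo.fixP (S : Set E) (g : Q.GS S) (o : E × E) : (aPk (Q.GS S).subtype).act g o = o ↔ ∀ s ∈ ps o, g.1 s = s := by
  constructor
  · rintro h s (rfl | rfl)
    · exact congrArg Prod.fst h
    · exact congrArg Prod.snd h
  · intro h
    exact Prod.ext (h _ (Or.inl rfl)) (h _ (Or.inr rfl))

theorem Geo.fixV (S : Set E) (g : Q.GS S) (o : E) : (aVk (Q.GS S).subtype).act g o = o ↔ ∀ s ∈ ({o} : Set E), g.1 s = s := by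
  constructor
  · rintro h s rfl
    exact h
  · intro h
    exact h _ rfl

variable [FiniteDimensional K E]

theorem Geo.ps_drop {S : Set E} {g : ℕ} {x : E × E} (hx : x ∈ Q.W0 S) (h : Q.Wi S (g + 1)) : Q.Wi (S ∪ ps x) g :=
  Q.Wi_congr (fun m => by simp [Geo.perp_insert, Geo.perp_union, ps, Geo.mem_perp]; tauto)
    (Q.pair_drop hx.1 hx.2.2.1 (by rw [hx.2.2.2.2]; exact one_ne_zero) h)

theorem Geo.W_link1 {S : Set E} {x : E × E} : Q.W0 S ∩ {o | Q.Tr ps o x} = Q.W0 (S ∪ ps x) := by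
  have h := Q.Xs_eq ps S {x}
  have : US ps {x} = ps x := by simp [US]
  rw [this] at h
  rw [← h]
  ext o
  simp only [Xs, Set.mem_inter_iff, Set.mem_setOf_eq, Set.mem_singleton_iff, forall_eq]
  exact and_congr_right fun _ => ⟨Q.Tr_symm, Q.Tr_symm⟩

theorem Geo.main_fin (i : ℕ) : ∀ S : Set E, Q.Wi S (2 * i + 3) → Van (Q.Rg S) i := by
  induction i using Nat.strong_induction_on with
  | _ i ih =>
  intro S hS y
  have := engine (Q.InvP S) i (fun q hq => R_exact (fun x hx => ?_) ?_ (fun w hw => ?_)) (fun q j hq w hw => ?_) ⊥ (fun o ho _ => ?_) y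
  · exact this
  · rw [Q.W_link1]
    exact Q.W_acyclic q _ (Q.ps_drop hx (Q.Wi_mono (by omega) hS))
  · exact Q.W_acyclic (q + 1) S (Q.Wi_mono (by omega) hS)
  · rw [Q.Xs_eq]
    exact Q.w1 (Q.pair_word w hw (Q.Wi_mono (by omega) hS))
  · refine ⟨_, _, Q.stb S ps _ _ _ (Q.InvP S) (Q.fixP S) w, ih j (by omega) _ (Q.pair_word w hw (Q.Wi_mono (by omega) hS))⟩
  · refine ⟨_, _, Q.stb S ps _ _ _ (Q.InvP S) (Q.fixP S) _, ?_⟩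
    have key : ∀ (T : Set E) (hT : T = S ∪ ps o) (h : S ⊆ T) (y : H (Q.Rg T) i), Hm (Q.Rinc h) i y = 0 := by
      rintro T rfl h y
      refine Q.kill_fin ho i (Q.Wi_mono (by omega) hS) (fun x0 hx0 q hq => ih q (by omega) _ ?_) y
      exact Q.ps_drop hx0 (Q.ps_drop ho (Q.Wi_mono (by omega) hS))
    exact fun y => key _ (by rw [US_one]) _ y

theorem Geo.main_inf' [Infinite K]
    (hP : ∀ (i : ℕ) (S : Set E) (v : E), v ∈ Q.Yv S → Q.Wi S (i + 2) → (∀ x ∈ Q.W0 S, ∀ j < i, Van (Q.Rg (S ∪ ps x)) j) →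
      ∀ y : H (Q.Rg (S ∪ {v})) i, Hm (Q.Rinc Set.subset_union_left) i y = 0)
    (i : ℕ) : ∀ S : Set E, Q.Wi S (i + 2) → Van (Q.Rg S) i := by
  induction i using Nat.strong_induction_on with
  | _ i ih =>
  intro S hS y
  have := engine (Q.InvV S) i (fun q hq => R_exact (fun x hx => ?_) ?_ (fun w hw => ?_)) (fun q j hq w hw => ?_) ⊥ (fun o ho _ => ?_) y
  · exact this
  · rw [Q.Yv_link hx]
    have h1 := Q.ps_drop hx hS
    rcases Nat.eq_zero_or_pos i with rfl | hi
    · obtain rfl : q = 0 := by omega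
      obtain ⟨x, hx⟩ := Q.w1 h1
      exact Ex_zero Q.rV_refl ⟨_, Q.Yv_W0 hx⟩
    · exact Q.V_acyclic (Q.Wi_mono (by omega) h1) q
  · exact Q.V_acyclic (Q.Wi_mono (by omega) hS) _
  · rw [Q.Xs_eq]
    exact Q.w1 (Q.vec_word2 w hw (Q.Wi_mono (by omega) hS))
  · refine ⟨_, _, Q.stb S _ _ _ _ (Q.InvV S) (Q.fixV S) w, ih j (by omega) _ (Q.vec_word2 w hw (Q.Wi_mono (by omega) hS))⟩
  · refine ⟨_, _, Q.stb S _ _ _ _ (Q.InvV S) (Q.fixV S) _, ?_⟩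
    have key : ∀ (T : Set E) (hT : T = S ∪ {o}) (h : S ⊆ T) (y : H (Q.Rg T) i), Hm (Q.Rinc h) i y = 0 := by
      rintro T rfl h y
      exact hP i S o ho hS (fun x hx j hj => ih j hj _ (Q.ps_drop hx (Q.Wi_mono (by omega) hS))) y
    exact fun y => key _ (by rw [US_one]) _ y
end main

end P13

section P14
open Tup
/-! ### the unipotent group -/
section uni
variable {K E : Type} [Field K] [AddCommGroup E] [Module K E] (Q : Geo K E)

@[ext] structure Geo.Aq where
  m : E
  c : K
  h : 2 * c + Q.b m m = 0

variable {Q}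
instance : Zero Q.Aq := ⟨⟨0, 0, by simp⟩⟩
instance : Add Q.Aq := ⟨fun a a' => ⟨a.m + a'.m, a.c + a'.c - Q.b a.m a'.m, by
  simp only [map_add, LinearMap.add_apply, Q.symm a'.m a.m]
  linear_combination a.h + a'.h⟩⟩
instance : Neg Q.Aq := ⟨fun a => ⟨-a.m, a.c, by simpa using a.h⟩⟩
instance : SMul K Q.Aq := ⟨fun t a => ⟨t • a.m, t ^ 2 * a.c, by
  simp only [map_smul, LinearMap.smul_apply, smul_eq_mul]
  linear_combination t ^ 2 * a.h⟩⟩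
theorem Geo.Aq.zero_m : (0 : Q.Aq).m = 0 := rfl
theorem Geo.Aq.zero_c : (0 : Q.Aq).c = 0 := rfl
theorem Geo.Aq.add_m (a a' : Q.Aq) : (a + a').m = a.m + a'.m := rfl
theorem Geo.Aq.add_c (a a' : Q.Aq) : (a + a').c = a.c + a'.c - Q.b a.m a'.m := rfl
theorem Geo.Aq.neg_m (a : Q.Aq) : (-a).m = -a.m := rfl
theorem Geo.Aq.neg_c (a : Q.Aq) : (-a).c = a.c := rfl
theorem Geo.Aq.smul_m (t : K) (a : Q.Aq) : (t • a).m = t • a.m := rfl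
theorem Geo.Aq.smul_c (t : K) (a : Q.Aq) : (t • a).c = t ^ 2 * a.c := rfl

instance : AddCommGroup Q.Aq where
  add_assoc a a' a'' := by
    ext
    · exact add_assoc _ _ _
    · simp only [Geo.Aq.add_c, Geo.Aq.add_m, map_add, LinearMap.add_apply]; ring
  zero_add a := by
    ext
    · exact zero_add _
    · simp [Geo.Aq.add_c, Geo.Aq.zero_c, Geo.Aq.zero_m]
  add_zero a := by
    ext
    · exact add_zero _
    · simp [Geo.Aq.add_c, Geo.Aq.zero_c, Geo.Aq.zero_m]
  nsmul := nsmulRec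
  zsmul := zsmulRec
  neg_add_cancel a := by
    ext
    · exact neg_add_cancel _
    · simp only [Geo.Aq.add_c, Geo.Aq.neg_c, Geo.Aq.neg_m, Geo.Aq.zero_c, map_neg, LinearMap.neg_apply]
      linear_combination a.h
  add_comm a a' := by
    ext
    · exact add_comm _ _
    · simp only [Geo.Aq.add_c, Q.symm a.m a'.m]; ring

instance : Module K Q.Aq where
  one_smul a := by
    ext
    · exact one_smul _ _
    · simp [Geo.Aq.smul_c]
  mul_smul t s a := by
    ext
    · exact mul_smul _ _ _
    · simp [Geo.Aq.smul_c]; ring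
  smul_zero t := by
    ext
    · exact smul_zero _
    · simp [Geo.Aq.smul_c, Geo.Aq.zero_c]
  smul_add t a a' := by
    ext
    · exact smul_add _ _ _
    · simp only [Geo.Aq.smul_c, Geo.Aq.add_c, Geo.Aq.smul_m, map_smul, LinearMap.smul_apply, smul_eq_mul]; ring
  add_smul t s a := by
    ext
    · exact add_smul _ _ _
    · simp only [Geo.Aq.smul_c, Geo.Aq.add_c, Geo.Aq.smul_m, map_smul, LinearMap.smul_apply, smul_eq_mul]
      linear_combination t * s * a.h
  zero_smul a := by
    ext
    · exact zero_smul _ _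
    · simp [Geo.Aq.smul_c, Geo.Aq.zero_c]

variable (Q)
def Geo.AU (U : Set E) : Submodule K Q.Aq where
  carrier := {a | a.m ∈ Q.perp U}
  zero_mem' := (Q.perp U).zero_mem
  add_mem' := fun h h' => (Q.perp U).add_mem h h'
  smul_mem' := fun t _ h => (Q.perp U).smul_mem t h

abbrev Geo.LL (U : Set E) : Type := Kˣ × Q.GS U

def Geo.gA (U : Set E) (g : Q.GS U) : Q.AU U →ₗ[K] Q.AU U where
  toFun a := ⟨⟨g.1 a.1.m, a.1.c, by rw [g.2.1]; exact a.1.h⟩, Q.GS_perp g.2 a.2⟩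
  map_add' a a' := by
    apply Subtype.ext
    apply Geo.Aq.ext
    · exact map_add g.1 _ _
    · show a.1.c + a'.1.c - Q.b a.1.m a'.1.m = a.1.c + a'.1.c - Q.b (g.1 a.1.m) (g.1 a'.1.m)
      rw [g.2.1]
  map_smul' t a := by
    apply Subtype.ext
    apply Geo.Aq.ext
    · exact map_smul g.1 _ _
    · rfl

def Geo.actA (U : Set E) : Q.LL U →* Module.End K (Q.AU U) where
  toFun l := (l.1 : K) • Q.gA U l.2
  map_one' := by
    ext a
    · exact one_smul _ _
    · show (1 : K) ^ 2 * a.1.c = a.1.c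
      simp
  map_mul' l l' := by
    ext a
    · show ((l.1 * l'.1 : Kˣ) : K) • l.2.1 (l'.2.1 a.1.m) = (l.1 : K) • l.2.1 ((l'.1 : K) • l'.2.1 a.1.m)
      rw [map_smul, smul_smul, Units.val_mul]
    · show ((l.1 * l'.1 : Kˣ) : K) ^ 2 * a.1.c = (l.1 : K) ^ 2 * ((l'.1 : K) ^ 2 * a.1.c)
      rw [Units.val_mul]; ring

theorem Geo.actA_m (U : Set E) (l : Q.LL U) (a : Q.AU U) : (Q.actA U l a).1.m = (l.1 : K) • l.2.1 a.1.m := rfl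
theorem Geo.actA_c (U : Set E) (l : Q.LL U) (a : Q.AU U) : (Q.actA U l a).1.c = (l.1 : K) ^ 2 * a.1.c := rfl

abbrev Geo.Gam (U : Set E) : Type := SD (Q.actA U)

/-- the torus acts trivially on homology -/
theorem Geo.Gam_scal [Infinite K] (U : Set E) {j : ℕ} (y : H (trivM (Q.Gam U)) j) : Hm (trivH (scal (Q.actA U) 0)) j y = y := by
  refine torus_kill (Q.actA U) (fun t ht y => ?_) y
  conv_rhs => rw [← Hm_conj (A := trivM (Q.Gam U)) ⟨0, (Units.mk0 t ht, 1)⟩ y]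
  congr 2
  refine GHom.ext' (fun g => ?_) (fun n => rfl)
  show _ = (⟨0, (Units.mk0 t ht, 1)⟩ : Q.Gam U) * g * (⟨0, (Units.mk0 t ht, 1)⟩ : Q.Gam U)⁻¹
  rw [eq_mul_inv_iff_mul_eq]
  ext
  · show t • g.a.1.m + ((g.l.1 : K) • g.l.2.1 (0 : E)) = 0 + t • g.a.1.m
    simp
  · show (t • g.a + Q.actA U g.l 0).1.c = (0 + Q.actA U (Units.mk0 t ht, 1) g.a).1.c
    rw [map_zero, add_zero, zero_add]
    rfl
  · show ((g.l.1 * Units.mk0 t ht : Kˣ) : K) = ((Units.mk0 t ht * g.l.1 : Kˣ) : K)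
    rw [mul_comm]
  · show (g.l.2 * 1).1 _ = (1 * g.l.2).1 _
    rw [one_mul, mul_one]

def Geo.Gj {U U' : Set E} (h : U ⊆ U') : Q.Gam U' →* Q.Gam U :=
  SDm (Submodule.inclusion (fun a ha => Q.perp_anti h ha)) (MonoidHom.prodMap (MonoidHom.id _) (Subgroup.inclusion (Q.GS_anti h)))
    (fun l a => rfl)
end uni

end P14

section P15
open Tup
/-! ### the parabolic group -/
section kap
variable {K E : Type} [Field K] [AddCommGroup E] [Module K E] [FiniteDimensional K E] (Q : Geo K E)

def Geo.el (v : E) (a : Q.Aq) : E →ₗ[K] E :=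
  LinearMap.id + (Q.b v).smulRight (a.m + a.c • v) - (Q.b a.m).smulRight v

theorem Geo.el_apply (v : E) (a : Q.Aq) (z : E) : Q.el v a z = z + Q.b v z • (a.m + a.c • v) - Q.b a.m z • v := by
  simp [Geo.el]

theorem Geo.el_add {v : E} {a a' : Q.Aq} (h0 : Q.b v v = 0) (h : Q.b v a.m = 0) (h' : Q.b v a'.m = 0) (z : E) :
    Q.el v (a + a') z = Q.el v a (Q.el v a' z) := by
  have k : Q.b a.m v = 0 := by rw [Q.symm, h]
  have k' : Q.b a'.m v = 0 := by rw [Q.symm, h']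
  simp only [Geo.el_apply, Geo.Aq.add_m, Geo.Aq.add_c, map_add, map_sub, map_smul, LinearMap.add_apply, h0, h, h', k, k', smul_eq_mul]
  module

theorem Geo.el_zero (v z : E) : Q.el v 0 z = z := by
  simp [Geo.el_apply, Geo.Aq.zero_m, Geo.Aq.zero_c]

theorem Geo.el_iso {v : E} {a : Q.Aq} (h0 : Q.b v v = 0) (h : Q.b v a.m = 0) (x y : E) :
    Q.b (Q.el v a x) (Q.el v a y) = Q.b x y := by
  have k : Q.b a.m v = 0 := by rw [Q.symm, h]
  simp only [Geo.el_apply, map_add, map_sub, map_smul, LinearMap.add_apply, LinearMap.sub_apply, LinearMap.smul_apply, h0, h, k, smul_eq_mul,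
    Q.symm x v, Q.symm x a.m]
  linear_combination Q.b v x * Q.b v y * a.h

theorem Geo.el_det {v : E} {a : Q.Aq} (h0 : Q.b v v = 0) (h : Q.b v a.m = 0) : LinearMap.det (Q.el v a) = 1 := by
  have k : Q.b a.m v = 0 := by rw [Q.symm, h]
  have h1 : Q.el v a = (LinearMap.transvection (-(Q.b a.m + Q.b a.m a.m • Q.b v) : E →ₗ[K] K) v).comp
      ((LinearMap.transvection (Q.b v) (a.m)).comp (LinearMap.transvection (Q.b v) ((a.c + 2 * Q.b a.m a.m) • v))) := by
    ext z
    simp only [Geo.el_apply, LinearMap.comp_apply, LinearMap.transvection.apply, map_add, map_smul, LinearMap.neg_apply,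
      LinearMap.add_apply, LinearMap.smul_apply, smul_eq_mul, h0, h, k]
    module
  rw [h1, LinearMap.det_comp, LinearMap.det_comp, LinearMap.transvection.det, LinearMap.transvection.det, LinearMap.transvection.det]
  simp [h0, h, k]

def Geo.eE {v : E} (h0 : Q.b v v = 0) (a : Q.Aq) (h : Q.b v a.m = 0) : E ≃ₗ[K] E :=
  have h' : Q.b v (-a).m = 0 := by rw [Geo.Aq.neg_m, map_neg, h, neg_zero]
  LinearEquiv.ofLinear (Q.el v a) (Q.el v (-a))
    (by ext z; rw [LinearMap.comp_apply, ← Q.el_add h0 h h', add_neg_cancel]; exact Q.el_zero v z)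
    (by ext z; rw [LinearMap.comp_apply, ← Q.el_add h0 h' h, neg_add_cancel]; exact Q.el_zero v z)

theorem Geo.eE_apply {v : E} (h0 : Q.b v v = 0) (a : Q.Aq) (h : Q.b v a.m = 0) (z : E) : Q.eE h0 a h z = Q.el v a z := rfl

theorem Geo.eE_mem {S : Set E} {v : E} (h0 : Q.b v v = 0) (a : Q.Aq) (h : Q.b v a.m = 0) (hv : v ∈ Q.perp S)
    (ha : a.m ∈ Q.perp S) : Q.eE h0 a h ∈ Q.GS S := by
  refine ⟨Q.el_iso h0 h, ?_, fun s hs => ?_⟩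
  · apply Units.ext
    rw [LinearEquiv.coe_det]
    exact Q.el_det h0 h
  · rw [Geo.eE_apply, Geo.el_apply, Q.mem_perp'.1 hv s hs, Q.mem_perp'.1 ha s hs]; simp

variable {S : Set E} {x1 : E × E} (hx1 : x1 ∈ Q.W0 S)

theorem zt_hd {β : K} (t : Kˣ) (hb : β = 1) : ((t : K) - 1) + ((t⁻¹ : Kˣ) - 1 : K) + ((t : K) - 1) * ((t⁻¹ : Kˣ) - 1 : K) * β = 0 := by
  rw [hb]
  have : (t : K) * ((t⁻¹ : Kˣ) : K) = 1 := t.mul_inv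
  linear_combination this

def Geo.zt (t : Kˣ) : E ≃ₗ[K] E := Q.rk (u := x1.1) (w := x1.2) hx1.2.2.1 hx1.2.2.2.1 (zt_hd t hx1.2.2.2.2)

theorem Geo.zt_apply (t : Kˣ) (z : E) : Q.zt hx1 t z = z + (((t : K) - 1) * Q.b x1.2 z) • x1.1 + (((t⁻¹ : Kˣ) - 1 : K) * Q.b x1.1 z) • x1.2 :=
  Q.rk_apply hx1.2.2.1 hx1.2.2.2.1 (zt_hd t hx1.2.2.2.2) z

theorem Geo.zt_mem (t : Kˣ) : Q.zt hx1 t ∈ Q.GS S := Q.rk_mem _ _ _ hx1.1 hx1.2.1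

theorem Geo.zt_mul (t s : Kˣ) (z : E) : Q.zt hx1 (t * s) z = Q.zt hx1 t (Q.zt hx1 s z) := by
  obtain ⟨a1, a2, a3, a4, a5⟩ := id hx1
  have a6 : Q.b x1.2 x1.1 = 1 := by rw [Q.symm, a5]
  simp only [Geo.zt_apply, map_add, map_smul, a3, a4, a5, a6, smul_eq_mul, Units.val_mul, mul_inv]
  module

theorem Geo.zt_one (z : E) : Q.zt hx1 1 z = z := by
  simp [Geo.zt_apply]

theorem Geo.zt_v (t : Kˣ) : Q.zt hx1 t x1.1 = (t : K) • x1.1 := by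
  obtain ⟨a1, a2, a3, a4, a5⟩ := id hx1
  have a6 : Q.b x1.2 x1.1 = 1 := by rw [Q.symm, a5]
  simp only [Geo.zt_apply, a3, a6]
  module

theorem Geo.zt_f (t : Kˣ) : Q.zt hx1 t x1.2 = ((t⁻¹ : Kˣ) : K) • x1.2 := by
  obtain ⟨a1, a2, a3, a4, a5⟩ := id hx1
  simp only [Geo.zt_apply, a4, a5]
  module

theorem Geo.zt_fix (t : Kˣ) {z : E} (h1 : Q.b x1.1 z = 0) (h2 : Q.b x1.2 z = 0) : Q.zt hx1 t z = z := by
  simp [Geo.zt_apply, h1, h2]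

theorem Geo.zt_el (t : Kˣ) (a : Q.Aq) (h1 : Q.b x1.1 a.m = 0) (h2 : Q.b x1.2 a.m = 0) (z : E) :
    Q.zt hx1 t (Q.el x1.1 a z) = Q.el x1.1 ((t : K) • a) (Q.zt hx1 t z) := by
  have k1 := Q.zt_fix hx1 t h1 h2
  have hi := (Q.zt_mem hx1 t).1
  have e1 : (t : K) * Q.b x1.1 (Q.zt hx1 t z) = Q.b x1.1 z := by
    rw [← smul_eq_mul, ← LinearMap.smul_apply, ← map_smul, ← Q.zt_v hx1, hi]
  have e2 : Q.b a.m (Q.zt hx1 t z) = Q.b a.m z := by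
    conv_lhs => rw [← k1, hi]
  simp only [Geo.el_apply, map_add, map_sub, map_smul, LinearMap.smul_apply, k1, Q.zt_v hx1, Geo.Aq.smul_m, Geo.Aq.smul_c, e2, smul_eq_mul]
  rw [← e1]
  module

theorem Geo.el_g {g : E ≃ₗ[K] E} (hg : g ∈ Q.GS (S ∪ ps x1)) (a : Q.AU (S ∪ ps x1)) (z : E) :
    g (Q.el x1.1 a.1 z) = Q.el x1.1 (Q.gA _ ⟨g, hg⟩ a).1 (g z) := by
  have hv : g x1.1 = x1.1 := hg.2.2 _ (Or.inr (Or.inl rfl))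
  have e1 : Q.b x1.1 (g z) = Q.b x1.1 z := by conv_lhs => rw [← hv, hg.1]
  have e2 : Q.b (Q.gA _ ⟨g, hg⟩ a).1.m (g z) = Q.b a.1.m z := hg.1 _ _
  simp only [Geo.el_apply, map_add, map_sub, map_smul, hv, e1, e2]
  rfl

theorem Geo.zt_g (t : Kˣ) {g : E ≃ₗ[K] E} (hg : g ∈ Q.GS (S ∪ ps x1)) (z : E) : g (Q.zt hx1 t z) = Q.zt hx1 t (g z) := by
  have hv : g x1.1 = x1.1 := hg.2.2 _ (Or.inr (Or.inl rfl))
  have hf : g x1.2 = x1.2 := hg.2.2 _ (Or.inr (Or.inr rfl))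
  have e1 : Q.b x1.1 (g z) = Q.b x1.1 z := by conv_lhs => rw [← hv, hg.1]
  have e2 : Q.b x1.2 (g z) = Q.b x1.2 z := by conv_lhs => rw [← hf, hg.1]
  simp only [Geo.zt_apply, map_add, map_smul, hv, hf, e1, e2]

theorem Geo.AU_v (a : Q.AU (S ∪ ps x1)) : Q.b x1.1 a.1.m = 0 := a.2 _ (Or.inr (Or.inl rfl))
theorem Geo.AU_f (a : Q.AU (S ∪ ps x1)) : Q.b x1.2 a.1.m = 0 := a.2 _ (Or.inr (Or.inr rfl))

theorem Geo.kap_mem (γ : Q.Gam (S ∪ ps x1)) : Q.eE hx1.2.2.1 γ.a.1 (Q.AU_v γ.a) * Q.zt hx1 γ.l.1 * γ.l.2.1 ∈ Q.GS S :=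
  mul_mem (mul_mem (Q.eE_mem _ _ _ hx1.1 (Q.perp_anti Set.subset_union_left γ.a.2)) (Q.zt_mem hx1 _)) (Q.GS_anti Set.subset_union_left γ.l.2.2)

def Geo.kap : Q.Gam (S ∪ ps x1) →* Q.GS S :=
  MonoidHom.mk' (fun γ => ⟨_, Q.kap_mem hx1 γ⟩) (fun γ γ' => by
    apply Subtype.ext
    ext z
    show Q.el x1.1 (γ.a + Q.actA _ γ.l γ'.a).1 (Q.zt hx1 (γ.l.1 * γ'.l.1) (γ.l.2.1 (γ'.l.2.1 z))) =
      Q.el x1.1 γ.a.1 (Q.zt hx1 γ.l.1 (γ.l.2.1 (Q.el x1.1 γ'.a.1 (Q.zt hx1 γ'.l.1 (γ'.l.2.1 z)))))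
    rw [Q.el_g γ.l.2.2, Q.zt_g hx1 _ γ.l.2.2, Q.zt_el hx1 _ _ (Q.AU_v _) (Q.AU_f _), ← Q.zt_mul hx1, ← Q.el_add hx1.2.2.1 (Q.AU_v _)]
    · rfl
    · exact Q.AU_v (Q.actA _ γ.l γ'.a))

theorem Geo.kap_apply (γ : Q.Gam (S ∪ ps x1)) (z : E) : (Q.kap hx1 γ).1 z = Q.el x1.1 γ.a.1 (Q.zt hx1 γ.l.1 (γ.l.2.1 z)) := rfl

theorem Geo.kap_v (γ : Q.Gam (S ∪ ps x1)) : (Q.kap hx1 γ).1 x1.1 = (γ.l.1 : K) • x1.1 := by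
  rw [Geo.kap_apply, γ.l.2.2.2.2 _ (Or.inr (Or.inl rfl)), Q.zt_v hx1, map_smul, Q.el_apply, hx1.2.2.1, Q.symm, Q.AU_v]
  simp

theorem Geo.kap_f (γ : Q.Gam (S ∪ ps x1)) : (Q.kap hx1 γ).1 x1.2 = ((γ.l.1⁻¹ : Kˣ) : K) • (x1.2 + γ.a.1.m + γ.a.1.c • x1.1) := by
  rw [Geo.kap_apply, γ.l.2.2.2.2 _ (Or.inr (Or.inr rfl)), Q.zt_f hx1, map_smul, Q.el_apply, hx1.2.2.2.2, Q.symm, Q.AU_f]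
  simp [add_assoc]

/-- the action on vectors orthogonal to `v` and `f` -/
theorem Geo.kap_z (γ : Q.Gam (S ∪ ps x1)) {z : E} (h1 : Q.b x1.1 z = 0) (h2 : Q.b x1.2 z = 0) :
    (Q.kap hx1 γ).1 z = γ.l.2.1 z - Q.b γ.a.1.m (γ.l.2.1 z) • x1.1 := by
  have hg := γ.l.2.2
  have hv : γ.l.2.1 x1.1 = x1.1 := hg.2.2 _ (Or.inr (Or.inl rfl))
  have hf : γ.l.2.1 x1.2 = x1.2 := hg.2.2 _ (Or.inr (Or.inr rfl))
  have e1 : Q.b x1.1 (γ.l.2.1 z) = 0 := by conv_lhs => rw [← hv, hg.1, h1]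
  have e2 : Q.b x1.2 (γ.l.2.1 z) = 0 := by conv_lhs => rw [← hf, hg.1, h2]
  rw [Geo.kap_apply, Q.zt_fix hx1 _ e1 e2, Q.el_apply, e1]
  simp

theorem Geo.kap_inj : Function.Injective (Q.kap hx1) := by
  obtain ⟨a1, a2, a3, a4, a5⟩ := id hx1
  have a6 : Q.b x1.2 x1.1 = 1 := by rw [Q.symm, a5]
  refine (injective_iff_map_eq_one _).2 fun γ h => ?_
  have h1 : ∀ z, (Q.kap hx1 γ).1 z = z := fun z => by rw [h]; rfl
  have ht : γ.l.1 = 1 := by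
    have := congrArg (Q.b x1.2) ((Q.kap_v hx1 γ).symm.trans (h1 x1.1))
    rw [map_smul, a6, smul_eq_mul, mul_one] at this
    exact Units.ext this
  have hf := (Q.kap_f hx1 γ).symm.trans (h1 x1.2)
  rw [ht, inv_one, Units.val_one, one_smul] at hf
  have hc : γ.a.1.c = 0 := by
    have := congrArg (Q.b x1.2) hf
    simpa [a4, a6, Q.AU_f] using this
  have hm : γ.a.1.m = 0 := by
    rw [hc] at hf
    simpa using hf
  have ha : γ.a = 0 := Subtype.ext (Geo.Aq.ext hm hc)
  have hg : γ.l.2 = 1 := by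
    apply Subtype.ext
    ext z
    have := h1 z
    rw [Geo.kap_apply, ha, ht, Q.zt_one hx1] at this
    exact (Q.el_zero _ _).symm.trans this
  exact SD.ext ha (Prod.ext ht hg)

theorem Geo.kap_lift (g : Q.GS (S ∪ {x1.1})) : ∃ γ, Q.kap hx1 γ = Subgroup.inclusion (Q.GS_anti Set.subset_union_left) g := by
  obtain ⟨a1, a2, a3, a4, a5⟩ := id hx1
  have a6 : Q.b x1.2 x1.1 = 1 := by rw [Q.symm, a5]
  have hv : g.1 x1.1 = x1.1 := g.2.2.2 _ (Or.inr rfl)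
  have e1 : Q.b x1.1 (g.1 x1.2) = 1 := by
    have := g.2.1 x1.1 x1.2
    rwa [hv, a5] at this
  have e2 : Q.b (g.1 x1.2) (g.1 x1.2) = 0 := by rw [g.2.1, a4]
  set w := g.1 x1.2 with hw
  have e3 : Q.b w x1.1 = 1 := by rw [Q.symm, e1]
  let c := Q.b x1.2 w
  have e4 : Q.b w x1.2 = c := Q.symm _ _
  have e5 : Q.b x1.2 w = c := rfl
  have hmem : w - x1.2 - c • x1.1 ∈ Q.perp (S ∪ ps x1) := by
    rintro s (hs | rfl | rfl)
    · have : Q.b s w = Q.b s x1.2 := by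
        conv_lhs => rw [← g.2.2.2 s (Or.inl hs), hw, g.2.1]
      simp only [map_sub, map_smul, this, a1 s hs]; simp
    · simp [e1, a3, a5]
    · simp [e5, a4, a6]
  let a : Q.Aq := ⟨w - x1.2 - c • x1.1, c, by
    simp only [map_sub, map_smul, LinearMap.sub_apply, LinearMap.smul_apply, smul_eq_mul, e1, e2, e3, e4, e5, a3, a4, a5, a6]; ring⟩
  have hav : Q.b x1.1 a.m = 0 := hmem _ (Or.inr (Or.inl rfl))
  have hE : Q.eE a3 a hav ∈ Q.GS (S ∪ {x1.1}) := Q.eE_mem a3 a hav (by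
    rintro s (hs | rfl)
    · exact a1 s hs
    · exact a3) (by
    rintro s (hs | rfl)
    · exact hmem s (Or.inl hs)
    · exact hav)
  have hEf : Q.eE a3 a hav x1.2 = w := by
    rw [Q.eE_apply, Q.el_apply, a5, Q.symm, hmem x1.2 (Or.inr (Or.inr rfl))]
    show x1.2 + (1 : K) • (w - x1.2 - c • x1.1 + c • x1.1) - (0 : K) • x1.1 = w
    module
  have hk := mul_mem (inv_mem hE) g.2
  refine ⟨⟨⟨a, hmem⟩, (1, ⟨(Q.eE a3 a hav)⁻¹ * g.1, hk.1, hk.2.1, ?_⟩)⟩, ?_⟩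
  · rintro s (hs | rfl | rfl)
    · exact hk.2.2 s (Or.inl hs)
    · exact hk.2.2 _ (Or.inr rfl)
    · show (Q.eE a3 a hav).symm (g.1 x1.2) = x1.2
      rw [LinearEquiv.symm_apply_eq, hEf]
  · apply Subtype.ext
    ext z
    rw [Q.kap_apply, Q.zt_one hx1]
    exact (Q.eE a3 a hav).apply_symm_apply (g.1 z)

noncomputable def Geo.lf (g : Q.GS (S ∪ {x1.1})) : Q.Gam (S ∪ ps x1) := (Q.kap_lift hx1 g).choose
theorem Geo.kap_lf (g : Q.GS (S ∪ {x1.1})) : Q.kap hx1 (Q.lf hx1 g) = Subgroup.inclusion (Q.GS_anti Set.subset_union_left) g :=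
  (Q.kap_lift hx1 g).choose_spec
noncomputable def Geo.lif : Q.GS (S ∪ {x1.1}) →* Q.Gam (S ∪ ps x1) :=
  MonoidHom.mk' (Q.lf hx1) (fun g g' => by
    apply Q.kap_inj hx1
    rw [map_mul, Q.kap_lf hx1, Q.kap_lf hx1, Q.kap_lf hx1, map_mul])
theorem Geo.kap_lif (g : Q.GS (S ∪ {x1.1})) : Q.kap hx1 (Q.lif hx1 g) = Subgroup.inclusion (Q.GS_anti Set.subset_union_left) g :=
  Q.kap_lf hx1 g
end kap

end P15

section P16
open Tup
/-! ### maps of permutation modules -/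
section pmap
variable {X X' X'' : Type}
noncomputable def mp (f : X → X') : (X →₀ ℤ) →+ (X' →₀ ℤ) := lin fun x => sg (f x)
theorem mp_single (f : X → X') (x : X) (n : ℤ) : mp f (Finsupp.single x n) = Finsupp.single (f x) n := by
  simp [mp]

theorem Zz_le {X0 : Set X} {B : AddSubgroup (X →₀ ℤ)} (h : ∀ x ∈ X0, ∀ n, Finsupp.single x n ∈ B) : Zz X0 ≤ B := by
  intro n hn
  rw [← Finsupp.sum_single n]
  refine sum_mem fun x hx => ?_
  by_cases hx0 : x ∈ X0
  · exact h x hx0 _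
  · exact absurd (hn x hx0) (Finsupp.mem_support_iff.1 hx)

theorem Zz_ext {B : Type} [AddCommGroup B] {X0 : Set X} (F F' : (X →₀ ℤ) →+ B)
    (h : ∀ x ∈ X0, ∀ n, F (Finsupp.single x n) = F' (Finsupp.single x n)) {n : X →₀ ℤ} (hn : n ∈ Zz X0) : F n = F' n :=
  Zz_le (B := F.eqLocus F') h hn

theorem mp_Zz {X0 : Set X} {X0' : Set X'} {f : X → X'} (h : ∀ x ∈ X0, f x ∈ X0') {n : X →₀ ℤ} (hn : n ∈ Zz X0) : mp f n ∈ Zz X0' :=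
  Zz_le (B := (Zz X0').comap (mp f)) (fun x hx n => by
    show mp f (Finsupp.single x n) ∈ Zz X0'
    rw [mp_single]
    exact single_Zz (h x hx) n) hn

theorem aug_mp (f : X → X') (n : X →₀ ℤ) : aug (mp f n) = aug n :=
  hom_ext_apply (aug.comp (mp f)) aug (fun x n => by
    show aug (mp f _) = _
    rw [mp_single, aug_single, aug_single]) n

theorem mp_Rz {X0 : Set X} {X0' : Set X'} {f : X → X'} (h : ∀ x ∈ X0, f x ∈ X0') {n : X →₀ ℤ} (hn : n ∈ Rz X0) : mp f n ∈ Rz X0' :=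
  ⟨mp_Zz h hn.1, by
    show aug _ = 0
    rw [aug_mp]; exact hn.2⟩

variable {G G' G'' : Type} [Group G] [Group G'] [Group G''] {aX : GAct (trivM G).G X} {X0 : Set X}
  {hX : ∀ g, ∀ x ∈ X0, aX.act g x ∈ X0} {aX' : GAct (trivM G').G X'} {X0' : Set X'} {hX' : ∀ g, ∀ x ∈ X0', aX'.act g x ∈ X0'}
  {aX'' : GAct (trivM G'').G X''} {X0'' : Set X''} {hX'' : ∀ g, ∀ x ∈ X0'', aX''.act g x ∈ X0''}

theorem mp_rho (u : G →* G') (f : X → X') (he : ∀ g, ∀ x ∈ X0, f (aX.act g x) = aX'.act (u g) (f x)) (g : G)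
    {n : X →₀ ℤ} (hn : n ∈ Zz X0) : mp f ((labM (A := trivM G) aX).ρ g n) = (labM (A := trivM G') aX').ρ (u g) (mp f n) :=
  Zz_ext ((mp f).comp ((labM (A := trivM G) aX).ρ g)) (((labM (A := trivM G') aX').ρ (u g)).comp (mp f)) (fun x hx n => by
    show mp f ((labM (A := trivM G) aX).ρ g _) = (labM (A := trivM G') aX').ρ (u g) (mp f _)
    rw [mp_single, lin_single, lin_single]
    show mp f (Finsupp.single _ _) = Finsupp.single _ _
    rw [mp_single, he g x hx]) hn

variable (hX hX') in
noncomputable def Zmap (u : G →* G') (f : X → X') (hf : ∀ x ∈ X0, f x ∈ X0')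
    (he : ∀ g, ∀ x ∈ X0, f (aX.act g x) = aX'.act (u g) (f x)) : GHom (Zm aX X0 hX) (Zm aX' X0' hX') where
  f := u
  φ := ((mp f).comp (Zz X0).subtype).codRestrict (Zz X0') fun n => mp_Zz hf n.2
  h g m := Subtype.ext (mp_rho u f he g m.2)

variable (hX hX') in
noncomputable def Rmap (u : G →* G') (f : X → X') (hf : ∀ x ∈ X0, f x ∈ X0')
    (he : ∀ g, ∀ x ∈ X0, f (aX.act g x) = aX'.act (u g) (f x)) : GHom (Rm aX X0 hX) (Rm aX' X0' hX') where
  f := u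
  φ := ((mp f).comp (Rz X0).subtype).codRestrict (Rz X0') fun n => mp_Rz hf n.2
  h g m := Subtype.ext (mp_rho u f he g m.2.1)

theorem Rmap_comp (u : G →* G') (f : X → X') (hf : ∀ x ∈ X0, f x ∈ X0')
    (he : ∀ g, ∀ x ∈ X0, f (aX.act g x) = aX'.act (u g) (f x))
    (u' : G' →* G'') (f' : X' → X'') (hf' : ∀ x ∈ X0', f' x ∈ X0'')
    (he' : ∀ g, ∀ x ∈ X0', f' (aX'.act g x) = aX''.act (u' g) (f' x))
    (u'' : G →* G'') (f'' : X → X'') (hf'' : ∀ x ∈ X0, f'' x ∈ X0'')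
    (he'' : ∀ g, ∀ x ∈ X0, f'' (aX.act g x) = aX''.act (u'' g) (f'' x))
    (hu : ∀ g, u' (u g) = u'' g) (hff : ∀ x ∈ X0, f' (f x) = f'' x) :
    (Rmap hX' hX'' u' f' hf' he').comp (Rmap hX hX' u f hf he) = Rmap hX hX'' u'' f'' hf'' he'' :=
  GHom.ext' hu (fun n => Subtype.ext (Zz_ext ((mp f').comp (mp f)) (mp f'') (fun x hx n => by
    show mp f' (mp f _) = _
    rw [mp_single, mp_single, mp_single, hff x hx]) n.2.1))

theorem RZ_map (u : G →* G') (f : X → X') (hf : ∀ x ∈ X0, f x ∈ X0')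
    (he : ∀ g, ∀ x ∈ X0, f (aX.act g x) = aX'.act (u g) (f x)) :
    (RZ aX' X0' hX').comp (Rmap hX hX' u f hf he) = (Zmap hX hX' u f hf he).comp (RZ aX X0 hX) := rfl

theorem Zt_map (u : G →* G') (f : X → X') (hf : ∀ x ∈ X0, f x ∈ X0')
    (he : ∀ g, ∀ x ∈ X0, f (aX.act g x) = aX'.act (u g) (f x)) :
    (Zt aX' X0' hX').comp (Zmap hX hX' u f hf he) = (trivH u).comp (Zt aX X0 hX) :=
  GHom.ext' (fun _ => rfl) (fun n => aug_mp f n.1)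

theorem Zmap_Zp {G1 G2 : Type} [Group G1] [Group G2] (u : G →* G') (f : X → X') (hf : ∀ x ∈ X0, f x ∈ X0')
    (he : ∀ g, ∀ x ∈ X0, f (aX.act g x) = aX'.act (u g) (f x)) (j : G1 →* G) (x : X) (hx : x ∈ X0) (hj : ∀ g, aX.act (j g) x = x)
    (j' : G2 →* G') (x' : X') (hx' : x' ∈ X0') (hj' : ∀ g, aX'.act (j' g) x' = x') (v : G1 →* G2) (hv : ∀ g, u (j g) = j' (v g)) (hxx : f x = x') :
    (Zmap hX hX' u f hf he).comp (Zp aX X0 hX j x hx hj) = (Zp aX' X0' hX' j' x' hx' hj').comp (trivH v) :=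
  GHom.ext' hv (fun n => Subtype.ext (by
    show mp f (Finsupp.single x n) = Finsupp.single x' n
    rw [mp_single, hxx]))
end pmap

section fin
variable {K E : Type} [Field K] [AddCommGroup E] [Module K E] [FiniteDimensional K E] (Q : Geo K E)
variable {S : Set E} {x1 : E × E} (hx1 : x1 ∈ Q.W0 S)

theorem Geo.Rinc_eq {S S' : Set E} (h : S ⊆ S') : Q.Rinc h =
    Rmap (G := Q.GS S') (G' := Q.GS S) (aX := aPk (Q.GS S').subtype) (aX' := aPk (Q.GS S).subtype) (Q.hXg S') (Q.hXg S)
      (Subgroup.inclusion (Q.GS_anti h)) (fun x => x) (fun x hx => Q.W0_anti h hx) (fun g x hx => rfl) :=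
  GHom.ext' (fun _ => rfl) (fun n => Subtype.ext (Zz_ext (AddMonoidHom.id _) (mp _) (fun x hx n => by
    rw [mp_single]; rfl) n.2.1))

def Geo.aG : GAct (trivM (Q.Gam (S ∪ ps x1))).G (E × E) := aPk ((Q.GS S).subtype.comp (Q.kap hx1))

theorem Geo.aG_act (γ : Q.Gam (S ∪ ps x1)) (x : E × E) : (Q.aG hx1).act γ x = pr (Q.kap hx1 γ).1 x := rfl

theorem Geo.kap_perp (γ : Q.Gam (S ∪ ps x1)) {z : E} (hz : z ∈ Q.perp (S ∪ {x1.1})) : (Q.kap hx1 γ).1 z ∈ Q.perp (S ∪ {x1.1}) := by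
  rintro s (hs | rfl)
  · exact Q.GS_perp (Q.kap hx1 γ).2 (Q.perp_anti Set.subset_union_left hz) s hs
  · have h := (Q.kap hx1 γ).2.1 x1.1 z
    rw [Q.kap_v hx1, map_smul, LinearMap.smul_apply, hz _ (Or.inr rfl)] at h
    exact (smul_eq_zero.1 h).resolve_left γ.l.1.ne_zero

theorem Geo.hXG (γ : Q.Gam (S ∪ ps x1)) (x : E × E) (hx : x ∈ Q.W0 (S ∪ {x1.1})) : (Q.aG hx1).act γ x ∈ Q.W0 (S ∪ {x1.1}) := by
  have hi := (Q.kap hx1 γ).2.1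
  refine ⟨Q.kap_perp hx1 γ hx.1, Q.kap_perp hx1 γ hx.2.1, ?_⟩
  show Q.b ((Q.kap hx1 γ).1 x.1) ((Q.kap hx1 γ).1 x.1) = 0 ∧ Q.b ((Q.kap hx1 γ).1 x.2) ((Q.kap hx1 γ).1 x.2) = 0 ∧
    Q.b ((Q.kap hx1 γ).1 x.1) ((Q.kap hx1 γ).1 x.2) = 1
  rw [hi, hi, hi]
  exact hx.2.2

/-- projecting along `v` -/
def Geo.P0 (x1 : E × E) (z : E) : E := z - Q.b x1.2 z • x1.1
def Geo.PP (x1 x : E × E) : E × E := (Q.P0 x1 x.1, Q.P0 x1 x.2)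

include hx1 in
theorem Geo.P0_perp {z : E} (hz : z ∈ Q.perp (S ∪ {x1.1})) : Q.P0 x1 z ∈ Q.perp (S ∪ ps x1) := by
  obtain ⟨a1, a2, a3, a4, a5⟩ := id hx1
  have a6 : Q.b x1.2 x1.1 = 1 := by rw [Q.symm, a5]
  rintro s (hs | rfl | rfl)
  · simp [Geo.P0, hz s (Or.inl hs), a1 s hs]
  · simp [Geo.P0, hz _ (Or.inr rfl), a3]
  · simp [Geo.P0, a6]

include hx1 in
theorem Geo.P0_b {z z' : E} (hz : z ∈ Q.perp (S ∪ {x1.1})) (hz' : z' ∈ Q.perp (S ∪ {x1.1})) : Q.b (Q.P0 x1 z) (Q.P0 x1 z') = Q.b z z' := by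
  obtain ⟨a1, a2, a3, a4, a5⟩ := id hx1
  have h1 : Q.b x1.1 z' = 0 := hz' _ (Or.inr rfl)
  have h2 : Q.b z x1.1 = 0 := by rw [Q.symm]; exact hz _ (Or.inr rfl)
  simp [Geo.P0, h1, h2, a3]

include hx1 in
theorem Geo.PP_W0 {x : E × E} (hx : x ∈ Q.W0 (S ∪ {x1.1})) : Q.PP x1 x ∈ Q.W0 (S ∪ ps x1) := by
  refine ⟨Q.P0_perp hx1 hx.1, Q.P0_perp hx1 hx.2.1, ?_⟩
  simp only [Geo.PP]
  rw [Q.P0_b hx1 hx.1 hx.1, Q.P0_b hx1 hx.2.1 hx.2.1, Q.P0_b hx1 hx.1 hx.2.1]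
  exact hx.2.2

theorem Geo.P0_fix {z : E} (h : z ∈ Q.perp (S ∪ ps x1)) : Q.P0 x1 z = z := by
  simp [Geo.P0, h _ (Or.inr (Or.inr rfl))]
theorem Geo.PP_fix {x : E × E} (h : x ∈ Q.W0 (S ∪ ps x1)) : Q.PP x1 x = x :=
  Prod.ext (Q.P0_fix h.1) (Q.P0_fix h.2.1)

theorem Geo.P0_kap (γ : Q.Gam (S ∪ ps x1)) {z : E} (hz : z ∈ Q.perp (S ∪ {x1.1})) :
    Q.P0 x1 ((Q.kap hx1 γ).1 z) = γ.l.2.1 (Q.P0 x1 z) := by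
  obtain ⟨a1, a2, a3, a4, a5⟩ := id hx1
  have a6 : Q.b x1.2 x1.1 = 1 := by rw [Q.symm, a5]
  have hp := Q.P0_perp hx1 hz
  have h1 := Q.kap_z hx1 γ (hp _ (Or.inr (Or.inl rfl))) (hp _ (Or.inr (Or.inr rfl)))
  have h2 : z = Q.P0 x1 z + Q.b x1.2 z • x1.1 := by simp [Geo.P0]
  have h3 := Q.GS_perp γ.l.2.2 hp _ (Or.inr (Or.inr rfl))
  have h4 : (Q.kap hx1 γ).1 z = (Q.kap hx1 γ).1 (Q.P0 x1 z) + Q.b x1.2 z • (Q.kap hx1 γ).1 x1.1 := by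
    conv_lhs => rw [h2]
    rw [map_add, map_smul]
  rw [h4, h1, Q.kap_v hx1]
  simp only [Geo.P0] at h3 ⊢
  simp only [map_add, map_sub, map_smul, h3, a6, smul_eq_mul] at h3 ⊢
  have h5 : (Q.b x1.2) (γ.l.2.1 z) = Q.b x1.2 z * (Q.b x1.2) (γ.l.2.1 x1.1) := by linear_combination h3
  rw [h5]
  module

theorem Geo.PP_kap (γ : Q.Gam (S ∪ ps x1)) {x : E × E} (hx : x ∈ Q.W0 (S ∪ {x1.1})) :
    Q.PP x1 ((Q.aG hx1).act γ x) = pr γ.l.2.1 (Q.PP x1 x) :=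
  Prod.ext (Q.P0_kap hx1 γ hx.1) (Q.P0_kap hx1 γ hx.2.1)

theorem Geo.W0_Uv : Q.W0 (S ∪ ps x1) ⊆ Q.W0 (S ∪ {x1.1}) :=
  Q.W0_anti (Set.union_subset_union_right _ (by rintro _ rfl; exact Or.inl rfl))

theorem Geo.kap_W0U (γ : Q.Gam (S ∪ ps x1)) {x : E × E} (hx : x ∈ Q.W0 (S ∪ ps x1)) (ha : γ.a = 0) :
    (Q.aG hx1).act γ x = pr γ.l.2.1 x := by
  rw [Q.aG_act]
  refine Prod.ext ?_ ?_
  · show (Q.kap hx1 γ).1 x.1 = _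
    rw [Q.kap_z hx1 γ (hx.1 _ (Or.inr (Or.inl rfl))) (hx.1 _ (Or.inr (Or.inr rfl))), ha]
    simp [Geo.Aq.zero_m, pr]
  · show (Q.kap hx1 γ).1 x.2 = _
    rw [Q.kap_z hx1 γ (hx.2.1 _ (Or.inr (Or.inl rfl))) (hx.2.1 _ (Or.inr (Or.inr rfl))), ha]
    simp [Geo.Aq.zero_m, pr]

theorem Geo.PP_equiv (γ : Q.Gam (S ∪ ps x1)) (x : E × E) (hx : x ∈ Q.W0 (S ∪ {x1.1})) :
    Q.PP x1 ((Q.aG hx1).act γ x) = (Q.aG hx1).act (scal (Q.actA _) 0 γ) (Q.PP x1 x) := by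
  rw [Q.PP_kap hx1 γ hx, Q.kap_W0U hx1 _ (Q.PP_W0 hx1 hx)]
  · rfl
  · exact zero_smul K γ.a

/-- the projection on permutation modules -/
noncomputable def Geo.dZ : GHom (Zm (Q.aG hx1) (Q.W0 (S ∪ {x1.1})) (Q.hXG hx1)) (Zm (Q.aG hx1) (Q.W0 (S ∪ {x1.1})) (Q.hXG hx1)) :=
  Zmap (Q.hXG hx1) (Q.hXG hx1) (scal (Q.actA _) 0) (Q.PP x1) (fun x hx => Q.W0_Uv (Q.PP_W0 hx1 hx)) (Q.PP_equiv hx1)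
noncomputable def Geo.dR : GHom (Rm (Q.aG hx1) (Q.W0 (S ∪ {x1.1})) (Q.hXG hx1)) (Rm (Q.aG hx1) (Q.W0 (S ∪ {x1.1})) (Q.hXG hx1)) :=
  Rmap (Q.hXG hx1) (Q.hXG hx1) (scal (Q.actA _) 0) (Q.PP x1) (fun x hx => Q.W0_Uv (Q.PP_W0 hx1 hx)) (Q.PP_equiv hx1)

theorem Geo.stab_mem {x : E × E} (hx : x ∈ Q.W0 (S ∪ ps x1)) (γ : Q.Gam (S ∪ ps x1)) (h : (Q.aG hx1).act γ x = x) :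
    ∃ γ', Q.Gj (U := S ∪ ps x1) (U' := S ∪ ps x ∪ ps x1) (Set.union_subset_union_left _ Set.subset_union_left) γ' = γ := by
  obtain ⟨a1, a2, a3, a4, a5⟩ := id hx1
  have a6 : Q.b x1.2 x1.1 = 1 := by rw [Q.symm, a5]
  have key : ∀ z ∈ Q.perp (S ∪ ps x1), (Q.kap hx1 γ).1 z = z → Q.b γ.a.1.m z = 0 ∧ γ.l.2.1 z = z := by
    intro z hz hk
    rw [Q.kap_z hx1 γ (hz _ (Or.inr (Or.inl rfl))) (hz _ (Or.inr (Or.inr rfl)))] at hk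
    have h3 := Q.GS_perp γ.l.2.2 hz _ (Or.inr (Or.inr rfl))
    have h4 := congrArg (Q.b x1.2) hk
    rw [map_sub, map_smul, h3, a6, hz _ (Or.inr (Or.inr rfl)), smul_eq_mul, mul_one, zero_sub, neg_eq_zero] at h4
    rw [h4, zero_smul, sub_zero] at hk
    rw [hk] at h4
    exact ⟨h4, hk⟩
  have k1 := key _ hx.1 (congrArg Prod.fst h)
  have k2 := key _ hx.2.1 (congrArg Prod.snd h)
  have hg : γ.l.2.1 ∈ Q.GS (S ∪ ps x ∪ ps x1) := by
    refine ⟨γ.l.2.2.1, γ.l.2.2.2.1, ?_⟩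
    rintro s ((hs | rfl | rfl) | hs)
    · exact γ.l.2.2.2.2 s (Or.inl hs)
    · exact k1.2
    · exact k2.2
    · exact γ.l.2.2.2.2 s (Or.inr hs)
  have ha : γ.a.1.m ∈ Q.perp (S ∪ ps x ∪ ps x1) := by
    rintro s ((hs | rfl | rfl) | hs)
    · exact γ.a.2 s (Or.inl hs)
    · rw [Q.symm]; exact k1.1
    · rw [Q.symm]; exact k2.1
    · exact γ.a.2 s (Or.inr hs)
  exact ⟨⟨⟨γ.a.1, ha⟩, (γ.l.1, ⟨γ.l.2.1, hg⟩)⟩, rfl⟩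

theorem Geo.orb_mem {x : E × E} (hx : x ∈ Q.W0 (S ∪ {x1.1})) : ∃ γ, (Q.aG hx1).act γ (Q.PP x1 x) = x := by
  have hp := Q.PP_W0 hx1 hx
  set r := Q.PP x1 x with hr
  obtain ⟨c1, c2, c3, c4, c5⟩ := id hp
  have c6 : Q.b r.2 r.1 = 1 := by rw [Q.symm, c5]
  let s1 := Q.b x1.2 x.1
  let s2 := Q.b x1.2 x.2
  let a : Q.Aq := ⟨-(s1 • r.2) - s2 • r.1, -(s1 * s2), by
    simp [c3, c4, c5, c6]; ring⟩
  refine ⟨⟨⟨a, sub_mem (neg_mem (Submodule.smul_mem _ _ c2)) (Submodule.smul_mem _ _ c1)⟩, 1⟩, ?_⟩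
  rw [Q.aG_act]
  refine Prod.ext ?_ ?_
  · show (Q.kap hx1 _).1 r.1 = x.1
    rw [Q.kap_z hx1 _ (c1 _ (Or.inr (Or.inl rfl))) (c1 _ (Or.inr (Or.inr rfl)))]
    show r.1 - Q.b (-(s1 • r.2) - s2 • r.1) r.1 • x1.1 = x.1
    simp only [map_sub, map_neg, map_smul, LinearMap.sub_apply, LinearMap.neg_apply, LinearMap.smul_apply, c6, c3]
    show x.1 - s1 • x1.1 - _ = x.1
    simp
  · show (Q.kap hx1 _).1 r.2 = x.2
    rw [Q.kap_z hx1 _ (c2 _ (Or.inr (Or.inl rfl))) (c2 _ (Or.inr (Or.inr rfl)))]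
    show r.2 - Q.b (-(s1 • r.2) - s2 • r.1) r.2 • x1.1 = x.2
    simp only [map_sub, map_neg, map_smul, LinearMap.sub_apply, LinearMap.neg_apply, LinearMap.smul_apply, c5, c4]
    show x.2 - s2 • x1.1 - _ = x.2
    simp

theorem Geo.dZ_id [Infinite K] {i : ℕ} (y : H (Zm (Q.aG hx1) (Q.W0 (S ∪ {x1.1})) (Q.hXG hx1)) i) : Hm (Q.dZ hx1) i y = y := by
  have hU : ∀ x : E × E, S ∪ ps x1 ⊆ S ∪ ps x ∪ ps x1 := fun x => Set.union_subset_union_left _ Set.subset_union_left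
  refine Zm_ind (Q.aG hx1) (Q.W0 (S ∪ {x1.1})) (Q.hXG hx1) (R := {x // x ∈ Q.W0 (S ∪ ps x1)})
    (fun x => Q.Gam (S ∪ ps x.1 ∪ ps x1)) (fun x => Q.Gj (hU x.1)) (fun x => x.1) (fun x => Q.W0_Uv x.2) (fun x γ γ' h => ?_)
    (fun x γ => ?_) (fun x γ h => Q.stab_mem hx1 x.2 γ h) (fun x hx => ?_) i ((Hm (Q.dZ hx1) i).eqLocus (AddMonoidHom.id _)) (fun x y => ?_) y
  · have h1 : (Q.Gj (hU x.1) γ).a.1 = (Q.Gj (hU x.1) γ').a.1 := by rw [h]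
    have h2 : (Q.Gj (hU x.1) γ).l.1 = (Q.Gj (hU x.1) γ').l.1 := by rw [h]
    have h3 : (Q.Gj (hU x.1) γ).l.2.1 = (Q.Gj (hU x.1) γ').l.2.1 := by rw [h]
    exact SD.ext (Subtype.ext h1) (Prod.ext h2 (Subtype.ext h3))
  · obtain ⟨x, hx⟩ := x
    have f1 : γ.l.2.1 x.1 = x.1 := γ.l.2.2.2.2 _ (Or.inl (Or.inr (Or.inl rfl)))
    have f2 : γ.l.2.1 x.2 = x.2 := γ.l.2.2.2.2 _ (Or.inl (Or.inr (Or.inr rfl)))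
    have g1 : Q.b γ.a.1.m x.1 = 0 := by rw [Q.symm]; exact γ.a.2 _ (Or.inl (Or.inr (Or.inl rfl)))
    have g2 : Q.b γ.a.1.m x.2 = 0 := by rw [Q.symm]; exact γ.a.2 _ (Or.inl (Or.inr (Or.inr rfl)))
    rw [Q.aG_act]
    refine Prod.ext ?_ ?_
    · show (Q.kap hx1 _).1 x.1 = x.1
      rw [Q.kap_z hx1 _ (hx.1 _ (Or.inr (Or.inl rfl))) (hx.1 _ (Or.inr (Or.inr rfl)))]
      show γ.l.2.1 x.1 - Q.b γ.a.1.m (γ.l.2.1 x.1) • x1.1 = x.1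
      rw [f1, g1]; simp
    · show (Q.kap hx1 _).1 x.2 = x.2
      rw [Q.kap_z hx1 _ (hx.2.1 _ (Or.inr (Or.inl rfl))) (hx.2.1 _ (Or.inr (Or.inr rfl)))]
      show γ.l.2.1 x.2 - Q.b γ.a.1.m (γ.l.2.1 x.2) • x1.1 = x.2
      rw [f2, g2]; simp
  · obtain ⟨γ, h⟩ := Q.orb_mem hx1 hx
    exact ⟨⟨_, Q.PP_W0 hx1 hx⟩, γ, h⟩
  · show Hm (Q.dZ hx1) i _ = Hm _ i y
    conv_rhs => rw [← Q.Gam_scal _ y]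
    rw [← Hm_comp, ← Hm_comp]
    congr 2
    exact Zmap_Zp _ _ _ _ _ _ _ _ _ _ _ _ _ (fun γ => SD.ext (by
      show (0 : K) • _ = Submodule.inclusion _ ((0 : K) • _)
      rw [zero_smul, zero_smul]; rfl) rfl) (Q.PP_fix x.2)

theorem Geo.dR_id [Infinite K] {i : ℕ} (hne : (Q.W0 (S ∪ {x1.1})).Nonempty)
    (y : H (Rm (Q.aG hx1) (Q.W0 (S ∪ {x1.1})) (Q.hXG hx1)) i) : Hm (Q.dR hx1) i y = y := by
  refine ses_square (RZ (Q.aG hx1) (Q.W0 (S ∪ {x1.1})) (Q.hXG hx1)) (Zt (Q.aG hx1) (Q.W0 (S ∪ {x1.1})) (Q.hXG hx1))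
    Function.bijective_id Function.bijective_id (RZ_inj _ _ _) (RZ_zero _ _ _) (RZ_exact _ _ _) (Zt_surj _ _ _ hne)
    (Q.dR hx1) (Q.dZ hx1) (trivH (scal (Q.actA _) 0)) (fun q c => ?_) (fun q c => ?_) (Q.dZ_id hx1) (Q.Gam_scal _) (fun y => ?_) y
  · rw [← mapC_comp, ← mapC_comp]; rfl
  · rw [← mapC_comp, ← mapC_comp]
    exact congrArg (fun F => mapC F c) (Zt_map _ _ _ _)
  · rw [← Hm_comp]
    congr 2
    refine Rmap_comp _ _ _ _ _ _ _ _ _ _ _ _ (fun γ => ?_) (fun x hx => Q.PP_fix (Q.PP_W0 hx1 hx))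
    refine SD.ext ?_ rfl
    show (0 : K) • ((0 : K) • γ.a) = (0 : K) • γ.a
    rw [zero_smul, zero_smul]

/-- the Levi factor -/
def Geo.aL (U : Set E) : GAct (trivM (Q.LL U)).G (E × E) := aPk ((Q.GS U).subtype.comp (MonoidHom.snd _ _))
theorem Geo.hXL (U : Set E) (l : Q.LL U) (x : E × E) (hx : x ∈ Q.W0 U) : (Q.aL U).act l x ∈ Q.W0 U := Q.GS_W0 l.2.2 hx

def Geo.prl (U : Set E) : Q.Gam U →* Q.LL U := MonoidHom.mk' (fun γ => γ.l) (fun _ _ => rfl)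
def Geo.inl (U : Set E) : Q.LL U →* Q.Gam U := MonoidHom.mk' (fun l => ⟨0, l⟩) (fun l l' => SD.ext (by
  show 0 = 0 + Q.actA U l 0
  simp) rfl)

theorem Geo.kap_inl (g : Q.GS (S ∪ ps x1)) : Q.kap hx1 (Q.inl _ (1, g)) = Subgroup.inclusion (Q.GS_anti Set.subset_union_left) g := by
  apply Subtype.ext
  ext z
  rw [Q.kap_apply]
  show Q.el x1.1 0 (Q.zt hx1 1 (g.1 z)) = g.1 z
  rw [Q.zt_one, Q.el_zero]

include hx1 in
theorem Geo.hP' [Infinite K] (i : ℕ) (hne : (Q.W0 (S ∪ {x1.1})).Nonempty)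
    (hv : ∀ j < i, Van (Q.Rg (S ∪ ps x1)) j) (y : H (Q.Rg (S ∪ {x1.1})) i) :
    Hm (Q.Rinc Set.subset_union_left) i y = 0 := by
  let J0 := Rmap (G := Q.GS (S ∪ {x1.1})) (G' := Q.Gam (S ∪ ps x1)) (aX := aPk (Q.GS (S ∪ {x1.1})).subtype) (aX' := Q.aG hx1)
    (Q.hXg (S ∪ {x1.1})) (Q.hXG hx1) (Q.lif hx1) (fun x => x) (fun x hx => hx) (fun g x hx => by
      rw [Q.aG_act, Q.kap_lif hx1]; rfl)
  let J := Rmap (G := Q.Gam (S ∪ ps x1)) (G' := Q.GS S) (aX := Q.aG hx1) (aX' := aPk (Q.GS S).subtype)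
    (Q.hXG hx1) (Q.hXg S) (Q.kap hx1) (fun x => x) (fun x hx => Q.W0_anti Set.subset_union_left hx) (fun g x hx => rfl)
  let pj := Rmap (G := Q.Gam (S ∪ ps x1)) (G' := Q.LL (S ∪ ps x1)) (aX := Q.aG hx1) (aX' := Q.aL (S ∪ ps x1))
    (Q.hXG hx1) (Q.hXL _) (Q.prl _) (Q.PP x1) (fun x hx => Q.PP_W0 hx1 hx) (fun γ x hx => Q.PP_kap hx1 γ hx)
  let ic := Rmap (G := Q.LL (S ∪ ps x1)) (G' := Q.Gam (S ∪ ps x1)) (aX := Q.aL (S ∪ ps x1)) (aX' := Q.aG hx1)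
    (Q.hXL _) (Q.hXG hx1) (Q.inl _) (fun x => x) (fun x hx => Q.W0_Uv hx) (fun l x hx => (Q.kap_W0U hx1 (Q.inl _ l) hx rfl).symm)
  let F : GHom (Q.Rg (S ∪ ps x1)) (Rm (Q.aL (S ∪ ps x1)) (Q.W0 (S ∪ ps x1)) (Q.hXL _)) :=
    Rmap (G := Q.GS (S ∪ ps x1)) (G' := Q.LL (S ∪ ps x1)) (aX := aPk (Q.GS (S ∪ ps x1)).subtype) (aX' := Q.aL (S ∪ ps x1))
    (Q.hXg _) (Q.hXL _) (MonoidHom.inr _ _) (fun x => x) (fun x hx => hx) (fun l x hx => rfl)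
  have e1 : J.comp J0 = Q.Rinc Set.subset_union_left := by
    rw [Q.Rinc_eq]
    exact Rmap_comp _ _ _ _ _ _ _ _ _ _ _ _ (fun g => Q.kap_lif hx1 g) (fun x hx => rfl)
  have e2 : ic.comp pj = Q.dR hx1 := by
    refine Rmap_comp _ _ _ _ _ _ _ _ _ _ _ _ (fun γ => SD.ext ?_ rfl) (fun x hx => rfl)
    show 0 = (0 : K) • γ.a
    rw [zero_smul]
  have e3 : (J.comp ic).comp F = Q.Rinc Set.subset_union_left := by
    rw [Q.Rinc_eq]
    have : J.comp ic = Rmap (Q.hXL _) (Q.hXg S) ((Q.kap hx1).comp (Q.inl _)) (fun x => x)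
        (fun x hx => Q.W0_anti Set.subset_union_left hx) (fun l x hx => (Q.kap_W0U hx1 (Q.inl _ l) hx rfl).symm) :=
      Rmap_comp _ _ _ _ _ _ _ _ _ _ _ _ (fun g => rfl) (fun x hx => rfl)
    rw [this]
    exact Rmap_comp _ _ _ _ _ _ _ _ _ _ _ _ (fun g => Q.kap_inl hx1 g) (fun x hx => rfl)
  have hF : Function.Surjective (Hm F i) := by
    let a : GAct (Rm (Q.aL (S ∪ ps x1)) (Q.W0 (S ∪ ps x1)) (Q.hXL _)).G Kˣ :=
      ⟨fun l x => l.1 * x, fun x => one_mul x, fun l l' x => mul_assoc _ _ _⟩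
    have hid : ∀ n : Rz (Q.W0 (S ∪ ps x1)), (F.φ n : Rz (Q.W0 (S ∪ ps x1))) = n := fun n =>
      Subtype.ext (Zz_ext (mp _) (AddMonoidHom.id _) (fun x hx n => by rw [mp_single]; rfl) n.2.1)
    refine F5 a F (fun g g' h => congrArg Prod.snd h) ⟨fun n n' h => ?_, fun n => ⟨n, hid n⟩⟩ (fun x l => ?_) i hv
    · exact ((hid n).symm.trans h).trans (hid n')
    · constructor
      · intro h
        have h1 : l.1 = 1 := mul_eq_right.1 h
        exact ⟨l.2, Prod.ext h1.symm rfl⟩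
      · rintro ⟨g, rfl⟩
        exact one_mul x
  rw [← e1, Hm_comp, ← Q.dR_id hx1 hne (Hm J0 i y), ← e2, Hm_comp]
  obtain ⟨u, hu⟩ := hF (Hm pj i (Hm J0 i y))
  rw [← hu, ← Hm_comp, ← Hm_comp, e3]
  exact Q.kill_inf hx1 i u

theorem Geo.main_inf [Infinite K] (i : ℕ) (S : Set E) (hS : Q.Wi S (i + 2)) : Van (Q.Rg S) i := by
  refine Q.main_inf' (fun i S v hv hS hV y => ?_) i S hS
  obtain ⟨m, hm, h⟩ := hv.2.2
  obtain ⟨a, c, hx⟩ := Q.complete hv.1 hv.2.1 hm h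
  refine Q.hP' hx i ?_ (fun j hj => hV _ hx j hj) y
  obtain ⟨x, hx'⟩ := Q.w1 (Q.ps_drop hx (Q.Wi_mono (by omega : 2 ≤ i + 2) hS))
  exact ⟨x, Q.W0_Uv hx'⟩
end fin

end P16

section P17
open Tup
/-! ### the stability statement for the abstract groups -/
section stab
variable {K E : Type} [Field K] [AddCommGroup E] [Module K E] [FiniteDimensional K E] (Q : Geo K E)

theorem Geo.trans {S : Set E} (hS : Q.Wi S 3) {x x' : E × E} (hx : x ∈ Q.W0 S) (hx' : x' ∈ Q.W0 S) :
    ∃ g ∈ Q.GS S, pr g x = x' := by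
  classical
  let P : E × E → Prop := fun y => ∃ g ∈ Q.GS S, pr g x = y
  have hedge1 : ∀ y y', y ∈ Q.W0 S → y' ∈ Q.W0 S → Q.rP y y' → P y → P y' := by
    rintro y y' hy hy' (rfl | h) hP
    · exact hP
    · obtain ⟨g, hg, rfl⟩ := hP
      have hy2 : y' ∈ Q.W0 (S ∪ ps (pr g x)) := by
        simp only [Geo.Tr, ps, Set.mem_insert_iff, Set.mem_singleton_iff, forall_eq_or_imp, forall_eq] at h
        obtain ⟨⟨a1, a2⟩, a3, a4⟩ := h
        refine ⟨Q.perp_union.2 ⟨hy'.1, fun s hs => ?_⟩, Q.perp_union.2 ⟨hy'.2.1, fun s hs => ?_⟩, hy'.2.2⟩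
        · rcases hs with rfl | rfl <;> first | assumption | (rw [Q.symm]; assumption)
        · rcases hs with rfl | rfl <;> first | assumption | (rw [Q.symm]; assumption)
      obtain ⟨s, hs, h1, -⟩ := Q.swap hy hy2
      exact ⟨s * g, mul_mem hs hg, by rw [pr_mul, h1]⟩
  let χ : E × E → ℤ := fun y => if P y then 1 else 0
  let F : (Tup (E × E) 1 →₀ ℤ) →+ ℤ := lin fun w => match w with
    | tc y _ => AddMonoidHom.mulRight (χ y)
  have hF : ∀ y n, F (Finsupp.single (tc y tn) n) = n * χ y := fun y n => by
    simp only [F, lin_single]; rfl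
  have hb : ∀ b ∈ wc (JA Q.rP (Q.W0 S)) 2, F (wd b) = 0 := by
    intro b hb
    refine inn_ind (F.comp wd) ⊥ (fun w n hn => ?_) hb
    obtain ⟨y, w, rfl⟩ := tup_succ w
    obtain ⟨y', w, rfl⟩ := tup_succ w
    obtain rfl := tup_zero w
    show F (wd (Finsupp.single _ n)) = 0
    by_cases hc : Cl Q.rP (Q.W0 S) (ent (tc y (tc y' tn)))
    · have hy : y ∈ ent (tc y (tc y' tn)) := Or.inl rfl
      have hy' : y' ∈ ent (tc y (tc y' tn)) := Or.inr (Or.inl rfl)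
      have e : P y ↔ P y' := ⟨hedge1 _ _ (hc.1 hy) (hc.1 hy') (hc.2 _ hy _ hy'), hedge1 _ _ (hc.1 hy') (hc.1 hy) (hc.2 _ hy' _ hy)⟩
      have e' : χ y = χ y' := by simp only [χ, e]
      rw [← consL_single, ← consL_single, wd_cons, wd_zero, consL_single, map_sub, consL_single, hF, hF, e', sub_self]
    · rw [hn hc, Finsupp.single_zero, map_zero, map_zero]
  obtain ⟨b, hbm, hbe⟩ := Q.W_acyclic 1 S hS (Finsupp.single (tc x tn) 1 - Finsupp.single (tc x' tn) 1) (by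
    refine sub_mem (single_inn (gate_pos ⟨?_, ?_⟩)) (single_inn (gate_pos ⟨?_, ?_⟩)) <;> simp [ent, hx, hx', Geo.rP_refl]) (by
    show wd _ = 0
    rw [map_sub, ← consL_single, ← consL_single, wd_zero, wd_zero, sub_self])
  have h1 := hb b hbm
  rw [hbe, map_sub, hF, hF] at h1
  have h2 : χ x = 1 := if_pos ⟨1, one_mem _, rfl⟩
  by_contra h3
  have h4 : χ x' = 0 := if_neg h3
  rw [h2, h4] at h1
  norm_num at h1

theorem Zp_inj {G X G' : Type} [Group G] [Group G'] (aX : GAct (trivM G).G X) (X0 : Set X)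
    (hX : ∀ g, ∀ x ∈ X0, aX.act g x ∈ X0) (j : G' →* G) (x : X) (hx : x ∈ X0) (hj : ∀ g, aX.act (j g) x = x)
    (hinj : Function.Injective j) (hst : ∀ g, aX.act g x = x → ∃ b, j b = g) (htr : ∀ y ∈ X0, ∃ g, aX.act g x = y) (i : ℕ) :
    Function.Injective (Hm (Zp aX X0 hX j x hx hj) i) := by
  classical
  let aW : GAct (trivM G).G X0 := ⟨fun g y => ⟨aX.act g y.1, hX g _ y.2⟩, fun y => Subtype.ext (aX.one _), fun g h y => Subtype.ext (aX.mul g h _)⟩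
  let f : X → X0 := fun y => if h : y ∈ X0 then ⟨y, h⟩ else ⟨x, hx⟩
  have hf : ∀ y (h : y ∈ X0), f y = ⟨y, h⟩ := fun y h => dif_pos h
  let T : GHom (Zm aX X0 hX) (labM (A := trivM G) aW) :=
    { f := MonoidHom.id _
      φ := (mp f).comp (Zz X0).subtype
      h := fun g m => mp_rho (MonoidHom.id G) f (fun g y hy => by
        rw [hf y hy, hf _ (hX g y hy)]; rfl) g m.2 }
  let F : GHom (trivM G') (labM (A := trivM G) aW) := labIn (A := trivM G) aW (trivH j) ⟨x, hx⟩ (fun g => Subtype.ext (hj g))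
  have e : T.comp (Zp aX X0 hX j x hx hj) = F := GHom.ext' (fun _ => rfl) (fun n => by
    show mp f (Finsupp.single x n) = Finsupp.single _ n
    rw [mp_single, hf x hx])
  have hi : Function.Injective (Hm F i) := by
    refine shapiro_inj (labGrad (A := trivM G) aW) F ⟨x, hx⟩ hinj ?_ ?_ ?_ ?_ ?_ ?_ i
    · exact fun n n' h => Finsupp.single_injective _ h
    · exact fun g => Subtype.ext (hj g)
    · intro g h
      exact hst g (congrArg Subtype.val h)
    · intro m
      refine ⟨m ⟨x, hx⟩, ?_⟩
      refine hom_ext_apply ((sg (⟨x, hx⟩ : X0)).comp (Finsupp.applyAddHom (⟨x, hx⟩ : X0)))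
        ((Finsupp.applyAddHom (⟨x, hx⟩ : X0)).comp (labGrad (A := trivM G) aW).γ) (fun y n => ?_) m
      simp only [AddMonoidHom.comp_apply, labGrad, lin_single, Finsupp.applyAddHom_apply, sg_apply]
      by_cases h : y = ⟨x, hx⟩
      · subst h; simp
      · rw [Finsupp.single_eq_of_ne (Ne.symm h), Finsupp.single_eq_of_ne (Ne.symm h), Finsupp.single_zero]
    · intro n
      show lin _ (Finsupp.single _ n) = Finsupp.single _ (Finsupp.single _ n)
      rw [lin_single]; rfl
    · intro y
      obtain ⟨g, hg⟩ := htr y.1 y.2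
      exact ⟨g, Subtype.ext hg⟩
  intro y y' h
  apply hi
  rw [← e, Hm_comp, Hm_comp, h]

theorem Geo.stable (h3 : Q.Wi ∅ 3) {G' : Type} [Group G'] (j : G' →* Q.GS ∅) (x : E × E) (hx : x ∈ Q.W0 ∅) (hinj : Function.Injective j)
    (hj : ∀ g, pr (j g).1 x = x) (hst : ∀ g : Q.GS ∅, pr g.1 x = x → ∃ b, j b = g) (i : ℕ) (hv : Van (Q.Rg ∅) i) :
    Function.Surjective (Hm (trivH j) (i + 1)) ∧ Function.Injective (Hm (trivH j) i) := by
  have htr : ∀ y ∈ Q.W0 ∅, ∃ g : Q.GS ∅, (aPk (Q.GS ∅).subtype).act g x = y := fun y hy => by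
    obtain ⟨g, hg, h⟩ := Q.trans h3 hx hy
    exact ⟨⟨g, hg⟩, h⟩
  constructor
  · intro y
    exact triv_ind (G := Q.GS ∅) (aPk (Q.GS ∅).subtype) (Q.W0 ∅) (Q.hXg ∅) (R := Unit) (fun _ => G') (fun _ => j) (fun _ => x) (fun _ => hx) (fun _ => hinj)
      (fun _ => hj) (fun _ => hst) (fun y hy => ⟨(), htr y hy⟩) (i + 1) ⟨x, hx⟩ (fun q hq => by
        obtain rfl : q = i := by omega
        exact hv) (Hm (trivH j) (i + 1)).range (fun _ y => ⟨y, rfl⟩) y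
  · have h1 := Zp_inj (G := Q.GS ∅) (aPk (Q.GS ∅).subtype) (Q.W0 ∅) (Q.hXg ∅) j x hx hj hinj hst htr i
    have h2 := ses_inj (RZ (G := Q.GS ∅) (aPk (Q.GS ∅).subtype) (Q.W0 ∅) (Q.hXg ∅)) (Zt (G := Q.GS ∅) (aPk (Q.GS ∅).subtype) (Q.W0 ∅) (Q.hXg ∅)) Function.bijective_id Function.bijective_id
        (RZ_inj _ _ _) (RZ_exact _ _ _) (Zt_surj _ _ _ ⟨x, hx⟩) hv
    have e : (Zt (G := Q.GS ∅) (aPk (Q.GS ∅).subtype) (Q.W0 ∅) (Q.hXg ∅)).comp (Zp (G := Q.GS ∅) (aPk (Q.GS ∅).subtype) (Q.W0 ∅) (Q.hXg ∅) j x hx hj) = trivH j :=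
      GHom.ext' (fun _ => rfl) (fun n => aug_single x n)
    intro y y' h
    rw [← e, Hm_comp, Hm_comp] at h
    exact h1 (h2 h)
end stab

end P17

section P18
open Tup
open Matrix
/-! ### comparison with the bar complex of the statement -/
section bridge
variable {G G' : Type} [Group G] [Group G']

def tf {X : Type} : ∀ {q : ℕ}, Tup X q → Fin q → X
  | _, tn => Fin.elim0
  | _, tc k g => Fin.cons k (tf g)
def ft {X : Type} : ∀ (q : ℕ), (Fin q → X) → Tup X q
  | 0, _ => tn
  | q + 1, c => tc (c 0) (ft q (Fin.tail c))

theorem tf_ft {X : Type} : ∀ (q : ℕ) (c : Fin q → X), tf (ft q c) = c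
  | 0, c => funext fun i => i.elim0
  | q + 1, c => by
    show Fin.cons (c 0) (tf (ft q (Fin.tail c))) = c
    rw [tf_ft q]; exact Fin.cons_self_tail c
theorem ft_tf {X : Type} {q : ℕ} (g : Tup X q) : ft q (tf g) = g := by
  induction g with
  | tn => rfl
  | tc k g ih =>
    show tc _ _ = _
    simp [tf, ih]

theorem tf_tmap {X Y : Type} (f : X → Y) {q : ℕ} (g : Tup X q) : tf (tmap f g) = f ∘ tf g := by
  induction g with
  | tn => exact funext fun i => i.elim0
  | tc k g ih =>
    show Fin.cons (f k) (tf (tmap f g)) = f ∘ (Fin.cons k (tf g) : Fin _ → X)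
    rw [ih]
    funext i
    refine Fin.cases ?_ (fun i => ?_) i <;> simp

def cF {X : Type} (q : ℕ) (k : X) (f : Fin q → X) : Fin (q + 1) → X := Fin.cons k f

/-- the part of the bar differential omitting the first face -/
noncomputable def bT (q : ℕ) (c : Fin (q + 1) → G) : (Fin q → G) →₀ ℤ :=
  ∑ i : Fin q, Finsupp.single
          (fun j : Fin q => if (j : ℕ) < (i : ℕ) then c (Fin.castSucc j)
            else if (j : ℕ) = (i : ℕ) then c (Fin.castSucc i) * c i.succ
            else c j.succ) ((-1 : ℤ) ^ ((i : ℕ) + 1))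
      + Finsupp.single (fun j : Fin q => c (Fin.castSucc j)) ((-1 : ℤ) ^ (q + 1))

theorem barDiff_single (q : ℕ) (c : Fin (q + 1) → G) (m : ℤ) :
    barDiff ℤ G q (Finsupp.single c m) = m • (Finsupp.single (Fin.tail c) 1 + bT q c) := by
  simp only [barDiff, Finsupp.lift_apply, Finsupp.sum_single_index, zero_smul, bT, add_assoc]
  rfl

theorem bT_cons (q : ℕ) (k : G) (c : Fin (q + 1) → G) :
    bT (q + 1) (Fin.cons k c) = - Finsupp.single (Fin.cons (k * c 0) (Fin.tail c)) 1 - mp (cF q k) (bT q c) := by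
  have hl : ∀ (f : (Fin q → G)) (m : ℤ), mp (cF q k) (Finsupp.single f m) = Finsupp.single (Fin.cons k f) m :=
    fun f m => mp_single _ _ _
  rw [bT, Fin.sum_univ_succ, bT, map_add, map_sum]
  simp only [hl]
  have e1 : (fun j : Fin (q + 1) => if (j : ℕ) < ((0 : Fin (q + 1)) : ℕ) then (Fin.cons k c : Fin (q + 2) → G) (Fin.castSucc j)
            else if (j : ℕ) = ((0 : Fin (q + 1)) : ℕ) then (Fin.cons k c : Fin (q + 2) → G) (Fin.castSucc 0) * (Fin.cons k c : Fin (q + 2) → G) (Fin.succ 0)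
            else (Fin.cons k c : Fin (q + 2) → G) j.succ) = Fin.cons (k * c 0) (Fin.tail c) := by
    funext j
    refine Fin.cases ?_ (fun j => ?_) j
    · simp
    · simp [Fin.tail]
  have e2 : ∀ i : Fin q, (fun j : Fin (q + 1) => if (j : ℕ) < (i.succ : ℕ) then (Fin.cons k c : Fin (q + 2) → G) (Fin.castSucc j)
            else if (j : ℕ) = (i.succ : ℕ) then (Fin.cons k c : Fin (q + 2) → G) (Fin.castSucc i.succ) * (Fin.cons k c : Fin (q + 2) → G) (Fin.succ i.succ)
            else (Fin.cons k c : Fin (q + 2) → G) j.succ) =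
        Fin.cons k (fun j : Fin q => if (j : ℕ) < (i : ℕ) then c (Fin.castSucc j)
            else if (j : ℕ) = (i : ℕ) then c (Fin.castSucc i) * c i.succ
            else c j.succ) := by
    intro i
    funext j
    refine Fin.cases ?_ (fun j => ?_) j
    · simp
    · simp [← Fin.succ_castSucc]
  have e3 : (fun j : Fin (q + 1) => (Fin.cons k c : Fin (q + 2) → G) (Fin.castSucc j)) = Fin.cons k (fun j : Fin q => c (Fin.castSucc j)) := by
    funext j
    refine Fin.cases ?_ (fun j => ?_) j
    · simp
    · simp [← Fin.succ_castSucc]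
  rw [e1, e3]
  simp only [e2]
  have e4 : ∀ (f : Fin (q + 1) → G) (r : ℕ), Finsupp.single f ((-1 : ℤ) ^ (r + 1)) = - Finsupp.single f ((-1 : ℤ) ^ r) := fun f r => by
    rw [pow_succ, mul_neg_one, Finsupp.single_neg]
  simp only [Fin.val_succ, e4 _ (_ + 1), Finset.sum_neg_distrib]
  simp
  abel

theorem mp_E0 : ∀ {q : ℕ} (g : Tup G (q + 1)) (m : ℤ), mp tf (E0 g m) = m • bT q (tf g)
  | 0, g, m => by
    show mp tf ((-(sg tn : ℤ →+ _)) m) = _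
    rw [AddMonoidHom.neg_apply, map_neg, sg_apply, mp_single]
    simp only [bT]
    simp
  | q + 1, g, m => by
    obtain ⟨k, g, rfl⟩ := tup_succ g
    have ih := mp_E0 g
    obtain ⟨l, g, rfl⟩ := tup_succ g
    show mp tf ((-(sg (tc (k * l) g)) - (consL k).comp (E0 (tc l g)) : ℤ →+ _) m) = _
    rw [AddMonoidHom.sub_apply, AddMonoidHom.neg_apply, AddMonoidHom.comp_apply, sg_apply, map_sub, map_neg, mp_single]
    have h1 : ∀ c : Tup G q →₀ ℤ, mp tf (consL k c) = mp (cF q k) (mp tf c) := fun c =>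
      hom_ext_apply ((mp tf).comp (consL k)) ((mp (cF q k)).comp (mp tf)) (fun g m => by
        simp only [AddMonoidHom.comp_apply, consL_single, mp_single]; rfl) c
    rw [h1, ih]
    show _ = m • bT (q + 1) (Fin.cons k (tf (tc l g)))
    rw [bT_cons, map_zsmul, smul_sub, smul_neg, Finsupp.smul_single]
    simp [tf]

theorem mp_dd {q : ℕ} (c : Ch (trivM G) (q + 1)) : mp tf (dd (trivM G) c) = barDiff ℤ G q (mp tf c) := by
  refine hom_ext_apply ((mp tf).comp (dd (trivM G))) ((barDiff ℤ G q).toAddMonoidHom.comp (mp tf)) (fun g m => ?_) c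
  obtain ⟨k, g, rfl⟩ := tup_succ g
  show mp tf (dd (trivM G) (Finsupp.single (tc k g) m)) = barDiff ℤ G q (mp tf (Finsupp.single (tc k g) m))
  rw [mp_single, barDiff_single, smul_add, ← mp_E0, ← consL_single, dd_cons, map_add]
  congr 1
  · have : actL (trivM G) k⁻¹ (Finsupp.single g m) = Finsupp.single g m := by
      simp only [actL, lin_single]; rfl
    rw [this, mp_single, Finsupp.smul_single]
    simp [tf]
  · rw [consL_single]
    simp only [EL, lin_single]

theorem mp_tf_ft {q : ℕ} (c : (Fin q → G) →₀ ℤ) : mp tf (mp (ft q) c) = c :=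
  hom_ext_apply ((mp tf).comp (mp (ft q))) (AddMonoidHom.id _) (fun g m => by
    simp only [AddMonoidHom.comp_apply, mp_single, tf_ft]; rfl) c
theorem mp_ft_tf {q : ℕ} (c : Tup G q →₀ ℤ) : mp (ft q) (mp tf c) = c :=
  hom_ext_apply ((mp (ft q)).comp (mp tf)) (AddMonoidHom.id _) (fun g m => by
    simp only [AddMonoidHom.comp_apply, mp_single, ft_tf]; rfl) c

theorem cyc_iff {q : ℕ} (c : Ch (trivM G) q) : mp tf c ∈ barCycles ℤ G q ↔ c ∈ cyc (trivM G) q := by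
  cases q with
  | zero => exact ⟨fun _ => trivial, fun _ => trivial⟩
  | succ q =>
    show barDiff ℤ G q (mp tf c) = 0 ↔ dd (trivM G) c = 0
    rw [← mp_dd]
    constructor
    · intro h
      have h' := congrArg (mp (ft q)) h
      rw [map_zero] at h'
      exact (mp_ft_tf _).symm.trans h'
    · intro h
      rw [h]; exact map_zero _
theorem bnd_iff {q : ℕ} (c : Ch (trivM G) q) : mp tf c ∈ barBoundaries ℤ G q ↔ ∃ b, dd (trivM G) b = c := by
  constructor
  · rintro ⟨b, hb⟩
    refine ⟨mp (ft _) b, ?_⟩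
    have : mp tf (dd (trivM G) (mp (ft _) b)) = mp tf c := by
      rw [mp_dd, mp_tf_ft, hb]
    have h' := congrArg (mp (ft q)) this
    exact (mp_ft_tf _).symm.trans (h'.trans (mp_ft_tf _))
  · rintro ⟨b, rfl⟩
    exact ⟨mp tf b, (mp_dd b).symm⟩

theorem barMap_mp (j : G' →* G) {q : ℕ} (c : Ch (trivM G') q) : barMap ℤ j q (mp tf c) = mp tf (mapC (trivH j) c) := by
  refine hom_ext_apply ((barMap ℤ j q).toAddMonoidHom.comp (mp tf)) ((mp tf).comp (mapC (trivH j))) (fun g m => ?_) c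
  show barMap ℤ j q (mp tf (Finsupp.single g m)) = mp tf (mapC (trivH j) (Finsupp.single g m))
  rw [mp_single, mapC_single]
  refine Eq.trans ?_ (mp_single (X := Tup G q) tf (tmap j g) m).symm
  rw [tf_tmap]
  simp [barMap, Finsupp.mapDomain_single]

theorem bar_surj (j : G' →* G) {k : ℕ} (h : Function.Surjective (Hm (trivH j) k)) : BarInducedSurj ℤ j k := by
  intro z hz
  rw [← mp_tf_ft z] at hz ⊢
  generalize mp (ft k) z = c at *
  have hc := (cyc_iff (G := G) c).1 hz
  obtain ⟨y, hy⟩ := h (cls ⟨c, hc⟩)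
  obtain ⟨w, hw, rfl⟩ := cls_surj y
  rw [Hm_cls] at hy
  obtain ⟨b, hb⟩ := cls_eq.1 hy.symm
  refine ⟨mp tf w, (cyc_iff w).2 hw, ?_⟩
  rw [barMap_mp]
  have := (bnd_iff (G := G) (c - mapC (trivH j) w)).2 ⟨b, hb⟩
  rwa [map_sub] at this

theorem bar_inj (j : G' →* G) {k : ℕ} (h : Function.Injective (Hm (trivH j) k)) : BarInducedInj ℤ j k := by
  intro w hw hb
  rw [← mp_tf_ft w] at hw hb ⊢
  generalize mp (ft k) w = c at *
  have hc := (cyc_iff (G := G') c).1 hw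
  rw [barMap_mp] at hb
  obtain ⟨b, hb⟩ := (bnd_iff (G := G) _).1 hb
  have h1 : Hm (trivH j) k (cls ⟨c, hc⟩) = 0 := by
    rw [Hm_cls]
    exact cls_eq_zero.2 ⟨b, hb⟩
  rw [← map_zero (Hm (trivH j) k)] at h1
  obtain ⟨b', hb'⟩ := cls_eq_zero.1 (h h1)
  exact (bnd_iff c).2 ⟨b', hb'⟩
end bridge

end P18

section P19
open Tup
open Matrix
/-! ### the hyperbolic space -/
section hyp
variable (K : Type) [Field K]

noncomputable def hb (m : ℕ) : (Fin m ⊕ Fin m → K) →ₗ[K] (Fin m ⊕ Fin m → K) →ₗ[K] K := Matrix.toLinearMap₂' K (Hmat K m)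

theorem hb_dot (m : ℕ) (x y : Fin m ⊕ Fin m → K) : hb K m x y = x ⬝ᵥ (Hmat K m *ᵥ y) :=
  Matrix.toLinearMap₂'_apply' _ _ _

theorem hb_apply (m : ℕ) (x y : Fin m ⊕ Fin m → K) :
    hb K m x y = (∑ i, x (Sum.inl i) * y (Sum.inr i)) + ∑ i, x (Sum.inr i) * y (Sum.inl i) := by
  rw [hb_dot, Hmat, Matrix.fromBlocks_mulVec]
  simp [dotProduct]

noncomputable def hG (m : ℕ) : Geo K (Fin m ⊕ Fin m → K) where
  b := hb K m
  symm x y := by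
    rw [hb_apply, hb_apply, add_comm]
    simp only [mul_comm]
  even x := ⟨∑ i, x (Sum.inl i) * x (Sum.inr i), by
    rw [hb_apply, two_mul]
    congr 1
    simp only [mul_comm]⟩

theorem hG_b (m : ℕ) (x y : Fin m ⊕ Fin m → K) :
    (hG K m).b x y = (∑ i, x (Sum.inl i) * y (Sum.inr i)) + ∑ i, x (Sum.inr i) * y (Sum.inl i) := hb_apply K m x y

theorem hG_inl (m : ℕ) (x : Fin m ⊕ Fin m → K) (i : Fin m) : (hG K m).b x (Pi.single (Sum.inl i) 1) = x (Sum.inr i) := by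
  rw [hG_b]
  simp [Pi.single_apply]
theorem hG_inr (m : ℕ) (x : Fin m ⊕ Fin m → K) (i : Fin m) : (hG K m).b x (Pi.single (Sum.inr i) 1) = x (Sum.inl i) := by
  rw [hG_b]
  simp [Pi.single_apply]

theorem hG_Wi (m : ℕ) : (hG K m).Wi ∅ m := by
  let f : (Fin m → K) →ₗ[K] (Fin m ⊕ Fin m → K) :=
    { toFun := fun v => Sum.elim v 0
      map_add' := fun v w => by funext i; cases i <;> simp
      map_smul' := fun c v => by funext i; cases i <;> simp }
  have hf : Function.Injective f := fun v w h => funext fun i => congrFun h (Sum.inl i)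
  refine ⟨LinearMap.range f, fun x _ s hs => absurd hs (Set.notMem_empty s), ?_, ?_, ?_⟩
  · rintro _ ⟨v, rfl⟩ _ ⟨w, rfl⟩
    rw [hG_b]
    simp [f]
  · rw [LinearMap.finrank_range_of_inj hf]; simp
  · rintro _ ⟨v, rfl⟩ h
    have : v = 0 := funext fun i => by
      have := h (Pi.single (Sum.inr i) 1) (fun s hs => absurd hs (Set.notMem_empty s))
      rwa [hG_inr] at this
    rw [this, map_zero]

noncomputable def muE (m : ℕ) : GL (Fin m ⊕ Fin m) K ≃* ((Fin m ⊕ Fin m → K) ≃ₗ[K] (Fin m ⊕ Fin m → K)) :=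
  Matrix.GeneralLinearGroup.toLin.trans (LinearMap.GeneralLinearGroup.generalLinearEquiv K _)

theorem muE_apply (m : ℕ) (A : GL (Fin m ⊕ Fin m) K) (x : Fin m ⊕ Fin m → K) : muE K m A x = A.val *ᵥ x := rfl

theorem muE_det (m : ℕ) (A : GL (Fin m ⊕ Fin m) K) : ((LinearEquiv.det (muE K m A) : Kˣ) : K) = A.val.det := by
  rw [LinearEquiv.coe_det, ← LinearMap.det_toLin']
  rfl

theorem form_iff (m : ℕ) (A : Matrix (Fin m ⊕ Fin m) (Fin m ⊕ Fin m) K) :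
    (∀ x y, (hG K m).b (A *ᵥ x) (A *ᵥ y) = (hG K m).b x y) ↔ Aᵀ * Hmat K m * A = Hmat K m := by
  have h1 : ∀ x y, (hG K m).b (A *ᵥ x) (A *ᵥ y) = Matrix.toLinearMap₂' K (Aᵀ * Hmat K m * A) x y := fun x y => by
    rw [Matrix.toLinearMap₂'_apply']
    refine (hb_dot K m _ _).trans ?_
    rw [← Matrix.mulVec_mulVec, ← Matrix.mulVec_mulVec, Matrix.dotProduct_mulVec x, Matrix.vecMul_transpose]
  constructor
  · intro h
    apply (Matrix.toLinearMap₂' (S₁ := K) (S₂ := K) (N₂ := K) (n := Fin m ⊕ Fin m) (m := Fin m ⊕ Fin m) K).injective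
    refine LinearMap.ext fun x => LinearMap.ext fun y => ?_
    rw [← h1, h]; rfl
  · intro h x y
    rw [h1, h]; rfl

theorem mem_GS (m : ℕ) (A : GL (Fin m ⊕ Fin m) K) : muE K m A ∈ (hG K m).GS ∅ ↔ A ∈ SOGroup K m := by
  rw [mem_soGroup_iff, ← form_iff, ← muE_det, ← Units.val_one, Units.val_inj]
  exact ⟨fun h => ⟨h.1, h.2.1⟩, fun h => ⟨h.1, h.2, fun s hs => absurd hs (Set.notMem_empty s)⟩⟩

noncomputable def kaE (m : ℕ) : SOGroup K m ≃* (hG K m).GS ∅ where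
  toFun A := ⟨muE K m A.1, (mem_GS K m A.1).2 A.2⟩
  invFun g := ⟨(muE K m).symm g.1, (mem_GS K m _).1 (by rw [MulEquiv.apply_symm_apply]; exact g.2)⟩
  left_inv A := Subtype.ext (MulEquiv.symm_apply_apply _ _)
  right_inv A := Subtype.ext (MulEquiv.apply_symm_apply _ _)
  map_mul' A B := Subtype.ext (map_mul _ _ _)

theorem embMat_mul (n : ℕ) (A B : Matrix (Fin n ⊕ Fin n) (Fin n ⊕ Fin n) K) : embMat K n (A * B) = embMat K n A * embMat K n B := by
  simp [embMat, Matrix.submatrix_mul_equiv, Matrix.fromBlocks_multiply]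

noncomputable def emH (n : ℕ) : SOGroup K n →* SOGroup K (n + 1) :=
  MonoidHom.mk' (embSO K n) fun A B => Subtype.ext (Units.ext (embMat_mul K n _ _))

theorem embMat_sub (n : ℕ) (A : Matrix (Fin n ⊕ Fin n) (Fin n ⊕ Fin n) K) :
    (embMat K n A).submatrix (sumEquiv n) (sumEquiv n) = Matrix.fromBlocks A 0 0 1 := by
  simp [embMat, Matrix.submatrix_submatrix]

theorem emH_inj (n : ℕ) : Function.Injective (emH K n) := by
  intro A B h
  have h1 : embMat K n A.1.val = embMat K n B.1.val := congrArg (fun t : SOGroup K (n + 1) => t.1.val) h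
  have h2 := congrArg (fun M => M.submatrix (sumEquiv n) (sumEquiv n)) h1
  simp only [embMat_sub] at h2
  exact Subtype.ext (Units.ext (Matrix.fromBlocks_inj.1 h2).1)

/-- the base pair -/
def x0 (n : ℕ) : (Fin (n + 1) ⊕ Fin (n + 1) → K) × (Fin (n + 1) ⊕ Fin (n + 1) → K) :=
  (Pi.single (Sum.inl (Fin.last n)) 1, Pi.single (Sum.inr (Fin.last n)) 1)

theorem x0_mem (n : ℕ) : x0 K n ∈ (hG K (n + 1)).W0 ∅ := by
  refine ⟨fun s hs => absurd hs (Set.notMem_empty s), fun s hs => absurd hs (Set.notMem_empty s), ?_, ?_, ?_⟩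
  · simp only [x0, hG_inl]; simp
  · simp only [x0, hG_inr]; simp
  · simp only [x0, hG_inr]; simp

theorem sE_l (n : ℕ) : sumEquiv n (Sum.inr (Sum.inl 0)) = Sum.inl (Fin.last n) := rfl
theorem sE_r (n : ℕ) : sumEquiv n (Sum.inr (Sum.inr 0)) = Sum.inr (Fin.last n) := rfl

theorem emH_fix (n : ℕ) (A : SOGroup K n) : pr (kaE K (n + 1) (emH K n A)).1 (x0 K n) = x0 K n := by
  have h : ∀ p q, embMat K n A.1.val (sumEquiv n p) (sumEquiv n q) = Matrix.fromBlocks A.1.val 0 0 1 p q := fun p q =>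
    congrFun (congrFun (embMat_sub K n A.1) p) q
  refine Prod.ext ?_ ?_
  · show embMat K n A.1.val *ᵥ (Pi.single (Sum.inl (Fin.last n)) 1) = Pi.single (Sum.inl (Fin.last n)) 1
    rw [Matrix.mulVec_single_one, ← sE_l]
    funext p
    obtain ⟨p, rfl⟩ := (sumEquiv n).surjective p
    rw [Matrix.col_apply, h]
    rcases p with p | (p | p)
    · simp [Pi.single_apply]
    · obtain rfl := Subsingleton.elim 0 p
      simp [Pi.single_apply, Matrix.one_apply]
    · obtain rfl := Subsingleton.elim 0 p
      simp [Pi.single_apply, Matrix.one_apply]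
  · show embMat K n A.1.val *ᵥ (Pi.single (Sum.inr (Fin.last n)) 1) = Pi.single (Sum.inr (Fin.last n)) 1
    rw [Matrix.mulVec_single_one, ← sE_r]
    funext p
    obtain ⟨p, rfl⟩ := (sumEquiv n).surjective p
    rw [Matrix.col_apply, h]
    rcases p with p | (p | p)
    · simp [Pi.single_apply]
    · obtain rfl := Subsingleton.elim 0 p
      simp [Pi.single_apply, Matrix.one_apply]
    · obtain rfl := Subsingleton.elim 0 p
      simp [Pi.single_apply, Matrix.one_apply]

theorem emH_st (n : ℕ) (g : (hG K (n + 1)).GS ∅) (hg : pr g.1 (x0 K n) = x0 K n) : ∃ A, kaE K (n + 1) (emH K n A) = g := by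
  obtain ⟨B, rfl⟩ := (kaE K (n + 1)).surjective g
  have hB := (mem_soGroup_iff K (n + 1) B.1).1 B.2
  have c1 : B.1.val *ᵥ (Pi.single (Sum.inl (Fin.last n)) 1) = Pi.single (Sum.inl (Fin.last n)) 1 := congrArg Prod.fst hg
  have c2 : B.1.val *ᵥ (Pi.single (Sum.inr (Fin.last n)) 1) = Pi.single (Sum.inr (Fin.last n)) 1 := congrArg Prod.snd hg
  have hf := (form_iff K (n + 1) _).2 hB.1
  have r1 : ∀ q, B.1.val (Sum.inr (Fin.last n)) q = (Pi.single q (1 : K) : _ → K) (Sum.inr (Fin.last n)) := fun q => by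
    have := hf (Pi.single q 1) (Pi.single (Sum.inl (Fin.last n)) 1)
    rw [c1, hG_inl, hG_inl, Matrix.mulVec_single_one] at this
    exact this
  have r2 : ∀ q, B.1.val (Sum.inl (Fin.last n)) q = (Pi.single q (1 : K) : _ → K) (Sum.inl (Fin.last n)) := fun q => by
    have := hf (Pi.single q 1) (Pi.single (Sum.inr (Fin.last n)) 1)
    rw [c2, hG_inr, hG_inr, Matrix.mulVec_single_one] at this
    exact this
  rw [Matrix.mulVec_single_one] at c1 c2
  have s1 : ∀ p, B.1.val p (Sum.inl (Fin.last n)) = (Pi.single (Sum.inl (Fin.last n)) (1 : K) : _ → K) p := fun p => congrFun c1 p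
  have s2 : ∀ p, B.1.val p (Sum.inr (Fin.last n)) = (Pi.single (Sum.inr (Fin.last n)) (1 : K) : _ → K) p := fun p => congrFun c2 p
  let M := B.1.val.submatrix (sumEquiv n) (sumEquiv n)
  let A := M.toBlocks₁₁
  have hM : M = Matrix.fromBlocks A 0 0 1 := by
    ext p q
    rcases p with p | p
    · rcases q with q | (q | q)
      · rfl
      · show B.1.val (sumEquiv n (Sum.inl p)) (Sum.inl (Fin.last n)) = 0
        rw [s1, ← sE_l, Pi.single_apply, if_neg (fun h => by simpa using (sumEquiv n).injective h)]
      · show B.1.val (sumEquiv n (Sum.inl p)) (Sum.inr (Fin.last n)) = 0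
        rw [s2, ← sE_r, Pi.single_apply, if_neg (fun h => by simpa using (sumEquiv n).injective h)]
    · rcases p with p | p
      · obtain rfl := Subsingleton.elim 0 p
        show B.1.val (Sum.inl (Fin.last n)) (sumEquiv n q) = _
        rw [r2, ← sE_l, Pi.single_apply]
        rcases q with q | q <;> simp [Matrix.one_apply]
      · obtain rfl := Subsingleton.elim 0 p
        show B.1.val (Sum.inr (Fin.last n)) (sumEquiv n q) = _
        rw [r1, ← sE_r, Pi.single_apply]
        rcases q with q | q <;> simp [Matrix.one_apply]
  have hBM : B.1.val = embMat K n A := by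
    rw [embMat, ← hM]
    simp [M, Matrix.submatrix_submatrix]
  have hd : A.det = 1 := by
    have := hB.2
    rw [hBM, embMat, Matrix.det_submatrix_equiv_self, Matrix.det_fromBlocks_zero₂₁] at this
    simpa using this
  have hA : Aᵀ * Hmat K n * A = Hmat K n := by
    have := hB.1
    rw [hBM, ← hmat_decomp K n] at this
    simp only [embMat, Matrix.transpose_submatrix, Matrix.fromBlocks_transpose,
        Matrix.submatrix_mul_equiv, Matrix.fromBlocks_multiply] at this
    have h2 := congrArg (fun M => M.submatrix (sumEquiv n) (sumEquiv n)) this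
    simp [Matrix.submatrix_submatrix] at h2
    exact h2
  refine ⟨⟨Matrix.GeneralLinearGroup.mkOfDetNeZero A (by rw [hd]; exact one_ne_zero), ?_⟩, ?_⟩
  · rw [mem_soGroup_iff]
    exact ⟨hA, hd⟩
  · congr 1
    exact Subtype.ext (Units.ext hBM.symm)

theorem kaE_inj (m i : ℕ) : Function.Injective (Hm (trivH (kaE K m).toMonoidHom) i) := by
  refine Function.LeftInverse.injective (g := Hm (trivH (kaE K m).symm.toMonoidHom) i) fun y => ?_
  rw [← Hm_comp, trivH_comp]
  have : ((kaE K m).symm.toMonoidHom.comp (kaE K m).toMonoidHom) = MonoidHom.id _ := MonoidHom.ext fun A => (kaE K m).symm_apply_apply A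
  rw [this]
  exact Hm_id y

theorem final_core (n i : ℕ) (hn : 2 ≤ n) (hv : Van ((hG K (n + 1)).Rg ∅) i) :
    BarInducedSurj ℤ (embSO K n) (i + 1) ∧ BarInducedInj ℤ (embSO K n) i := by
  have h := (hG K (n + 1)).stable ((hG K (n + 1)).Wi_mono (by omega) (hG_Wi K (n + 1))) ((kaE K (n + 1)).toMonoidHom.comp (emH K n)) (x0 K n)
    (x0_mem K n) ((kaE K (n + 1)).injective.comp (emH_inj K n)) (emH_fix K n) (emH_st K n) i hv
  rw [← trivH_comp] at h
  constructor
  · refine bar_surj (emH K n) fun y => ?_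
    obtain ⟨w, hw⟩ := h.1 (Hm (trivH (kaE K (n + 1)).toMonoidHom) (i + 1) y)
    rw [Hm_comp] at hw
    exact ⟨w, kaE_inj K _ _ hw⟩
  · refine bar_inj (emH K n) fun y y' hy => h.2 ?_
    rw [Hm_comp, Hm_comp, hy]

theorem final (k n : ℕ) (hk : 1 ≤ k) (hn : 1 ≤ n)
    (h : (Infinite K ∧ ((k = 1 ∧ 2 ≤ n) ∨ (2 ≤ k ∧ k ≤ n))) ∨ (Finite K ∧ 2 * k ≤ n)) :
    BarInducedSurj ℤ (embSO K n) k ∧ BarInducedInj ℤ (embSO K n) (k - 1) := by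
  obtain ⟨i, rfl⟩ : ∃ i, k = i + 1 := ⟨k - 1, by omega⟩
  rw [Nat.add_sub_cancel]
  have hW := hG_Wi K (n + 1)
  rcases h with ⟨hi, h⟩ | ⟨hi, h⟩
  · exact final_core K n i (by omega) ((hG K (n + 1)).main_inf i ∅ ((hG K (n + 1)).Wi_mono (by omega) hW))
  · exact final_core K n i (by omega) ((hG K (n + 1)).main_fin i ∅ ((hG K (n + 1)).Wi_mono (by omega) hW))
end hyp

end P19

/-- Let `D` be a field and `k ≥ 1`, `n ≥ 1`.  If `D` is infinite and either
(`k = 1` and `n ≥ 2`) or (`2 ≤ k ≤ n`), or if `D` is finite and `n ≥ 2k`, then the relative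
integral group homology `H_k(SO_{n+1,n+1}(D), SO_{n,n}(D); ℤ)` vanishes; equivalently, the
map `H_k(SO_{n,n}(D); ℤ) → H_k(SO_{n+1,n+1}(D); ℤ)` induced by the hyperbolic embedding is
surjective, and the induced map in degree `k − 1` is injective. -/
theorem statement4 (k n : ℕ) (hk : 1 ≤ k) (hn : 1 ≤ n)
    (h : (Infinite D ∧ ((k = 1 ∧ 2 ≤ n) ∨ (2 ≤ k ∧ k ≤ n))) ∨ (Finite D ∧ 2 * k ≤ n)) :
    BarInducedSurj ℤ (embSO D n) k ∧ BarInducedInj ℤ (embSO D n) (k - 1) := by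
  exact final D k n hk hn h


end Stmt4
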